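/- arXiv:0709.3599 — 3 statements merged into one kernel-verified Lean document; each statement's English description precedes it below -/
import Mathlib

section
/- There is a constant C = C(n) such that for all x ∈ ℝⁿ and t > 0 one has |K_{ij}(x,t)| ≤ C (|x|² + t)^{−n/2} and |K_{ijk}(x,t)| ≤ C (|x|² + t)^{−(n+1)/2} for all indices i, j, k ∈ {1,…,n}. -/
open MeasureTheory Real Filter Topology

noncomputable section

/-- Euclidean space ℝⁿ. -/
abbrev Euc (n : ℕ) := EuclideanSpace ℝ (Fin n)

/-- The heat kernel Γ(x,t) = (4πt)^{-n/2} exp(-|x|²/(4t)). -/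
noncomputable def heatKer (n : ℕ) (x : Euc n) (t : ℝ) : ℝ :=
  (4 * π * t) ^ (-(n : ℝ) / 2) * Real.exp (-‖x‖ ^ 2 / (4 * t))

/-- The fundamental solution G of the Laplacian on ℝⁿ (n ≥ 2). -/
noncomputable def lapFund (n : ℕ) (x : Euc n) : ℝ :=
  if n = 2 then (2 * π)⁻¹ * Real.log ‖x‖
  else -((((n : ℝ) - 2) * (2 * π ^ ((n : ℝ) / 2) / Real.Gamma ((n : ℝ) / 2)))⁻¹) *
      ‖x‖ ^ (2 - (n : ℝ))

/-- The generating function Φ(x,t) = ∫_{ℝⁿ} G(y) Γ(x-y,t) dy. -/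
noncomputable def genPhi (n : ℕ) (x : Euc n) (t : ℝ) : ℝ :=
  ∫ y : Euc n, lapFund n y * heatKer n (x - y) t

/-- Spatial partial derivative ∂f/∂x_i of a scalar function on ℝⁿ. -/
noncomputable def pd (n : ℕ) (i : Fin n) (f : Euc n → ℝ) (x : Euc n) : ℝ :=
  fderiv ℝ f x (EuclideanSpace.single i 1)

/-- The Laplacian of a scalar function on ℝⁿ. -/
noncomputable def lap (n : ℕ) (f : Euc n → ℝ) (x : Euc n) : ℝ :=
  ∑ i : Fin n, pd n i (pd n i f) x

/-- The Oseen kernel K_{ij} = (-δ_{ij}Δ + ∂²/∂x_i∂x_j)Φ. -/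
noncomputable def Kmat (n : ℕ) (i j : Fin n) (x : Euc n) (t : ℝ) : ℝ :=
  (if i = j then -(lap n (fun y => genPhi n y t) x) else 0)
    + pd n i (pd n j (fun y => genPhi n y t)) x

/-- The kernel K_{ijk} = ∂K_{ij}/∂x_k. -/
noncomputable def Kten (n : ℕ) (i j k : Fin n) (x : Euc n) (t : ℝ) : ℝ :=
  pd n k (fun y => Kmat n i j y t) x

/-- Mild solution of the Navier–Stokes equations on ℝⁿ × (t₀,t₁) with initial datum u₀:
u_i(x,t) = ∫ Γ(x-y,t-t₀) u₀ᵢ(y) dy - ∫_{t₀}^t ∫ K_{ijk}(x-y,t-s) u_k u_j dy ds. -/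
def IsMildNS (n : ℕ) (t₀ t₁ : ℝ) (u₀ : Euc n → Euc n) (u : Euc n → ℝ → Euc n) : Prop :=
  ∀ x : Euc n, ∀ t : ℝ, t ∈ Set.Ioo t₀ t₁ → ∀ i : Fin n,
    u x t i = (∫ y : Euc n, heatKer n (x - y) (t - t₀) * u₀ y i)
      - ∫ s in Set.Ioo t₀ t, ∫ y : Euc n,
          ∑ j : Fin n, ∑ k : Fin n, Kten n i j k (x - y) (t - s) * u y s k * u y s j

/-- Spatial partial derivative for functions on space-time ℝⁿ × ℝ. -/
noncomputable def pdx (n : ℕ) (i : Fin n) (g : Euc n × ℝ → ℝ) (p : Euc n × ℝ) : ℝ :=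
  fderiv ℝ g p (EuclideanSpace.single i 1, 0)

/-- Time derivative for functions on space-time ℝⁿ × ℝ. -/
noncomputable def pdt (n : ℕ) (g : Euc n × ℝ → ℝ) (p : Euc n × ℝ) : ℝ :=
  fderiv ℝ g p (0, 1)

/-- Spatial Laplacian for functions on space-time ℝⁿ × ℝ. -/
noncomputable def lapx (n : ℕ) (g : Euc n × ℝ → ℝ) (p : Euc n × ℝ) : ℝ :=
  ∑ i : Fin n, pdx n i (pdx n i g) p

lemma heatKer_pos {n : ℕ} (x : Euc n) {t : ℝ} (ht : 0 < t) : 0 < heatKer n x t := by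
  unfold heatKer; positivity

lemma one_add_rpow_mul_exp_le (β : ℝ) :
    ∃ C > (0:ℝ), ∀ w : ℝ, 0 ≤ w → (1 + w) ^ β * Real.exp (-w / 4) ≤ C := by
  obtain ⟨N, hN⟩ := exists_nat_ge β
  refine ⟨4 ^ N * N.factorial * Real.exp (1 / 4), by positivity, fun w hw => ?_⟩
  have h1 : (1 + w) ^ β ≤ (1 + w) ^ N := by
    rw [← Real.rpow_natCast]
    exact Real.rpow_le_rpow_of_exponent_le (by linarith) hN
  have h2 := Real.pow_div_factorial_le_exp ((1 + w) / 4) (by positivity) N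
  rw [div_le_iff₀ (by positivity), div_pow, div_le_iff₀ (by positivity)] at h2
  calc (1 + w) ^ β * Real.exp (-w / 4)
      ≤ (Real.exp ((1 + w) / 4) * N.factorial * 4 ^ N) * Real.exp (-w / 4) := by
        gcongr; exact h1.trans h2
    _ = 4 ^ N * N.factorial * (Real.exp ((1 + w) / 4) * Real.exp (-w / 4)) := by ring
    _ = 4 ^ N * N.factorial * Real.exp (1 / 4) := by
        rw [← Real.exp_add]; ring_nf

/-- Polynomially weighted heat kernels decay like a power of `|x|² + s`. -/
lemma norm_pow_mul_heatKer_le (n a b : ℕ) :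
    ∃ C > (0:ℝ), ∀ (x : Euc n) (s : ℝ), 0 < s →
      ‖x‖ ^ a / s ^ b * heatKer n x s ≤
        C * (s + ‖x‖ ^ 2) ^ ((a : ℝ) / 2 - b - n / 2) := by
  obtain ⟨C, hC, h⟩ := one_add_rpow_mul_exp_le ((b : ℝ) + n / 2)
  refine ⟨(4 * π) ^ (-(n : ℝ) / 2) * C, by positivity, fun x s hs => ?_⟩
  have h1 := h (‖x‖ ^ 2 / s) (by positivity)
  have hp : 0 < s + ‖x‖ ^ 2 := by positivity
  have e1 : 1 + ‖x‖ ^ 2 / s = (s + ‖x‖ ^ 2) / s := by field_simp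
  have e2 : -(‖x‖ ^ 2 / s) / 4 = -‖x‖ ^ 2 / (4 * s) := by field_simp
  rw [e1, e2, Real.div_rpow hp.le hs.le, div_mul_eq_mul_div, div_le_iff₀ (by positivity)] at h1
  have h2 : Real.exp (-‖x‖ ^ 2 / (4 * s)) ≤
      C * s ^ ((b : ℝ) + n / 2) * (s + ‖x‖ ^ 2) ^ (-((b : ℝ) + n / 2)) := by
    rw [Real.rpow_neg hp.le, ← div_eq_mul_inv, le_div_iff₀ (by positivity)]
    linarith
  have h3 : ‖x‖ ^ a ≤ (s + ‖x‖ ^ 2) ^ ((a : ℝ) / 2) := by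
    calc ‖x‖ ^ a = (‖x‖ ^ 2) ^ ((a : ℝ) / 2) := by
          rw [← Real.rpow_natCast, ← Real.rpow_natCast, ← Real.rpow_mul (norm_nonneg _)]
          congr 1; push_cast; ring
      _ ≤ _ := by gcongr; linarith
  have e3 : s ^ ((b : ℝ) + n / 2) * s ^ (-(n : ℝ) / 2) = s ^ b := by
    rw [← Real.rpow_add hs, ← Real.rpow_natCast]; congr 1; ring
  unfold heatKer
  rw [Real.mul_rpow (by positivity) hs.le]
  calc _ ≤ (s + ‖x‖ ^ 2) ^ ((a : ℝ) / 2) / s ^ b * ((4 * π) ^ (-(n : ℝ) / 2) * s ^ (-(n : ℝ) / 2) *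
        (C * s ^ ((b : ℝ) + n / 2) * (s + ‖x‖ ^ 2) ^ (-((b : ℝ) + n / 2)))) := by gcongr
    _ = (4 * π) ^ (-(n : ℝ) / 2) * C * ((s ^ ((b : ℝ) + n / 2) * s ^ (-(n : ℝ) / 2)) / s ^ b) *
        ((s + ‖x‖ ^ 2) ^ ((a : ℝ) / 2) * (s + ‖x‖ ^ 2) ^ (-((b : ℝ) + n / 2))) := by ring
    _ = _ := by
        rw [e3, div_self (by positivity), ← Real.rpow_add hp, mul_one]
        congr 2; ring

lemma heatKer_le (n : ℕ) : ∃ C > (0:ℝ), ∀ (x : Euc n) (s : ℝ), 0 < s →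
    heatKer n x s ≤ C * (s + ‖x‖ ^ 2) ^ (-(n : ℝ) / 2) := by
  obtain ⟨C, hC, h⟩ := norm_pow_mul_heatKer_le n 0 0
  refine ⟨C, hC, fun x s hs => ?_⟩
  have := h x s hs
  simp only [pow_zero, div_one, one_mul] at this
  convert this using 3
  push_cast; ring

/-- The product of two heat kernels is a Gaussian, by completing the square. -/
lemma heatKer_mul_heatKer (n : ℕ) (x y : Euc n) {s t : ℝ} (hs : 0 < s) (ht : 0 < t) :
    heatKer n y s * heatKer n (x - y) t =
      heatKer n x (s + t) * ((π / ((s + t) / (4 * s * t))) ^ (-(n : ℝ) / 2) *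
        Real.exp (-((s + t) / (4 * s * t)) * ‖y - (s / (s + t)) • x‖ ^ 2)) := by
  have hst : 0 < s + t := by positivity
  have e1 : (4 * π * s) ^ (-(n : ℝ) / 2) * (4 * π * t) ^ (-(n : ℝ) / 2) =
      (4 * π * (s + t)) ^ (-(n : ℝ) / 2) * (π / ((s + t) / (4 * s * t))) ^ (-(n : ℝ) / 2) := by
    rw [← Real.mul_rpow (by positivity) (by positivity),
      ← Real.mul_rpow (by positivity) (by positivity)]
    congr 1; field_simp
  have e2 : Real.exp (-‖y‖ ^ 2 / (4 * s)) * Real.exp (-‖x - y‖ ^ 2 / (4 * t)) =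
      Real.exp (-‖x‖ ^ 2 / (4 * (s + t))) *
        Real.exp (-((s + t) / (4 * s * t)) * ‖y - (s / (s + t)) • x‖ ^ 2) := by
    rw [← Real.exp_add, ← Real.exp_add, norm_sub_sq_real, norm_sub_sq_real, norm_smul,
      inner_smul_right, real_inner_comm, Real.norm_eq_abs, mul_pow, sq_abs]
    congr 1; field_simp; ring
  unfold heatKer
  calc _ = ((4 * π * s) ^ (-(n : ℝ) / 2) * (4 * π * t) ^ (-(n : ℝ) / 2)) *
        (Real.exp (-‖y‖ ^ 2 / (4 * s)) * Real.exp (-‖x - y‖ ^ 2 / (4 * t))) := by ring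
    _ = _ := by rw [e1, e2]; ring

lemma integral_heatKer_mul_heatKer (n : ℕ) (x : Euc n) {s t : ℝ} (hs : 0 < s) (ht : 0 < t) :
    ∫ y, heatKer n y s * heatKer n (x - y) t = heatKer n x (s + t) := by
  simp_rw [heatKer_mul_heatKer n x _ hs ht]
  have hb : 0 < (s + t) / (4 * s * t) := by positivity
  rw [integral_const_mul, integral_const_mul,
    integral_sub_right_eq_self
      (fun y : Euc n => Real.exp (-((s + t) / (4 * s * t)) * ‖y‖ ^ 2)),
    GaussianFourier.integral_rexp_neg_mul_sq_norm hb, finrank_euclideanSpace_fin,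
    ← Real.rpow_add (by positivity)]
  ring_nf
  simp

lemma integral_heatKer (n : ℕ) (x : Euc n) {t : ℝ} (ht : 0 < t) :
    ∫ y, heatKer n (x - y) t = 1 := by
  rw [integral_sub_left_eq_self (fun y : Euc n => heatKer n y t) _ x]
  unfold heatKer
  have h : ∀ y : Euc n, -‖y‖ ^ 2 / (4 * t) = -(1 / (4 * t)) * ‖y‖ ^ 2 := fun y => by ring
  simp_rw [h]
  rw [integral_const_mul, GaussianFourier.integral_rexp_neg_mul_sq_norm (by positivity),
    finrank_euclideanSpace_fin, div_div_eq_mul_div, div_one, mul_comm π, mul_right_comm,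
    ← Real.rpow_add (by positivity)]
  ring_nf
  simp

lemma integrable_heatKer_mul_heatKer (n : ℕ) (x : Euc n) {s t : ℝ} (hs : 0 < s) (ht : 0 < t) :
    Integrable fun y => heatKer n y s * heatKer n (x - y) t := by
  by_contra h
  have := integral_heatKer_mul_heatKer n x hs ht
  rw [integral_undef h] at this
  exact (heatKer_pos x (add_pos hs ht)).ne this

lemma integrable_heatKer (n : ℕ) (x : Euc n) {t : ℝ} (ht : 0 < t) :
    Integrable fun y => heatKer n (x - y) t := by
  by_contra h
  have := integral_heatKer n x ht
  rw [integral_undef h] at this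
  exact zero_ne_one this

lemma measurable_heatKer (n : ℕ) : Measurable fun p : Euc n × ℝ => heatKer n p.1 p.2 := by
  unfold heatKer
  fun_prop

lemma heatKer_two (y : Euc 2) (s : ℝ) :
    heatKer 2 y s = (4 * π * s)⁻¹ * Real.exp (-‖y‖ ^ 2 / (4 * s)) := by
  unfold heatKer
  rw [← Real.rpow_neg_one]
  norm_num

/-- The renormalization that makes the time integral of the heat kernel converge when `n = 2`. -/
noncomputable def renorm (n : ℕ) (s : ℝ) : ℝ :=
  if n = 2 then (4 * π * s)⁻¹ * Real.exp (-1 / (4 * s)) else 0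

lemma measurable_renorm (n : ℕ) : Measurable (renorm n) := by
  unfold renorm
  split_ifs <;> fun_prop

lemma integrableOn_Ioi_of_bounds {f : ℝ → ℝ}
    (hf : AEStronglyMeasurable f (volume.restrict (Set.Ioi 0))) {A B : ℝ}
    (hA : ∀ s, 0 < s → s ≤ 1 → |f s| ≤ A) (hB : ∀ s, 1 ≤ s → |f s| ≤ B / s ^ 2) :
    IntegrableOn f (Set.Ioi 0) := by
  rw [← Set.Ioc_union_Ioi_eq_Ioi zero_le_one]
  refine IntegrableOn.union ?_ ?_
  · refine (integrableOn_const (C := A) (s := Set.Ioc (0:ℝ) 1) (by simp)).mono'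
      (hf.mono_measure (Measure.restrict_mono Set.Ioc_subset_Ioi_self le_rfl)) ?_
    filter_upwards [ae_restrict_mem measurableSet_Ioc] with s hs using hA s hs.1 hs.2
  · have h2 : IntegrableOn (fun s : ℝ => B * s ^ (-2 : ℝ)) (Set.Ioi 1) :=
      (integrableOn_Ioi_rpow_of_lt (by norm_num) zero_lt_one).const_mul B
    refine h2.mono' (hf.mono_measure
      (Measure.restrict_mono (Set.Ioi_subset_Ioi zero_le_one) le_rfl)) ?_
    filter_upwards [ae_restrict_mem measurableSet_Ioi] with s hs
    have hs' : (1:ℝ) < s := hs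
    have := hB s hs'.le
    rwa [Real.rpow_neg (by positivity), Real.rpow_two, ← div_eq_mul_inv]

lemma inv_mul_exp_neg_le {c s : ℝ} (hc : 0 < c) (hs : 0 < s) :
    (4 * π * s)⁻¹ * Real.exp (-c / (4 * s)) ≤ c⁻¹ := by
  have h1 : c / (4 * s) ≤ Real.exp (c / (4 * s)) := by
    linarith [Real.add_one_le_exp (c / (4 * s))]
  have h2 : -c / (4 * s) = -(c / (4 * s)) := by ring
  rw [h2, Real.exp_neg, ← mul_inv]
  refine inv_anti₀ hc ?_
  calc c = 1 * (4 * s) * (c / (4 * s)) := by field_simp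
    _ ≤ π * (4 * s) * Real.exp (c / (4 * s)) := by
        gcongr
        linarith [Real.pi_gt_three]
    _ = _ := by ring

lemma inv_mul_one_sub_exp_le {c s : ℝ} (hc : 0 ≤ c) (hs : 0 < s) :
    (4 * π * s)⁻¹ * (1 - Real.exp (-c / (4 * s))) ≤ c / s ^ 2 := by
  have h1 : 1 - Real.exp (-c / (4 * s)) ≤ c / (4 * s) := by
    have := Real.add_one_le_exp (-c / (4 * s))
    have e : -c / (4 * s) = -(c / (4 * s)) := by ring
    linarith
  calc _ ≤ (4 * π * s)⁻¹ * (c / (4 * s)) := by gcongr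
    _ = (c / s ^ 2) * (16 * π)⁻¹ := by field_simp; ring
    _ ≤ (c / s ^ 2) * 1 := by
        gcongr
        exact inv_le_one_of_one_le₀ (by linarith [Real.pi_gt_three])
    _ = _ := mul_one _

lemma exp_neg_div_le_one {c s : ℝ} (hc : 0 ≤ c) (hs : 0 < s) :
    Real.exp (-c / (4 * s)) ≤ 1 := by
  rw [Real.exp_le_one_iff, neg_div]
  have : 0 ≤ c / (4 * s) := by positivity
  linarith

lemma integral_inv_mul_exp_sub_exp {c : ℝ} (hc : 0 < c) :
    ∫ s in Set.Ioi (0:ℝ), ((4 * π * s)⁻¹ * Real.exp (-1 / (4 * s)) -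
      (4 * π * s)⁻¹ * Real.exp (-c / (4 * s))) = (4 * π)⁻¹ * Real.log c := by
  have hint : IntegrableOn (fun s => (4 * π * s)⁻¹ * Real.exp (-1 / (4 * s)) -
      (4 * π * s)⁻¹ * Real.exp (-c / (4 * s))) (Set.Ioi 0) := by
    refine integrableOn_Ioi_of_bounds (A := 1⁻¹ + c⁻¹) (B := 1 + c)
      (Measurable.aestronglyMeasurable (by fun_prop)) (fun s hs _ => ?_) (fun s hs => ?_)
    · have h1 := inv_mul_exp_neg_le one_pos hs
      have h2 := inv_mul_exp_neg_le hc hs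
      have h3 : 0 ≤ (4 * π * s)⁻¹ * Real.exp (-1 / (4 * s)) := by positivity
      have h4 : 0 ≤ (4 * π * s)⁻¹ * Real.exp (-c / (4 * s)) := by positivity
      rw [abs_le]; constructor <;> linarith
    · have hs : 0 < s := by linarith
      have h1 := inv_mul_one_sub_exp_le zero_le_one hs
      have h2 := inv_mul_one_sub_exp_le hc.le hs
      have h3 := mul_nonneg (by positivity : 0 ≤ (4 * π * s)⁻¹)
        (sub_nonneg.2 (exp_neg_div_le_one zero_le_one hs))
      have h4 := mul_nonneg (by positivity : 0 ≤ (4 * π * s)⁻¹)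
        (sub_nonneg.2 (exp_neg_div_le_one hc.le hs))
      rw [add_div]
      rw [abs_le]; constructor <;> linarith
  have hcont : ContinuousOn (fun x : ℝ => Real.exp (-x⁻¹)) (Set.Ioi 0) := by
    refine Real.continuous_exp.comp_continuousOn (ContinuousOn.neg ?_)
    exact continuousOn_inv₀.mono fun x hx => (ne_of_gt hx : x ≠ 0)
  have e : ∀ s ∈ Set.Ioi (0:ℝ), (4 * π * s)⁻¹ * Real.exp (-1 / (4 * s)) -
      (4 * π * s)⁻¹ * Real.exp (-c / (4 * s)) =
      (4 * π)⁻¹ * (s⁻¹ • (Real.exp (-(4 * s)⁻¹) - Real.exp (-(4 / c * s)⁻¹))) := fun s hs => by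
    have hs' : 0 < s := hs
    have e1 : -1 / (4 * s) = -(4 * s)⁻¹ := by field_simp
    have e2 : -c / (4 * s) = -(4 / c * s)⁻¹ := by field_simp
    rw [e1, e2, smul_eq_mul]
    field_simp
  have hint' : IntegrableOn
      (fun s : ℝ => s⁻¹ • (Real.exp (-(4 * s)⁻¹) - Real.exp (-(4 / c * s)⁻¹))) (Set.Ioi 0) := by
    have : IntegrableOn _ (Set.Ioi (0:ℝ)) volume := (hint.congr_fun e measurableSet_Ioi).const_mul (4 * π)
    refine this.congr_fun (fun s _ => ?_) measurableSet_Ioi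
    field_simp
  rw [setIntegral_congr_fun measurableSet_Ioi e, integral_const_mul,
    Frullani.integral_Ioi_eq (f := fun x => Real.exp (-x⁻¹)) (L := 0) (R := 1)
      (hcont.locallyIntegrableOn measurableSet_Ioi) (by norm_num) (by positivity) ?_ ?_ hint']
  · rw [div_div_cancel_left' (by norm_num), Real.log_inv]
    simp
  · exact Real.tendsto_exp_atBot.comp (tendsto_neg_atTop_atBot.comp tendsto_inv_nhdsGT_zero)
  · have := (Real.continuous_exp.tendsto 0).comp (f := fun x : ℝ => -x⁻¹) (x := atTop)
      (by simpa using (tendsto_inv_atTop_zero (𝕜 := ℝ)).neg)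
    simpa [Function.comp_def] using this

lemma integral_heatKer_time {n : ℕ} {e y : Euc n} (he : ‖e‖ = 1) (hy : y ≠ 0) :
    ∫ s in Set.Ioi (0:ℝ), heatKer n y s =
      ‖y‖ ^ (2 - (n:ℝ)) * ∫ s in Set.Ioi (0:ℝ), heatKer n e s := by
  have hr : 0 < ‖y‖ := norm_pos_iff.2 hy
  have h := integral_comp_mul_left_Ioi (heatKer n y) 0 (pow_pos hr 2)
  rw [mul_zero, smul_eq_mul, eq_inv_mul_iff_mul_eq₀ (by positivity)] at h
  rw [← h, ← integral_const_mul, ← integral_const_mul]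
  refine setIntegral_congr_fun measurableSet_Ioi fun s hs => ?_
  have hs' : 0 < s := hs
  simp only [heatKer, he]
  have e1 : -‖y‖ ^ 2 / (4 * (‖y‖ ^ 2 * s)) = -1 ^ 2 / (4 * s) := by field_simp
  have e2 : 4 * π * (‖y‖ ^ 2 * s) = ‖y‖ ^ 2 * (4 * π * s) := by ring
  rw [e1, e2, Real.mul_rpow (by positivity) (by positivity), ← mul_assoc, ← mul_assoc,
    ← mul_assoc]
  congr 2
  rw [← Real.rpow_two, ← Real.rpow_mul hr.le, ← Real.rpow_add hr]
  congr 1; ring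

lemma lapFund_eq_integral (n : ℕ) (hn : 2 ≤ n) : ∃ κ : ℝ, ∀ y : Euc n, y ≠ 0 →
    lapFund n y = κ * ∫ s in Set.Ioi (0:ℝ), (renorm n s - heatKer n y s) := by
  rcases eq_or_ne n 2 with rfl | h2
  · refine ⟨1, fun y hy => ?_⟩
    have hr : 0 < ‖y‖ := norm_pos_iff.2 hy
    have e : ∀ s ∈ Set.Ioi (0:ℝ), renorm 2 s - heatKer 2 y s =
        (4 * π * s)⁻¹ * Real.exp (-1 / (4 * s)) -
          (4 * π * s)⁻¹ * Real.exp (-(‖y‖ ^ 2) / (4 * s)) := fun s hs => by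
      simp [renorm, heatKer_two y s]
    rw [setIntegral_congr_fun measurableSet_Ioi e, integral_inv_mul_exp_sub_exp (by positivity),
      Real.log_pow, lapFund, if_pos rfl]
    field_simp
    push_cast
    ring
  · have h3 : (3:ℝ) ≤ n := by exact_mod_cast (by omega : 3 ≤ n)
    obtain ⟨e, he⟩ : ∃ e : Euc n, ‖e‖ = 1 :=
      ⟨EuclideanSpace.single ⟨0, by omega⟩ 1, by simp⟩
    have hint : IntegrableOn (fun s => heatKer n e s) (Set.Ioi 0) := by
      obtain ⟨C, hC, h⟩ := heatKer_le n
      refine ((integrableOn_add_rpow_Ioi_of_lt (a := -(n:ℝ) / 2) (c := 0) (m := 1)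
        (by linarith) (by norm_num)).const_mul C).mono'
        ((measurable_heatKer n).comp (by fun_prop : Measurable fun s : ℝ => (e, s))).aestronglyMeasurable ?_
      filter_upwards [ae_restrict_mem measurableSet_Ioi] with s hs
      have := h e s hs
      rw [he, one_pow] at this
      rwa [Real.norm_of_nonneg (heatKer_pos e hs).le]
    have hpos : 0 < ∫ s in Set.Ioi (0:ℝ), heatKer n e s := by
      rw [setIntegral_pos_iff_support_of_nonneg_ae _ hint]
      · have : Set.Ioi (0:ℝ) ⊆ Function.support (fun s => heatKer n e s) ∩ Set.Ioi 0 :=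
          fun s hs => ⟨(heatKer_pos e hs).ne', hs⟩
        exact lt_of_lt_of_le (by simp) (measure_mono this)
      · filter_upwards [ae_restrict_mem measurableSet_Ioi] with s hs using (heatKer_pos e hs).le
    refine ⟨(((n : ℝ) - 2) * (2 * π ^ ((n : ℝ) / 2) / Real.Gamma ((n : ℝ) / 2)))⁻¹ /
      ∫ s in Set.Ioi (0:ℝ), heatKer n e s, fun y hy => ?_⟩
    simp only [renorm, if_neg h2, zero_sub]
    rw [integral_neg, integral_heatKer_time he hy, lapFund, if_neg h2]
    field_simp

lemma measurable_kernel_mul (n : ℕ) (x : Euc n) (t : ℝ) :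
    Measurable fun p : Euc n × ℝ =>
      (renorm n p.2 - heatKer n p.1 p.2) * heatKer n (x - p.1) t := by
  have h1 : Measurable fun p : Euc n × ℝ => renorm n p.2 :=
    (measurable_renorm n).comp measurable_snd
  have h2 : Measurable fun p : Euc n × ℝ => heatKer n (x - p.1) t :=
    (measurable_heatKer n).comp (by fun_prop : Measurable fun p : Euc n × ℝ => (x - p.1, t))
  exact (h1.sub (measurable_heatKer n)).mul h2

lemma integrable_kernel_mul (n : ℕ) (x : Euc n) {s t : ℝ} (hs : 0 < s) (ht : 0 < t) :
    Integrable fun y => (renorm n s - heatKer n y s) * heatKer n (x - y) t := by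
  simp_rw [sub_mul]
  exact ((integrable_heatKer n x ht).const_mul _).sub (integrable_heatKer_mul_heatKer n x hs ht)

lemma integral_kernel_mul (n : ℕ) (x : Euc n) {s t : ℝ} (hs : 0 < s) (ht : 0 < t) :
    ∫ y, (renorm n s - heatKer n y s) * heatKer n (x - y) t =
      renorm n s - heatKer n x (s + t) := by
  simp_rw [sub_mul]
  rw [integral_sub ((integrable_heatKer n x ht).const_mul _)
    (integrable_heatKer_mul_heatKer n x hs ht), integral_const_mul, integral_heatKer n x ht,
    integral_heatKer_mul_heatKer n x hs ht, mul_one]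

lemma integral_norm_kernel_mul_two_le_add (x : Euc 2) {s t : ℝ} (hs : 0 < s) (ht : 0 < t) :
    ∫ y, ‖(renorm 2 s - heatKer 2 y s) * heatKer 2 (x - y) t‖ ≤
      renorm 2 s + heatKer 2 x (s + t) := by
  have hr : 0 ≤ renorm 2 s := by simp only [renorm, if_true]; positivity
  calc _ ≤ ∫ y, (renorm 2 s * heatKer 2 (x - y) t + heatKer 2 y s * heatKer 2 (x - y) t) := by
        refine integral_mono (integrable_kernel_mul 2 x hs ht).norm
          (((integrable_heatKer 2 x ht).const_mul _).add
            (integrable_heatKer_mul_heatKer 2 x hs ht)) fun y => ?_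
        have h1 := (heatKer_pos (x - y) ht).le
        have h2 := (heatKer_pos y hs).le
        simp only
        rw [norm_mul, Real.norm_of_nonneg h1, ← add_mul]
        gcongr
        rw [Real.norm_eq_abs, abs_le]; constructor <;> linarith
    _ = _ := by
        rw [integral_add ((integrable_heatKer 2 x ht).const_mul _)
          (integrable_heatKer_mul_heatKer 2 x hs ht), integral_const_mul, integral_heatKer 2 x ht,
          integral_heatKer_mul_heatKer 2 x hs ht, mul_one]

lemma integral_norm_kernel_mul_two_le_sub (x : Euc 2) {s t : ℝ} (hs : 0 < s) (ht : 0 < t) :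
    ∫ y, ‖(renorm 2 s - heatKer 2 y s) * heatKer 2 (x - y) t‖ ≤
      2 * (4 * π * s)⁻¹ - renorm 2 s - heatKer 2 x (s + t) := by
  have hr : renorm 2 s ≤ (4 * π * s)⁻¹ := by
    simp only [renorm, if_true]
    exact mul_le_of_le_one_right (by positivity) (exp_neg_div_le_one zero_le_one hs)
  calc _ ≤ ∫ y, ((2 * (4 * π * s)⁻¹ - renorm 2 s) * heatKer 2 (x - y) t -
          heatKer 2 y s * heatKer 2 (x - y) t) := by
        refine integral_mono (integrable_kernel_mul 2 x hs ht).norm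
          (((integrable_heatKer 2 x ht).const_mul _).sub
            (integrable_heatKer_mul_heatKer 2 x hs ht)) fun y => ?_
        have h1 := (heatKer_pos (x - y) ht).le
        have h2 : heatKer 2 y s ≤ (4 * π * s)⁻¹ := by
          rw [heatKer_two y s]
          exact mul_le_of_le_one_right (by positivity) (exp_neg_div_le_one (sq_nonneg _) hs)
        simp only
        rw [norm_mul, Real.norm_of_nonneg h1, ← sub_mul]
        gcongr
        rw [Real.norm_eq_abs, abs_le]; constructor <;> linarith
    _ = _ := by
        rw [integral_sub ((integrable_heatKer 2 x ht).const_mul _)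
          (integrable_heatKer_mul_heatKer 2 x hs ht), integral_const_mul, integral_heatKer 2 x ht,
          integral_heatKer_mul_heatKer 2 x hs ht, mul_one]

lemma integrable_prod_kernel_mul {n : ℕ} (hn : 2 ≤ n) (x : Euc n) {t : ℝ} (ht : 0 < t) :
    Integrable (fun p : Euc n × ℝ => (renorm n p.2 - heatKer n p.1 p.2) * heatKer n (x - p.1) t)
      (volume.prod (volume.restrict (Set.Ioi 0))) := by
  have hm := measurable_kernel_mul n x t
  rw [integrable_prod_iff' hm.aestronglyMeasurable]
  have hm' : AEStronglyMeasurable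
      (fun s => ∫ y, ‖(renorm n s - heatKer n y s) * heatKer n (x - y) t‖)
      (volume.restrict (Set.Ioi 0)) :=
    (hm.norm.stronglyMeasurable.integral_prod_left' (μ := volume)).aestronglyMeasurable
  refine ⟨?_, ?_⟩
  · filter_upwards [ae_restrict_mem measurableSet_Ioi] with s hs
    exact integrable_kernel_mul n x hs ht
  rcases eq_or_ne n 2 with rfl | h2
  · refine integrableOn_Ioi_of_bounds (A := 1⁻¹ + (4 * π * t)⁻¹)
      (B := 1 + t + ‖x‖ ^ 2) hm' (fun s hs _ => ?_) (fun s hs => ?_)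
    · rw [abs_of_nonneg (by positivity)]
      refine (integral_norm_kernel_mul_two_le_add x hs ht).trans (add_le_add ?_ ?_)
      · simp only [renorm, if_true]
        exact inv_mul_exp_neg_le one_pos hs
      · have hst : 0 < s + t := by positivity
        rw [heatKer_two x (s + t)]
        refine (mul_le_of_le_one_right (by positivity)
          (exp_neg_div_le_one (sq_nonneg _) hst)).trans ?_
        gcongr
        linarith
    · have hs : 0 < s := by linarith
      have hst : 0 < s + t := by positivity
      rw [abs_of_nonneg (by positivity)]
      refine (integral_norm_kernel_mul_two_le_sub x hs ht).trans ?_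
      have h1 := inv_mul_one_sub_exp_le zero_le_one hs
      have h2 := inv_mul_one_sub_exp_le (sq_nonneg ‖x‖) hst
      have h3 : ‖x‖ ^ 2 / (s + t) ^ 2 ≤ ‖x‖ ^ 2 / s ^ 2 := by gcongr; linarith
      have h4 : (4 * π * s)⁻¹ - (4 * π * (s + t))⁻¹ ≤ t / s ^ 2 := by
        have e : (4 * π * s)⁻¹ - (4 * π * (s + t))⁻¹ = (4 * π)⁻¹ * (t / (s * (s + t))) := by
          field_simp; ring
        rw [e]
        calc _ ≤ 1 * (t / (s * s)) := by
              gcongr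
              · exact inv_le_one_of_one_le₀ (by linarith [Real.pi_gt_three])
              · linarith
          _ = _ := by ring
      simp only [renorm, if_true, heatKer_two x (s + t)]
      rw [add_div, add_div]
      linarith
  · have h3 : (3:ℝ) ≤ n := by exact_mod_cast (by omega : 3 ≤ n)
    obtain ⟨C, hC, h⟩ := heatKer_le n
    refine ((integrableOn_add_rpow_Ioi_of_lt (a := -(n:ℝ) / 2) (c := 0) (m := t)
        (by linarith) (by linarith)).const_mul C).mono' hm' ?_
    filter_upwards [ae_restrict_mem measurableSet_Ioi] with s hs
    have hs' : 0 < s := hs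
    have hst : 0 < s + t := by positivity
    rw [Real.norm_of_nonneg (by positivity)]
    have e : ∀ y, ‖(renorm n s - heatKer n y s) * heatKer n (x - y) t‖ =
        heatKer n y s * heatKer n (x - y) t := fun y => by
      rw [renorm, if_neg h2, zero_sub, neg_mul, norm_neg,
        Real.norm_of_nonneg (mul_pos (heatKer_pos y hs') (heatKer_pos _ ht)).le]
    simp_rw [e]
    rw [integral_heatKer_mul_heatKer n x hs' ht]
    refine (h x _ hst).trans ?_
    gcongr ?_ * ?_
    exact Real.rpow_le_rpow_of_nonpos hst (by nlinarith [sq_nonneg ‖x‖]) (by linarith)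

lemma integrableOn_renorm_sub_heatKer {n : ℕ} (hn : 2 ≤ n) (x : Euc n) {t : ℝ} (ht : 0 < t) :
    IntegrableOn (fun s => renorm n s - heatKer n x (s + t)) (Set.Ioi 0) := by
  have h := (integrable_prod_kernel_mul hn x ht).integral_prod_right
  refine IntegrableOn.congr_fun h (fun s hs => ?_) measurableSet_Ioi
  exact integral_kernel_mul n x hs ht

/-- Up to renormalization, `Φ` is a time integral of the heat kernel. -/
lemma genPhi_eq_integral {n : ℕ} (hn : 2 ≤ n) : ∃ κ : ℝ, ∀ (x : Euc n) (t : ℝ), 0 < t →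
    genPhi n x t = κ * ∫ s in Set.Ioi (0:ℝ), (renorm n s - heatKer n x (s + t)) := by
  obtain ⟨κ, hκ⟩ := lapFund_eq_integral n hn
  have : Nonempty (Fin n) := ⟨⟨0, by omega⟩⟩
  refine ⟨κ, fun x t ht => ?_⟩
  calc genPhi n x t = ∫ y, κ * ∫ s in Set.Ioi (0:ℝ),
        (renorm n s - heatKer n y s) * heatKer n (x - y) t := by
        refine integral_congr_ae ?_
        filter_upwards [compl_mem_ae_iff.2 (measure_singleton (0 : Euc n))] with y hy
        rw [hκ y hy, integral_mul_const, mul_assoc]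
    _ = κ * ∫ s in Set.Ioi (0:ℝ), ∫ y, (renorm n s - heatKer n y s) * heatKer n (x - y) t := by
        rw [integral_const_mul, integral_integral_swap (integrable_prod_kernel_mul hn x ht)]
    _ = _ := by
        congr 1
        exact setIntegral_congr_fun measurableSet_Ioi fun s hs => integral_kernel_mul n x hs ht

/-- `f` is differentiable at `x` with partial derivatives `g`. -/
def HasGrad {n : ℕ} (f : Euc n → ℝ) (g : Fin n → ℝ) (x : Euc n) : Prop :=
  HasFDerivAt f (∑ k, g k • (EuclideanSpace.proj k : Euc n →L[ℝ] ℝ)) x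

namespace HasGrad

variable {n : ℕ} {f f' : Euc n → ℝ} {g g' : Fin n → ℝ} {x : Euc n}

lemma pd_eq (h : HasGrad f g x) (k : Fin n) : pd n k f x = g k := by
  rw [pd, HasFDerivAt.fderiv h]
  simp

lemma coord (i : Fin n) (x : Euc n) : HasGrad (fun x => x i) (fun k => if i = k then 1 else 0) x := by
  have h := (EuclideanSpace.proj i : Euc n →L[ℝ] ℝ).hasFDerivAt (x := x)
  unfold HasGrad
  convert! h using 1
  simp

lemma const (c : ℝ) (x : Euc n) : HasGrad (fun _ => c) (fun _ => 0) x := by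
  unfold HasGrad
  simpa using hasFDerivAt_const c x

lemma add (h : HasGrad f g x) (h' : HasGrad f' g' x) :
    HasGrad (fun x => f x + f' x) (fun k => g k + g' k) x := by
  unfold HasGrad
  convert! HasFDerivAt.add h h' using 1
  simp [add_smul, Finset.sum_add_distrib]

lemma mul (h : HasGrad f g x) (h' : HasGrad f' g' x) :
    HasGrad (fun x => f x * f' x) (fun k => f x * g' k + g k * f' x) x := by
  unfold HasGrad
  convert! HasFDerivAt.mul h h' using 1
  simp [add_smul, Finset.sum_add_distrib, Finset.smul_sum, smul_smul, mul_comm]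

lemma const_mul (c : ℝ) (h : HasGrad f g x) : HasGrad (fun x => c * f x) (fun k => c * g k) x := by
  simpa using (const c x).mul h

lemma sum {ι : Type*} {s : Finset ι} {f : ι → Euc n → ℝ} {g : ι → Fin n → ℝ}
    (h : ∀ i ∈ s, HasGrad (f i) (g i) x) :
    HasGrad (fun x => ∑ i ∈ s, f i x) (fun k => ∑ i ∈ s, g i k) x := by
  unfold HasGrad
  convert! HasFDerivAt.fun_sum h using 1
  simp_rw [Finset.sum_smul]
  exact Finset.sum_comm

end HasGrad

/-- The first spatial derivatives of the heat kernel. -/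
noncomputable def heatD1 (n : ℕ) (i : Fin n) (x : Euc n) (s : ℝ) : ℝ :=
  -(2 * s)⁻¹ * x i * heatKer n x s

/-- The second spatial derivatives of the heat kernel. -/
noncomputable def heatD2 (n : ℕ) (i j : Fin n) (x : Euc n) (s : ℝ) : ℝ :=
  ((4 * s ^ 2)⁻¹ * (x i * x j) + -(2 * s)⁻¹ * (if i = j then 1 else 0)) * heatKer n x s

/-- The third spatial derivatives of the heat kernel. -/
noncomputable def heatD3 (n : ℕ) (i j k : Fin n) (x : Euc n) (s : ℝ) : ℝ :=
  (-(8 * s ^ 3)⁻¹ * (x i * x j * x k) + (4 * s ^ 2)⁻¹ * ((if i = j then 1 else 0) * x k +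
    (if i = k then 1 else 0) * x j + (if j = k then 1 else 0) * x i)) * heatKer n x s

lemma hasGrad_heatKer {n : ℕ} (x : Euc n) {s : ℝ} (hs : s ≠ 0) :
    HasGrad (fun x => heatKer n x s) (fun k => heatD1 n k x s) x := by
  have h := (((hasStrictFDerivAt_norm_sq x).hasFDerivAt.const_mul (-(4 * s)⁻¹)).exp).const_mul
    ((4 * π * s) ^ (-(n : ℝ) / 2))
  have e : ∀ x : Euc n, -‖x‖ ^ 2 / (4 * s) = -(4 * s)⁻¹ * ‖x‖ ^ 2 := fun x => by ring
  unfold HasGrad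
  simp only [heatD1, heatKer, e]
  convert! h using 1
  ext v
  simp only [_root_.sum_apply, _root_.smul_apply, smul_eq_mul,
    innerSL_apply_apply, PiLp.inner_apply, Finset.mul_sum, nsmul_eq_mul]
  refine Finset.sum_congr rfl fun k _ => ?_
  simp
  field_simp
  ring

lemma hasGrad_heatD1 {n : ℕ} (i : Fin n) (x : Euc n) {s : ℝ} (hs : s ≠ 0) :
    HasGrad (fun x => heatD1 n i x s) (fun k => heatD2 n i k x s) x := by
  have h := ((HasGrad.coord i x).const_mul (-(2 * s)⁻¹)).mul (hasGrad_heatKer x hs)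
  convert! h using 2 with k
  simp only [heatD1, heatD2]
  field_simp
  ring

lemma hasGrad_heatD2 {n : ℕ} (i j : Fin n) (x : Euc n) {s : ℝ} (hs : s ≠ 0) :
    HasGrad (fun x => heatD2 n i j x s) (fun k => heatD3 n i j k x s) x := by
  have h := ((((HasGrad.coord i x).mul (HasGrad.coord j x)).const_mul (4 * s ^ 2)⁻¹).add
    (HasGrad.const (-(2 * s)⁻¹ * (if i = j then 1 else 0)) x)).mul (hasGrad_heatKer x hs)
  convert! h using 2 with k
  simp only [heatD1, heatD3]
  field_simp
  ring

lemma measurable_heatKer_shift (n : ℕ) (x : Euc n) (t : ℝ) :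
    Measurable fun s => heatKer n x (s + t) :=
  (measurable_heatKer n).comp (by fun_prop : Measurable fun s : ℝ => (x, s + t))

lemma abs_coord_le {n : ℕ} (x : Euc n) (i : Fin n) : |x i| ≤ ‖x‖ := by
  simpa using PiLp.norm_apply_le x i

lemma abs_ite_one_zero_le (p : Prop) [Decidable p] : |(if p then 1 else 0 : ℝ)| ≤ 1 := by
  split_ifs <;> simp

lemma abs_heatD1_le (n : ℕ) : ∃ C > (0:ℝ), ∀ (i : Fin n) (x : Euc n) (s : ℝ), 0 < s →
    |heatD1 n i x s| ≤ C * (s + ‖x‖ ^ 2) ^ (-((n : ℝ) + 1) / 2) := by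
  obtain ⟨C, hC, h⟩ := norm_pow_mul_heatKer_le n 1 1
  refine ⟨C, hC, fun i x s hs => ?_⟩
  have h1 := h x s hs
  have hk := heatKer_pos x hs
  rw [show ((1 : ℕ) : ℝ) / 2 - ((1 : ℕ) : ℝ) - n / 2 = -((n : ℝ) + 1) / 2 by push_cast; ring] at h1
  refine le_trans ?_ h1
  rw [heatD1, abs_mul, abs_of_pos hk]
  gcongr
  rw [abs_mul, abs_neg, abs_of_pos (by positivity : 0 < (2 * s)⁻¹)]
  calc (2 * s)⁻¹ * |x i| ≤ s⁻¹ * ‖x‖ := by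
        gcongr
        · linarith
        · exact abs_coord_le x i
    _ = _ := by ring

lemma abs_heatD2_le (n : ℕ) : ∃ C > (0:ℝ), ∀ (i j : Fin n) (x : Euc n) (s : ℝ), 0 < s →
    |heatD2 n i j x s| ≤ C * (s + ‖x‖ ^ 2) ^ (-((n : ℝ) + 2) / 2) := by
  obtain ⟨C, hC, h⟩ := norm_pow_mul_heatKer_le n 2 2
  obtain ⟨C', hC', h'⟩ := norm_pow_mul_heatKer_le n 0 1
  refine ⟨C + C', by positivity, fun i j x s hs => ?_⟩
  have h1 := h x s hs
  have h2 := h' x s hs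
  have hk := heatKer_pos x hs
  rw [show ((2 : ℕ) : ℝ) / 2 - ((2 : ℕ) : ℝ) - n / 2 = -((n : ℝ) + 2) / 2 by push_cast; ring] at h1
  rw [show ((0 : ℕ) : ℝ) / 2 - ((1 : ℕ) : ℝ) - n / 2 = -((n : ℝ) + 2) / 2 by push_cast; ring] at h2
  rw [add_mul]
  refine le_trans ?_ (add_le_add h1 h2)
  rw [heatD2, abs_mul, abs_of_pos hk, ← add_mul]
  gcongr
  refine (abs_add_le _ _).trans (add_le_add ?_ ?_)
  · rw [abs_mul, abs_mul, abs_of_pos (by positivity : 0 < (4 * s ^ 2)⁻¹)]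
    calc (4 * s ^ 2)⁻¹ * (|x i| * |x j|) ≤ (s ^ 2)⁻¹ * (‖x‖ * ‖x‖) := by
          gcongr
          · nlinarith [sq_nonneg s]
          · exact abs_coord_le x i
          · exact abs_coord_le x j
      _ = _ := by ring
  · rw [abs_mul, abs_neg, abs_of_pos (by positivity : 0 < (2 * s)⁻¹)]
    calc (2 * s)⁻¹ * |(if i = j then 1 else 0 : ℝ)| ≤ s⁻¹ * 1 := by
          gcongr
          · linarith
          · exact abs_ite_one_zero_le _
      _ = _ := by ring

lemma abs_heatD3_le (n : ℕ) : ∃ C > (0:ℝ), ∀ (i j k : Fin n) (x : Euc n) (s : ℝ), 0 < s →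
    |heatD3 n i j k x s| ≤ C * (s + ‖x‖ ^ 2) ^ (-((n : ℝ) + 3) / 2) := by
  obtain ⟨C, hC, h⟩ := norm_pow_mul_heatKer_le n 3 3
  obtain ⟨C', hC', h'⟩ := norm_pow_mul_heatKer_le n 1 2
  refine ⟨C + C', by positivity, fun i j k x s hs => ?_⟩
  have h1 := h x s hs
  have h2 := h' x s hs
  have hk := heatKer_pos x hs
  rw [show ((3 : ℕ) : ℝ) / 2 - ((3 : ℕ) : ℝ) - n / 2 = -((n : ℝ) + 3) / 2 by push_cast; ring] at h1
  rw [show ((1 : ℕ) : ℝ) / 2 - ((2 : ℕ) : ℝ) - n / 2 = -((n : ℝ) + 3) / 2 by push_cast; ring] at h2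
  rw [add_mul]
  refine le_trans ?_ (add_le_add h1 h2)
  rw [heatD3, abs_mul, abs_of_pos hk, ← add_mul]
  gcongr
  have hδ : ∀ (p : Prop) [Decidable p] (l : Fin n), |(if p then 1 else 0 : ℝ) * x l| ≤ ‖x‖ :=
    fun p _ l => by
      rw [abs_mul]
      exact (mul_le_of_le_one_left (abs_nonneg _) (abs_ite_one_zero_le p)).trans (abs_coord_le x l)
  refine (abs_add_le _ _).trans (add_le_add ?_ ?_)
  · rw [abs_mul, abs_mul, abs_mul, abs_neg, abs_of_pos (by positivity : 0 < (8 * s ^ 3)⁻¹)]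
    calc (8 * s ^ 3)⁻¹ * (|x i| * |x j| * |x k|) ≤ (s ^ 3)⁻¹ * (‖x‖ * ‖x‖ * ‖x‖) := by
          gcongr
          · nlinarith [pow_pos hs 3]
          · exact abs_coord_le x i
          · exact abs_coord_le x j
          · exact abs_coord_le x k
      _ = _ := by ring
  · rw [abs_mul, abs_of_pos (by positivity : 0 < (4 * s ^ 2)⁻¹)]
    calc _ ≤ (4 * s ^ 2)⁻¹ * (4 * ‖x‖) := by
          gcongr
          refine (abs_add_three _ _ _).trans ?_
          linarith [hδ (i = j) k, hδ (i = k) j, hδ (j = k) i, norm_nonneg x]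
      _ = _ := by field_simp

lemma integrable_sum_smul_const {α ι V : Type*} [MeasurableSpace α] [Fintype ι]
    [NormedAddCommGroup V] [NormedSpace ℝ V] {μ : Measure α} {f : ι → α → ℝ}
    (hf : ∀ k, Integrable (f k) μ) (v : ι → V) : Integrable (fun s => ∑ k, f k s • v k) μ :=
  integrable_finsetSum _ fun k _ => (hf k).smul_const (v k)

lemma integral_sum_smul_const {α ι V : Type*} [MeasurableSpace α] [Fintype ι]
    [NormedAddCommGroup V] [NormedSpace ℝ V] [CompleteSpace V] {μ : Measure α} {f : ι → α → ℝ}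
    (hf : ∀ k, Integrable (f k) μ) (v : ι → V) :
    ∫ s, ∑ k, f k s • v k ∂μ = ∑ k, (∫ s, f k s ∂μ) • v k := by
  rw [integral_finsetSum _ fun k _ => (hf k).smul_const (v k)]
  simp_rw [integral_smul_const]

/-- Differentiation under the integral sign with a bound uniform in space, for derivatives given
in coordinates. -/
lemma hasFDerivAt_integral_sum_smul {α ι E : Type*} [MeasurableSpace α] [Fintype ι]
    [NormedAddCommGroup E] [NormedSpace ℝ E] {μ : Measure α} {F : E → α → ℝ}
    {d : ι → E → α → ℝ} {L : ι → E →L[ℝ] ℝ} {b : α → ℝ} {x : E}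
    (hF : ∀ᵐ s ∂μ, ∀ y, HasFDerivAt (fun y => F y s) (∑ k, d k y s • L k) y)
    (hFi : ∀ y, Integrable (F y) μ) (hdm : ∀ k, AEStronglyMeasurable (d k x) μ)
    (hd : ∀ᵐ s ∂μ, ∀ k y, |d k y s| ≤ b s) (hb : Integrable b μ) :
    HasFDerivAt (fun y => ∫ s, F y s ∂μ) (∑ k, (∫ s, d k x s ∂μ) • L k) x := by
  have hdi : ∀ k, Integrable (d k x) μ := fun k => by
    refine hb.mono' (hdm k) ?_
    filter_upwards [hd] with s hs using hs k x
  have hsum := integrable_sum_smul_const hdi L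
  have hint := integral_sum_smul_const hdi L
  rw [← hint]
  refine hasFDerivAt_integral_of_dominated_of_fderiv_le (bound := fun s => ∑ k, b s * ‖L k‖)
    (F' := fun y s => ∑ k, d k y s • L k)
    Filter.univ_mem (Eventually.of_forall fun y => (hFi y).aestronglyMeasurable) (hFi x)
    hsum.aestronglyMeasurable ?_
    (integrable_finsetSum _ fun k _ => hb.mul_const _) ?_
  · filter_upwards [hd] with s hs y _
    refine (norm_sum_le _ _).trans (Finset.sum_le_sum fun k _ => ?_)
    rw [norm_smul]
    gcongr
    exact hs k y
  · filter_upwards [hF] with s hs y _ using hs y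

lemma hasGrad_integral {n : ℕ} {F : Euc n → ℝ → ℝ} {d : Fin n → Euc n → ℝ → ℝ} {C a t : ℝ}
    (ht : 0 < t) (ha : a < -1)
    (hF : ∀ x s, 0 < s → HasGrad (fun x => F x s) (fun k => d k x s) x)
    (hFi : ∀ x, IntegrableOn (F x) (Set.Ioi 0))
    (hdm : ∀ k x, Measurable (d k x))
    (hd : ∀ k x s, 0 < s → |d k x s| ≤ C * (s + t) ^ a) (x : Euc n) :
    HasGrad (fun x => ∫ s in Set.Ioi (0:ℝ), F x s)
      (fun k => ∫ s in Set.Ioi (0:ℝ), d k x s) x := by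
  refine hasFDerivAt_integral_sum_smul (b := fun s => C * (s + t) ^ a) ?_ hFi
    (fun k => (hdm k x).aestronglyMeasurable) ?_
    ((integrableOn_add_rpow_Ioi_of_lt (c := 0) (m := t) ha (by linarith)).const_mul C)
  · filter_upwards [ae_restrict_mem measurableSet_Ioi] with s hs y using hF y s hs
  · filter_upwards [ae_restrict_mem measurableSet_Ioi] with s hs k y using hd k y s hs

lemma integral_Ioi_add_rpow {a c : ℝ} (ha : a < -1) (hc : 0 < c) :
    ∫ s in Set.Ioi (0:ℝ), (s + c) ^ a = c ^ (a + 1) / (-(a + 1)) := by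
  have hd : ∀ s ∈ Set.Ici (0:ℝ), HasDerivAt (fun s => (s + c) ^ (a + 1) / (a + 1)) ((s + c) ^ a) s := by
    intro s hs
    have hs' : 0 < s + c := add_pos_of_nonneg_of_pos hs hc
    have h := (((hasDerivAt_id s).add_const c).rpow_const (p := a + 1)
      (Or.inl (by simpa using hs'.ne'))).div_const (a + 1)
    convert! h using 1
    have : a + 1 ≠ 0 := by linarith
    simp
    field_simp
  have ht : Tendsto (fun s : ℝ => (s + c) ^ (a + 1) / (a + 1)) atTop (𝓝 (0 / (a + 1))) := by
    rw [← neg_neg (a + 1)]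
    exact ((tendsto_rpow_neg_atTop (by linarith)).comp
      (tendsto_atTop_add_const_right _ c tendsto_id)).div_const _
  rw [integral_Ioi_of_hasDerivAt_of_tendsto' hd
    (integrableOn_add_rpow_Ioi_of_lt ha (by linarith)) ht]
  rw [zero_div, zero_sub, zero_add, div_neg]

lemma abs_integral_le_rpow {f : ℝ → ℝ} {C a c : ℝ} (ha : a < -1) (hc : 0 < c)
    (hf : ∀ s, 0 < s → |f s| ≤ C * (s + c) ^ a) :
    |∫ s in Set.Ioi (0:ℝ), f s| ≤ C / (-(a + 1)) * c ^ (a + 1) := by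
  have h := norm_integral_le_of_norm_le (μ := volume.restrict (Set.Ioi (0:ℝ))) (f := f)
    ((integrableOn_add_rpow_Ioi_of_lt (c := 0) ha (by linarith)).const_mul C)
    (by filter_upwards [ae_restrict_mem measurableSet_Ioi] with s hs using hf s hs)
  rw [integral_const_mul, integral_Ioi_add_rpow ha hc] at h
  rw [Real.norm_eq_abs] at h
  refine h.trans_eq ?_
  ring

lemma rpow_add_sq_le {n : ℕ} (x : Euc n) {s a : ℝ} (hs : 0 < s) (ha : a ≤ 0) :
    (s + ‖x‖ ^ 2) ^ a ≤ s ^ a :=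
  Real.rpow_le_rpow_of_nonpos hs (by nlinarith [sq_nonneg ‖x‖]) ha

lemma measurable_heatD1 {n : ℕ} (i : Fin n) (x : Euc n) (t : ℝ) :
    Measurable fun s => heatD1 n i x (s + t) := by
  unfold heatD1
  exact Measurable.mul (by fun_prop) (measurable_heatKer_shift n x t)

lemma measurable_heatD2 {n : ℕ} (i j : Fin n) (x : Euc n) (t : ℝ) :
    Measurable fun s => heatD2 n i j x (s + t) := by
  unfold heatD2
  exact Measurable.mul (by fun_prop) (measurable_heatKer_shift n x t)

lemma measurable_heatD3 {n : ℕ} (i j k : Fin n) (x : Euc n) (t : ℝ) :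
    Measurable fun s => heatD3 n i j k x (s + t) := by
  unfold heatD3
  exact Measurable.mul (by fun_prop) (measurable_heatKer_shift n x t)

/-- A family dominated by `(s + |x|²)^a` at time `s` is dominated, after a time shift by `t`,
uniformly in space. -/
lemma abs_shift_le {n : ℕ} {f : ℝ → ℝ} {C a t : ℝ} {x : Euc n} (hC : 0 < C) (ha : a ≤ 0)
    (ht : 0 < t) (hf : ∀ s, 0 < s → |f s| ≤ C * (s + ‖x‖ ^ 2) ^ a) {s : ℝ} (hs : 0 < s) :
    |f (s + t)| ≤ C * (s + t) ^ a := by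
  refine (hf _ (by positivity)).trans ?_
  gcongr ?_ * ?_
  exact rpow_add_sq_le x (by positivity) ha

lemma integrableOn_shift {n : ℕ} {f : ℝ → ℝ} {C a t : ℝ} {x : Euc n} (hC : 0 < C) (ha : a < -1)
    (ht : 0 < t) (hfm : Measurable fun s => f (s + t))
    (hf : ∀ s, 0 < s → |f s| ≤ C * (s + ‖x‖ ^ 2) ^ a) :
    IntegrableOn (fun s => f (s + t)) (Set.Ioi 0) := by
  refine ((integrableOn_add_rpow_Ioi_of_lt (c := 0) (m := t) ha (by linarith)).const_mul C).mono'
    hfm.aestronglyMeasurable ?_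
  filter_upwards [ae_restrict_mem measurableSet_Ioi] with s hs
  exact abs_shift_le hC (by linarith) ht hf hs

lemma hasGrad_integral_renorm_sub_heatKer {n : ℕ} (hn : 2 ≤ n) {t : ℝ} (ht : 0 < t) (x : Euc n) :
    HasGrad (fun x => ∫ s in Set.Ioi (0:ℝ), (renorm n s - heatKer n x (s + t)))
      (fun k => ∫ s in Set.Ioi (0:ℝ), -1 * heatD1 n k x (s + t)) x := by
  have hn' : (2:ℝ) ≤ n := by exact_mod_cast hn
  obtain ⟨C, hC, h⟩ := abs_heatD1_le n
  refine hasGrad_integral (C := C) (a := -((n : ℝ) + 1) / 2) ht (by linarith) (fun y s hs => ?_)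
    (fun y => integrableOn_renorm_sub_heatKer hn y ht)
    (fun k y => (measurable_heatD1 k y t).const_mul _) (fun k y s hs => ?_) x
  · have := (HasGrad.const (renorm n s) y).add
      ((hasGrad_heatKer y (by positivity : s + t ≠ 0)).const_mul (-1))
    convert! this using 2
    · ring
    · ring
  · rw [neg_one_mul, abs_neg]
    exact abs_shift_le hC (by linarith) ht (h k y) hs

lemma hasGrad_integral_heatD1 {n : ℕ} (hn : 2 ≤ n) (i : Fin n) {t : ℝ} (ht : 0 < t) (x : Euc n) :
    HasGrad (fun x => ∫ s in Set.Ioi (0:ℝ), heatD1 n i x (s + t))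
      (fun k => ∫ s in Set.Ioi (0:ℝ), heatD2 n i k x (s + t)) x := by
  have hn' : (2:ℝ) ≤ n := by exact_mod_cast hn
  obtain ⟨C, hC, h⟩ := abs_heatD1_le n
  obtain ⟨C', hC', h'⟩ := abs_heatD2_le n
  exact hasGrad_integral (C := C') (a := -((n : ℝ) + 2) / 2) ht (by linarith)
    (fun y s hs => hasGrad_heatD1 i y (by positivity))
    (fun y => integrableOn_shift hC (by linarith) ht (measurable_heatD1 i y t) (h i y))
    (fun k y => measurable_heatD2 i k y t)
    (fun k y s hs => abs_shift_le hC' (by linarith) ht (h' i k y) hs) x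

lemma hasGrad_integral_heatD2 {n : ℕ} (hn : 2 ≤ n) (i j : Fin n) {t : ℝ} (ht : 0 < t)
    (x : Euc n) :
    HasGrad (fun x => ∫ s in Set.Ioi (0:ℝ), heatD2 n i j x (s + t))
      (fun k => ∫ s in Set.Ioi (0:ℝ), heatD3 n i j k x (s + t)) x := by
  have hn' : (2:ℝ) ≤ n := by exact_mod_cast hn
  obtain ⟨C, hC, h⟩ := abs_heatD2_le n
  obtain ⟨C', hC', h'⟩ := abs_heatD3_le n
  exact hasGrad_integral (C := C') (a := -((n : ℝ) + 3) / 2) ht (by linarith)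
    (fun y s hs => hasGrad_heatD2 i j y (by positivity))
    (fun y => integrableOn_shift hC (by linarith) ht (measurable_heatD2 i j y t) (h i j y))
    (fun k y => measurable_heatD3 i j k y t)
    (fun k y s hs => abs_shift_le hC' (by linarith) ht (h' i j k y) hs) x

lemma exists_pd_pd_genPhi_eq {n : ℕ} (hn : 2 ≤ n) :
    ∃ κ : ℝ, ∀ (i j : Fin n) (x : Euc n) (t : ℝ), 0 < t →
      pd n i (pd n j (fun y => genPhi n y t)) x =
        κ * ∫ s in Set.Ioi (0:ℝ), heatD2 n j i x (s + t) := by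
  obtain ⟨κ, hκ⟩ := genPhi_eq_integral hn
  refine ⟨-κ, fun i j x t ht => ?_⟩
  have h0 : (fun y => genPhi n y t) =
      fun y => κ * ∫ s in Set.Ioi (0:ℝ), (renorm n s - heatKer n y (s + t)) :=
    funext fun y => hκ y t ht
  have h1 : pd n j (fun y => genPhi n y t) =
      fun y => -κ * ∫ s in Set.Ioi (0:ℝ), heatD1 n j y (s + t) := by
    funext y
    rw [h0, ((hasGrad_integral_renorm_sub_heatKer hn ht y).const_mul κ).pd_eq j,
      integral_const_mul]
    ring
  rw [h1, ((hasGrad_integral_heatD1 hn j ht x).const_mul (-κ)).pd_eq i]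

/-- Trace correction turning the Hessian components `H j i` into the Oseen kernel. -/
noncomputable def oseenOf {n : ℕ} (i j : Fin n) (H : Fin n → Fin n → ℝ) : ℝ :=
  (if i = j then -1 else 0) * ∑ l, H l l + H j i

lemma abs_oseenOf_le {n : ℕ} (i j : Fin n) {H : Fin n → Fin n → ℝ} {B : ℝ}
    (hH : ∀ i j, |H i j| ≤ B) : |oseenOf i j H| ≤ (n + 1) * B := by
  have h1 : |∑ l, H l l| ≤ n * B := by
    refine (Finset.abs_sum_le_sum_abs _ _).trans ?_
    refine (Finset.sum_le_card_nsmul _ _ B fun l _ => hH l l).trans_eq ?_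
    simp
  have h2 : |(if i = j then -1 else 0 : ℝ) * ∑ l, H l l| ≤ |∑ l, H l l| := by
    rw [abs_mul]
    refine mul_le_of_le_one_left (abs_nonneg _) ?_
    split_ifs <;> simp
  refine (abs_add_le _ _).trans ?_
  linarith [hH j i]

lemma exists_kernel_eq {n : ℕ} (hn : 2 ≤ n) :
    ∃ κ : ℝ, ∀ (x : Euc n) (t : ℝ), 0 < t → ∀ i j : Fin n,
      Kmat n i j x t =
        oseenOf i j (fun a b => κ * ∫ s in Set.Ioi (0:ℝ), heatD2 n a b x (s + t)) ∧
      ∀ k, Kten n i j k x t =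
        oseenOf i j (fun a b => κ * ∫ s in Set.Ioi (0:ℝ), heatD3 n a b k x (s + t)) := by
  obtain ⟨κ, hκ⟩ := exists_pd_pd_genPhi_eq hn
  have hK : ∀ (x : Euc n) (t : ℝ), 0 < t → ∀ i j : Fin n, Kmat n i j x t =
      oseenOf i j (fun a b => κ * ∫ s in Set.Ioi (0:ℝ), heatD2 n a b x (s + t)) := by
    intro x t ht i j
    simp only [Kmat, lap, oseenOf, hκ _ _ _ _ ht]
    split_ifs <;> ring
  refine ⟨κ, fun x t ht i j => ⟨hK x t ht i j, fun k => ?_⟩⟩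
  have h : (fun y => Kmat n i j y t) = fun y =>
      oseenOf i j (fun a b => κ * ∫ s in Set.Ioi (0:ℝ), heatD2 n a b y (s + t)) :=
    funext fun y => hK y t ht i j
  rw [Kten, h]
  have hH := fun a b => (hasGrad_integral_heatD2 hn a b ht x).const_mul κ
  exact (((HasGrad.sum (s := Finset.univ) fun l _ => hH l l).const_mul
    (if i = j then -1 else 0)).add (hH j i)).pd_eq k

lemma abs_integral_shift_le {n : ℕ} {f : ℝ → ℝ} {C m t : ℝ} {x : Euc n} (hn : 2 ≤ n)
    (hC : 0 < C) (hm : 0 ≤ m) (ht : 0 < t)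
    (hf : ∀ s, 0 < s → |f s| ≤ C * (s + ‖x‖ ^ 2) ^ (-((n : ℝ) + (m + 2)) / 2)) :
    |∫ s in Set.Ioi (0:ℝ), f (s + t)| ≤ C * (‖x‖ ^ 2 + t) ^ (-((n : ℝ) + m) / 2) := by
  have hn' : (2:ℝ) ≤ n := by exact_mod_cast hn
  have hc : 0 < ‖x‖ ^ 2 + t := by positivity
  have h := abs_integral_le_rpow (f := fun s => f (s + t)) (C := C)
    (a := -((n : ℝ) + (m + 2)) / 2) (c := ‖x‖ ^ 2 + t) (by linarith) hc (fun s hs => by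
      have := hf (s + t) (by positivity)
      rwa [show s + t + ‖x‖ ^ 2 = s + (‖x‖ ^ 2 + t) by ring] at this)
  rw [show -((n : ℝ) + (m + 2)) / 2 + 1 = -((n : ℝ) + m) / 2 by ring] at h
  refine h.trans ?_
  gcongr
  exact div_le_self hC.le (by linarith)

/-- Decay estimates for the Oseen kernel: |K_{ij}(x,t)| ≤ C (|x|²+t)^{-n/2} and
|K_{ijk}(x,t)| ≤ C (|x|²+t)^{-(n+1)/2}, with C = C(n). -/
theorem oseen_kernel_decay (n : ℕ) (hn : 2 ≤ n) :
    ∃ C > (0:ℝ), ∀ (x : Euc n) (t : ℝ), 0 < t → ∀ i j k : Fin n,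
      |Kmat n i j x t| ≤ C * (‖x‖ ^ 2 + t) ^ (-(n : ℝ) / 2) ∧
      |Kten n i j k x t| ≤ C * (‖x‖ ^ 2 + t) ^ (-((n : ℝ) + 1) / 2) := by
  obtain ⟨κ, hκ⟩ := exists_kernel_eq hn
  obtain ⟨C, hC, h⟩ := abs_heatD2_le n
  obtain ⟨C', hC', h'⟩ := abs_heatD3_le n
  refine ⟨(n + 1) * (|κ| * (C + C')) + 1, by positivity, fun x t ht i j k => ?_⟩
  have hc : 0 < ‖x‖ ^ 2 + t := by positivity
  rw [(hκ x t ht i j).1, (hκ x t ht i j).2 k]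
  constructor
  · have hB : ∀ a b, |κ * ∫ s in Set.Ioi (0:ℝ), heatD2 n a b x (s + t)| ≤
        |κ| * (C + C') * (‖x‖ ^ 2 + t) ^ (-(n : ℝ) / 2) := fun a b => by
      have hI := abs_integral_shift_le (m := 0) hn hC le_rfl ht
        (by simpa using h a b x)
      rw [add_zero] at hI
      rw [abs_mul, mul_assoc]
      gcongr
      refine hI.trans ?_
      gcongr
      linarith
    refine (abs_oseenOf_le i j hB).trans ?_
    have := Real.rpow_pos_of_pos hc (-(n : ℝ) / 2)
    linarith
  · have hB : ∀ a b, |κ * ∫ s in Set.Ioi (0:ℝ), heatD3 n a b k x (s + t)| ≤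
        |κ| * (C + C') * (‖x‖ ^ 2 + t) ^ (-((n : ℝ) + 1) / 2) := fun a b => by
      have hI := abs_integral_shift_le (m := 1) hn hC' zero_le_one ht
        (by norm_num; simpa using h' a b k x)
      rw [abs_mul, mul_assoc]
      gcongr
      refine hI.trans ?_
      gcongr
      linarith
    refine (abs_oseenOf_le i j hB).trans ?_
    have := Real.rpow_pos_of_pos hc (-((n : ℝ) + 1) / 2)
    linarith

end
end

section
/- Define the bilinear form B on L^∞(ℝⁿ×(0,T); ℝⁿ) by B(u,v)_i(x,t) = −∫₀^t ∫_{ℝⁿ} K_{ijk}(x−y,t−s) u_k(y,s) v_j(y,s) dy ds (summation over repeated indices). Then there exists C = C(n) such that ‖B(u,v)‖_{L^∞(ℝⁿ×(0,T))} ≤ C √T ‖u‖_{L^∞(ℝⁿ×(0,T))} ‖v‖_{L^∞(ℝⁿ×(0,T))} for all u, v ∈ L^∞(ℝⁿ×(0,T); ℝⁿ). -/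
open MeasureTheory Real Filter Topology

noncomputable section

/-- The bilinear form B(u,v)_i(x,t) = -∫₀ᵗ∫ K_{ijk}(x-y,t-s) u_k(y,s) v_j(y,s) dy ds. -/
noncomputable def nsBilin (n : ℕ) (u v : Euc n → ℝ → Euc n) (x : Euc n) (t : ℝ) : Euc n :=
  (WithLp.equiv 2 (Fin n → ℝ)).symm fun i =>
    -∫ s in Set.Ioo 0 t, ∫ y : Euc n,
      ∑ j : Fin n, ∑ k : Fin n, Kten n i j k (x - y) (t - s) * u y s k * v y s j

/-- The profile `τ ^ (-p) * exp (-r / (4 τ))`; with `p = n / 2` and `r = |x|²` it is the heat kernel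
at time `τ` up to a constant. -/
def heatProfile (p r τ : ℝ) : ℝ := τ ^ (-p) * Real.exp (-r / (4 * τ))

/-- The function subtracted from `heatProfile` to make it integrable in time at infinity. -/
def profileTail (p s : ℝ) : ℝ := if 1 < s then s ^ (-p) else 0

lemma heatProfile_pos {p r τ : ℝ} (hτ : 0 < τ) : 0 < heatProfile p r τ := by
  unfold heatProfile; positivity

lemma heatProfile_le {p r τ : ℝ} (hτ : 0 < τ) (hr : 0 ≤ r) : heatProfile p r τ ≤ τ ^ (-p) := by
  unfold heatProfile
  refine mul_le_of_le_one_right (by positivity) (Real.exp_le_one_iff.2 ?_)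
  rw [neg_div]
  have : 0 ≤ r / (4 * τ) := by positivity
  linarith

lemma integral_heatKer_sub (n : ℕ) (x : Euc n) {t : ℝ} (ht : 0 < t) :
    ∫ y : Euc n, heatKer n (x - y) t = 1 := by
  rw [integral_sub_left_eq_self (fun y => heatKer n y t) volume x]
  unfold heatKer
  rw [integral_const_mul]
  have h := GaussianFourier.integral_rexp_neg_mul_sq_norm (V := Euc n) (b := 1 / (4 * t))
    (by positivity)
  have e : ∀ v : Euc n, -‖v‖ ^ 2 / (4 * t) = -(1 / (4 * t)) * ‖v‖ ^ 2 := fun v => by ring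
  simp_rw [e, h]
  rw [finrank_euclideanSpace_fin, neg_div, Real.rpow_neg (by positivity)]
  have : π / (1 / (4 * t)) = 4 * π * t := by field_simp
  rw [this]
  exact inv_mul_cancel₀ (by positivity)

lemma integrable_heatKer_sub (n : ℕ) (x : Euc n) {t : ℝ} (ht : 0 < t) :
    Integrable fun y : Euc n => heatKer n (x - y) t :=
  .of_integral_ne_zero (by rw [integral_heatKer_sub n x ht]; exact one_ne_zero)

lemma integral_heatProfile_mul_heatKer (n : ℕ) (x : Euc n) {s t : ℝ} (hs : 0 < s) (ht : 0 < t) :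
    ∫ y : Euc n, heatProfile ((n : ℝ) / 2) (‖y‖ ^ 2) s * heatKer n (x - y) t =
      heatProfile ((n : ℝ) / 2) (‖x‖ ^ 2) (t + s) := by
  have hts : 0 < t + s := by positivity
  set b : ℝ := (t + s) / (4 * s * t) with hb
  set l : ℝ := s / (t + s) with hl
  have key : ∀ y : Euc n, heatProfile ((n : ℝ) / 2) (‖y‖ ^ 2) s * heatKer n (x - y) t =
      (s ^ (-((n : ℝ) / 2)) * (4 * π * t) ^ (-((n : ℝ) / 2)) *
        Real.exp (-‖x‖ ^ 2 / (4 * (t + s)))) * Real.exp (-b * ‖y - l • x‖ ^ 2) := by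
    intro y
    have e : Real.exp (-‖y‖ ^ 2 / (4 * s)) * Real.exp (-‖x - y‖ ^ 2 / (4 * t)) =
        Real.exp (-‖x‖ ^ 2 / (4 * (t + s))) * Real.exp (-b * ‖y - l • x‖ ^ 2) := by
      rw [← Real.exp_add, ← Real.exp_add, @norm_sub_sq_real, @norm_sub_sq_real, real_inner_smul_right,
        norm_smul, mul_pow, Real.norm_eq_abs, sq_abs, real_inner_comm x y]
      congr 1
      rw [hb, hl]
      field_simp
      ring
    unfold heatProfile heatKer
    rw [neg_div (2 : ℝ) (n : ℝ)]
    linear_combination (s ^ (-((n : ℝ) / 2)) * (4 * π * t) ^ (-((n : ℝ) / 2))) * e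
  simp_rw [key]
  rw [integral_const_mul, integral_sub_right_eq_self (fun y : Euc n => Real.exp (-b * ‖y‖ ^ 2)),
    GaussianFourier.integral_rexp_neg_mul_sq_norm (by positivity), finrank_euclideanSpace_fin]
  unfold heatProfile
  have e : s ^ (-((n : ℝ) / 2)) * (4 * π * t) ^ (-((n : ℝ) / 2)) * (π / b) ^ ((n : ℝ) / 2) =
      (t + s) ^ (-((n : ℝ) / 2)) := by
    have : π / b = (t + s)⁻¹ * (s * (4 * π * t)) := by rw [hb]; field_simp
    have hm : 0 < 4 * π * t := by positivity
    rw [this]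
    generalize 4 * π * t = m at hm
    rw [Real.mul_rpow (by positivity) (by positivity),
      Real.mul_rpow hs.le hm.le, Real.inv_rpow hts.le, Real.rpow_neg hs.le,
      Real.rpow_neg hts.le, Real.rpow_neg hm.le]
    have h1 : s ^ ((n : ℝ) / 2) ≠ 0 := by positivity
    have h2 : m ^ ((n : ℝ) / 2) ≠ 0 := by positivity
    field_simp
  linear_combination Real.exp (-‖x‖ ^ 2 / (4 * (t + s))) * e

lemma integrable_heatProfile_mul_heatKer (n : ℕ) (x : Euc n) {s t : ℝ} (hs : 0 < s) (ht : 0 < t) :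
    Integrable fun y : Euc n => heatProfile ((n : ℝ) / 2) (‖y‖ ^ 2) s * heatKer n (x - y) t :=
  .of_integral_ne_zero (by
    rw [integral_heatProfile_mul_heatKer n x hs ht]; exact (heatProfile_pos (by positivity)).ne')

lemma exists_one_add_rpow_mul_exp_le (q : ℝ) :
    ∃ C > 0, ∀ z : ℝ, 0 ≤ z → (1 + z) ^ q * Real.exp (-z / 4) ≤ C := by
  obtain ⟨N, hN⟩ := exists_nat_ge q
  refine ⟨(4 ^ N * N.factorial) * Real.exp (1 / 4), by positivity, fun z hz => ?_⟩
  have h1 : (1 + z) ^ q ≤ (1 + z) ^ N := by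
    rw [← Real.rpow_natCast]
    exact Real.rpow_le_rpow_of_exponent_le (by linarith) hN
  have h2 := Real.pow_div_factorial_le_exp ((1 + z) / 4) (by positivity) N
  rw [div_pow, div_div, div_le_iff₀ (by positivity)] at h2
  calc (1 + z) ^ q * Real.exp (-z / 4)
      ≤ (Real.exp ((1 + z) / 4) * (4 ^ N * N.factorial)) * Real.exp (-z / 4) := by
        gcongr; exact h1.trans h2
    _ = (4 ^ N * N.factorial) * (Real.exp ((1 + z) / 4) * Real.exp (-z / 4)) := by ring
    _ = _ := by rw [← Real.exp_add]; ring_nf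

/-- Polynomial decay of the profile in `τ + r`. -/
lemma exists_heatProfile_le (p q : ℝ) :
    ∃ C > 0, ∀ r τ : ℝ, 0 ≤ r → 0 < τ →
      heatProfile p r τ ≤ C * τ ^ (q - p) * (τ + r) ^ (-q) := by
  obtain ⟨C, hC, h⟩ := exists_one_add_rpow_mul_exp_le q
  refine ⟨C, hC, fun r τ hr hτ => ?_⟩
  have h1 := h (r / τ) (by positivity)
  have e : 1 + r / τ = (τ + r) / τ := by field_simp
  rw [e, Real.div_rpow (by positivity) (by positivity)] at h1
  have e2 : -(r / τ) / 4 = -r / (4 * τ) := by field_simp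
  rw [e2] at h1
  unfold heatProfile
  rw [sub_eq_add_neg, Real.rpow_add hτ, Real.rpow_neg (by positivity : 0 ≤ τ + r)]
  have : 0 < τ ^ q := by positivity
  have : 0 < (τ + r) ^ q := by positivity
  calc τ ^ (-p) * Real.exp (-r / (4 * τ))
      = (τ ^ (-p) * τ ^ q * ((τ + r) ^ q)⁻¹) *
        ((τ + r) ^ q / τ ^ q * Real.exp (-r / (4 * τ))) := by field_simp
    _ ≤ (τ ^ (-p) * τ ^ q * ((τ + r) ^ q)⁻¹) * C := by gcongr
    _ = _ := by ring

/-- The heat profile is close to its tail for large times. -/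
lemma sub_heatProfile_mem {p r t s : ℝ} (hp : 0 ≤ p) (hr : 0 ≤ r) (ht : 0 ≤ t) (hs : 0 < s) :
    0 ≤ s ^ (-p) - heatProfile p r (t + s) ∧
      s ^ (-p) - heatProfile p r (t + s) ≤ (p * t + r / 4) * s ^ (-p - 1) := by
  have hts : 0 < t + s := by linarith
  constructor
  · have h1 := heatProfile_le (p := p) hts hr
    have h2 : (t + s) ^ (-p) ≤ s ^ (-p) :=
      Real.rpow_le_rpow_of_nonpos hs (by linarith) (by linarith)
    linarith
  · have e : heatProfile p r (t + s) =
        s ^ (-p) * Real.exp (-p * Real.log (1 + t / s) + -r / (4 * (t + s))) := by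
      unfold heatProfile
      have : t + s = s * (1 + t / s) := by field_simp; ring
      rw [Real.exp_add, ← mul_assoc]
      congr 1
      rw [this, Real.mul_rpow hs.le (by positivity), Real.rpow_def_of_pos (by positivity : 0 < 1 + t / s)]
      ring_nf
    have h1 := Real.add_one_le_exp (-p * Real.log (1 + t / s) + -r / (4 * (t + s)))
    have h2 : Real.log (1 + t / s) ≤ t / s := by
      have := Real.log_le_sub_one_of_pos (by positivity : 0 < 1 + t / s); linarith
    have h3 : r / (4 * (t + s)) ≤ r / (4 * s) := by gcongr; linarith
    have h4 : 1 - (p * t + r / 4) / s ≤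
        Real.exp (-p * Real.log (1 + t / s) + -r / (4 * (t + s))) := by
      have h5 : p * Real.log (1 + t / s) ≤ p * (t / s) := by gcongr
      have h6 : (p * t + r / 4) / s = p * (t / s) + r / (4 * s) := by field_simp
      rw [neg_div] at h1 ⊢
      linarith
    have h7 := mul_le_mul_of_nonneg_left h4 (by positivity : 0 ≤ s ^ (-p))
    rw [e, Real.rpow_sub_one hs.ne']
    linear_combination h7

lemma measurable_heatProfile_add (p r t : ℝ) : Measurable fun s => heatProfile p r (t + s) := by
  unfold heatProfile; fun_prop

lemma measurable_profileTail (p : ℝ) : Measurable (profileTail p) :=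
  Measurable.ite measurableSet_Ioi (by fun_prop) measurable_const

lemma integrableOn_Ioc_heatProfile_add {p r t : ℝ} (hr : 0 ≤ r) (ht : 0 ≤ t)
    (h : 0 < t ∨ 0 < r) : IntegrableOn (fun s => heatProfile p r (t + s)) (Set.Ioc 0 1) := by
  obtain ⟨C, hC, hle⟩ := exists_heatProfile_le p p
  have hpos : 0 < t + r := by rcases h with h | h <;> linarith
  have hM : ∃ M, ∀ s ∈ Set.Ioc (0:ℝ) 1, (t + s + r) ^ (-p) ≤ M := by
    have hc : ContinuousOn (fun s : ℝ => (t + s + r) ^ (-p)) (Set.Icc 0 1) := by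
      refine ContinuousOn.rpow_const (by fun_prop) fun s hs => Or.inl ?_
      have := hs.1; intro h0; linarith
    obtain ⟨M, hM⟩ := isCompact_Icc.bddAbove_image hc
    exact ⟨M, fun s hs => hM (Set.mem_image_of_mem _ (Set.Ioc_subset_Icc_self hs))⟩
  obtain ⟨M, hM⟩ := hM
  refine Measure.integrableOn_of_bounded (M := C * M) (by simp)
    (measurable_heatProfile_add p r t).aestronglyMeasurable ?_
  refine ae_restrict_of_forall_mem measurableSet_Ioc fun s hs => ?_
  have hts : 0 < t + s := by linarith [hs.1]
  rw [Real.norm_of_nonneg (heatProfile_pos hts).le]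
  refine (hle r (t + s) hr hts).trans ?_
  rw [sub_self, Real.rpow_zero, mul_one]
  gcongr
  exact hM s hs

lemma integrableOn_heatProfile_sub_profileTail {p r t : ℝ} (hp : 0 < p) (hr : 0 ≤ r) (ht : 0 ≤ t)
    (h : 0 < t ∨ 0 < r) :
    IntegrableOn (fun s => heatProfile p r (t + s) - profileTail p s) (Set.Ioi 0) := by
  rw [← Set.Ioc_union_Ioi_eq_Ioi (zero_le_one' ℝ)]
  refine IntegrableOn.union ?_ ?_
  · refine (integrableOn_Ioc_heatProfile_add (p := p) hr ht h).congr_fun (fun s hs => ?_)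
      measurableSet_Ioc
    simp [profileTail, not_lt.2 hs.2]
  · refine Integrable.mono' ((integrableOn_Ioi_rpow_of_lt (a := -p - 1) (by linarith)
      one_pos).const_mul (p * t + r / 4))
      ((measurable_heatProfile_add p r t).sub (measurable_profileTail p)).aestronglyMeasurable ?_
    refine ae_restrict_of_forall_mem measurableSet_Ioi fun s hs => ?_
    have hs1 : (1:ℝ) < s := hs
    obtain ⟨h1, h2⟩ := sub_heatProfile_mem hp.le hr ht (one_pos.trans hs1)
    rw [profileTail, if_pos hs1, norm_sub_rev, Real.norm_of_nonneg h1]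
    exact h2

/-- The time integral of the (renormalized) heat profile from time `t` on. -/
def profileIntegral (p t r : ℝ) : ℝ :=
  ∫ s in Set.Ioi (0:ℝ), (heatProfile p r (t + s) - profileTail p s)

lemma heatProfile_mul {p r s : ℝ} (hr : 0 < r) (hs : 0 < s) :
    heatProfile p r (r * s) = r ^ (-p) * heatProfile p 1 s := by
  unfold heatProfile
  rw [Real.mul_rpow hr.le hs.le, mul_assoc]
  congr 3
  field_simp

lemma integrableOn_profileTail {p : ℝ} (hp : 1 < p) :
    IntegrableOn (profileTail p) (Set.Ioi 0) := by
  have h : profileTail p = (Set.Ioi 1).indicator fun s => s ^ (-p) := by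
    ext s; simp [profileTail, Set.indicator]
  rw [h]
  exact ((integrableOn_Ioi_rpow_of_lt (by linarith) one_pos).integrable_indicator
    measurableSet_Ioi).integrableOn

lemma exists_profileIntegral_zero_eq_rpow {p : ℝ} (hp : 1 < p) :
    ∃ K > 0, ∃ L : ℝ, ∀ r : ℝ, 0 < r → profileIntegral p 0 r = K * r ^ (1 - p) - L := by
  have hint : ∀ r : ℝ, 0 < r → IntegrableOn (fun s => heatProfile p r s) (Set.Ioi 0) := by
    intro r hr
    have := (integrableOn_heatProfile_sub_profileTail (p := p) (by linarith) hr.le le_rfl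
      (Or.inr hr)).add (integrableOn_profileTail hp)
    refine this.congr_fun (fun s _ => ?_) measurableSet_Ioi
    simp
  refine ⟨∫ s in Set.Ioi (0:ℝ), heatProfile p 1 s, ?_, ∫ s in Set.Ioi (0:ℝ), profileTail p s,
    fun r hr => ?_⟩
  · rw [gt_iff_lt, setIntegral_pos_iff_support_of_nonneg_ae
      (ae_restrict_of_forall_mem measurableSet_Ioi fun s hs => (heatProfile_pos hs).le)
      (hint 1 one_pos)]
    have : Set.Ioi (0:ℝ) ⊆ Function.support (fun s => heatProfile p 1 s) :=
      fun s hs => (heatProfile_pos hs).ne'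
    rw [Set.inter_eq_self_of_subset_right this]
    simp
  · have h := integral_comp_mul_left_Ioi (fun s => heatProfile p r s) 0 hr
    rw [mul_zero, setIntegral_congr_fun measurableSet_Ioi fun s hs => heatProfile_mul hr hs,
      integral_const_mul, smul_eq_mul] at h
    unfold profileIntegral
    simp_rw [zero_add]
    rw [integral_sub (hint r hr) (integrableOn_profileTail hp), sub_eq_add_neg 1 p,
      Real.rpow_add hr, Real.rpow_one]
    field_simp at h
    linear_combination -h

lemma profileIntegral_one_zero {r : ℝ} (hr : 0 < r) :
    profileIntegral 1 0 r = profileIntegral 1 0 1 - Real.log r := by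
  have h := integral_comp_mul_left_Ioi (fun s => heatProfile 1 r s - profileTail 1 s) 0 hr
  rw [mul_zero, smul_eq_mul] at h
  have hI : IntervalIntegrable (fun s : ℝ => s⁻¹) volume 1 r⁻¹ :=
    intervalIntegral.intervalIntegrable_inv (fun s hs => by
      have : 0 < s := lt_of_lt_of_le (lt_min one_pos (by positivity)) hs.1
      exact this.ne') continuousOn_id
  have hJ : ∫ s in Set.Ioi (0:ℝ), ((Set.Ioc 1 r⁻¹).indicator (fun s : ℝ => s⁻¹) s -
      (Set.Ioc r⁻¹ 1).indicator (fun s : ℝ => s⁻¹) s) = -Real.log r := by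
    rw [integral_sub (hI.1.integrable_indicator measurableSet_Ioc).integrableOn
      (hI.2.integrable_indicator measurableSet_Ioc).integrableOn,
      setIntegral_indicator measurableSet_Ioc, setIntegral_indicator measurableSet_Ioc,
      Set.inter_eq_self_of_subset_right, Set.inter_eq_self_of_subset_right]
    · have := integral_inv_of_pos one_pos (inv_pos.2 hr)
      rw [intervalIntegral] at this
      rw [this]; simp
    · exact fun s hs => lt_trans (inv_pos.2 hr) hs.1
    · exact fun s hs => lt_trans one_pos hs.1
  have hint := integrableOn_heatProfile_sub_profileTail (p := 1) one_pos zero_le_one le_rfl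
      (Or.inr one_pos)
  have key : ∀ s ∈ Set.Ioi (0:ℝ), heatProfile 1 r (r * s) - profileTail 1 (r * s) =
      r⁻¹ * ((heatProfile 1 1 (0 + s) - profileTail 1 s) +
      ((Set.Ioc 1 r⁻¹).indicator (fun s : ℝ => s⁻¹) s -
      (Set.Ioc r⁻¹ 1).indicator (fun s : ℝ => s⁻¹) s)) := by
    intro s hs
    have hs0 : 0 < s := hs
    rw [heatProfile_mul hr hs, Real.rpow_neg_one, zero_add]
    have hiff : 1 < r * s ↔ r⁻¹ < s := by rw [inv_lt_iff_one_lt_mul₀ hr, mul_comm]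
    simp only [profileTail, Set.indicator, Set.mem_Ioc, hiff, Real.rpow_neg_one, mul_inv]
    by_cases h1 : 1 < s <;> by_cases h2 : r⁻¹ < s <;>
      simp [h1, h2, not_lt.1, mul_sub, ← not_lt]
    all_goals ring
  rw [setIntegral_congr_fun measurableSet_Ioi key, integral_const_mul, integral_add hint, hJ] at h
  · unfold profileIntegral
    simp_rw [zero_add] at h ⊢
    have := mul_left_cancel₀ (inv_ne_zero hr.ne') h
    linarith
  · exact ((hI.1.integrable_indicator measurableSet_Ioc).sub
      (hI.2.integrable_indicator measurableSet_Ioc)).integrableOn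

/-- The fundamental solution of the Laplacian is, up to constants, the time integral of the heat
kernel. -/
lemma exists_lapFund_eq {n : ℕ} (hn : 2 ≤ n) :
    ∃ A B : ℝ, ∀ y : Euc n, y ≠ 0 →
      lapFund n y = A * profileIntegral ((n : ℝ) / 2) 0 (‖y‖ ^ 2) + B := by
  rcases hn.eq_or_lt with rfl | hn
  · refine ⟨-(4 * π)⁻¹, (4 * π)⁻¹ * profileIntegral 1 0 1, fun y hy => ?_⟩
    have hy' : 0 < ‖y‖ := norm_pos_iff.2 hy
    have : ((2 : ℕ) : ℝ) / 2 = 1 := by norm_num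
    rw [this, profileIntegral_one_zero (by positivity), Real.log_pow, lapFund, if_pos rfl]
    push_cast
    field_simp
    ring
  · have hp : (1:ℝ) < (n : ℝ) / 2 := by
      rw [lt_div_iff₀ two_pos]; exact_mod_cast (by omega : 1 * 2 < n)
    obtain ⟨K, hK, L, h⟩ := exists_profileIntegral_zero_eq_rpow hp
    set c := -((((n : ℝ) - 2) * (2 * π ^ ((n : ℝ) / 2) / Real.Gamma ((n : ℝ) / 2)))⁻¹) with hc
    refine ⟨c / K, c * L / K, fun y hy => ?_⟩
    have hy' : 0 < ‖y‖ := norm_pos_iff.2 hy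
    rw [h _ (by positivity), lapFund, if_neg (by omega), ← hc, ← Real.rpow_natCast ‖y‖ 2,
      ← Real.rpow_mul hy'.le]
    have : ((2 : ℕ) : ℝ) * (1 - (n : ℝ) / 2) = 2 - n := by push_cast; ring
    rw [this]
    field_simp
    ring

lemma integrable_prod_heatProfile (n : ℕ) (hn : n ≠ 0) (x : Euc n) {t : ℝ} (ht : 0 < t) :
    Integrable (fun q : Euc n × ℝ => (heatProfile ((n : ℝ) / 2) (‖q.1‖ ^ 2) q.2 -
      profileTail ((n : ℝ) / 2) q.2) * heatKer n (x - q.1) t)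
      (volume.prod (volume.restrict (Set.Ioi 0))) := by
  have hp : (0:ℝ) < (n : ℝ) / 2 := by positivity
  have hmeas : Measurable (fun q : Euc n × ℝ => (heatProfile ((n : ℝ) / 2) (‖q.1‖ ^ 2) q.2 -
      profileTail ((n : ℝ) / 2) q.2) * heatKer n (x - q.1) t) := by
    have h1 : Measurable fun q : Euc n × ℝ => profileTail ((n : ℝ) / 2) q.2 :=
      (measurable_profileTail _).comp measurable_snd
    have h2 : Measurable fun q : Euc n × ℝ => heatProfile ((n : ℝ) / 2) (‖q.1‖ ^ 2) q.2 := by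
      unfold heatProfile; fun_prop
    have h3 : Measurable fun q : Euc n × ℝ => heatKer n (x - q.1) t := by
      unfold heatKer; fun_prop
    exact (h2.sub h1).mul h3
  have hi : ∀ s > 0, Integrable fun y : Euc n => (heatProfile ((n : ℝ) / 2) (‖y‖ ^ 2) s -
      profileTail ((n : ℝ) / 2) s) * heatKer n (x - y) t := by
    intro s hs
    simp_rw [sub_mul]
    exact (integrable_heatProfile_mul_heatKer n x hs ht).sub
      ((integrable_heatKer_sub n x ht).const_mul _)
  have he : ∀ s > 0, ∫ y : Euc n, (heatProfile ((n : ℝ) / 2) (‖y‖ ^ 2) s -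
      profileTail ((n : ℝ) / 2) s) * heatKer n (x - y) t =
      heatProfile ((n : ℝ) / 2) (‖x‖ ^ 2) (t + s) - profileTail ((n : ℝ) / 2) s := by
    intro s hs
    simp_rw [sub_mul]
    rw [integral_sub (integrable_heatProfile_mul_heatKer n x hs ht)
      ((integrable_heatKer_sub n x ht).const_mul _), integral_const_mul,
      integral_heatProfile_mul_heatKer n x hs ht, integral_heatKer_sub n x ht, mul_one]
  rw [integrable_prod_iff' hmeas.aestronglyMeasurable]
  refine ⟨ae_restrict_of_forall_mem measurableSet_Ioi hi, ?_⟩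
  have hint := (integrableOn_heatProfile_sub_profileTail (p := (n : ℝ) / 2) hp
    (sq_nonneg ‖x‖) ht.le (Or.inl ht)).norm
  refine IntegrableOn.congr_fun hint (fun s hs => ?_) measurableSet_Ioi
  have hs0 : 0 < s := hs
  have hk : ∀ y, 0 ≤ heatKer n (x - y) t := fun y => by unfold heatKer; positivity
  simp only
  rw [← he s hs]
  by_cases h1 : 1 < s
  · have hneg : ∀ y : Euc n, (heatProfile ((n : ℝ) / 2) (‖y‖ ^ 2) s -
        profileTail ((n : ℝ) / 2) s) * heatKer n (x - y) t ≤ 0 := fun y =>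
      mul_nonpos_of_nonpos_of_nonneg (by
        rw [profileTail, if_pos h1]; linarith [heatProfile_le (p := (n : ℝ) / 2) hs (sq_nonneg ‖y‖)])
        (hk y)
    rw [Real.norm_of_nonpos (integral_nonpos hneg), ← integral_neg]
    exact integral_congr_ae (.of_forall fun y => (Real.norm_of_nonpos (hneg y)).symm)
  · have hpos : ∀ y : Euc n, 0 ≤ (heatProfile ((n : ℝ) / 2) (‖y‖ ^ 2) s -
        profileTail ((n : ℝ) / 2) s) * heatKer n (x - y) t := fun y =>
      mul_nonneg (by rw [profileTail, if_neg h1, sub_zero]; exact (heatProfile_pos hs).le) (hk y)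
    rw [Real.norm_of_nonneg (integral_nonneg hpos)]
    exact integral_congr_ae (.of_forall fun y => (Real.norm_of_nonneg (hpos y)).symm)

lemma exists_genPhi_eq {n : ℕ} (hn : 2 ≤ n) :
    ∃ A B : ℝ, ∀ t : ℝ, 0 < t → ∀ x : Euc n,
      genPhi n x t = A * profileIntegral ((n : ℝ) / 2) t (‖x‖ ^ 2) + B := by
  obtain ⟨A, B, h⟩ := exists_lapFund_eq hn
  refine ⟨A, B, fun t ht x => ?_⟩
  have : Nonempty (Fin n) := ⟨⟨0, by omega⟩⟩
  have hint := integrable_prod_heatProfile n (by omega) x ht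
  have hae : ∀ᵐ y : Euc n, lapFund n y * heatKer n (x - y) t =
      A * (∫ s in Set.Ioi (0:ℝ), (heatProfile ((n : ℝ) / 2) (‖y‖ ^ 2) s -
      profileTail ((n : ℝ) / 2) s) * heatKer n (x - y) t) + B * heatKer n (x - y) t := by
    filter_upwards [compl_mem_ae_iff.2 (measure_singleton (0 : Euc n))] with y hy
    rw [h y hy, integral_mul_const, profileIntegral]
    simp_rw [zero_add]
    ring
  rw [genPhi, integral_congr_ae hae, integral_add (hint.integral_prod_left.const_mul A)
    ((integrable_heatKer_sub n x ht).const_mul B), integral_const_mul, integral_const_mul,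
    integral_heatKer_sub n x ht, mul_one, integral_integral_swap hint, profileIntegral]
  congr 2
  refine setIntegral_congr_fun measurableSet_Ioi fun s hs => ?_
  simp only
  simp_rw [sub_mul]
  rw [integral_sub (integrable_heatProfile_mul_heatKer n x hs ht)
    ((integrable_heatKer_sub n x ht).const_mul _), integral_const_mul,
    integral_heatProfile_mul_heatKer n x hs ht, integral_heatKer_sub n x ht, mul_one]

/-- The time integral of the heat profile from time `t` on. -/
def profileTimeIntegral (q t r : ℝ) : ℝ := ∫ s in Set.Ioi (0:ℝ), heatProfile q r (t + s)

lemma hasDerivAt_heatProfile (p r : ℝ) {τ : ℝ} (hτ : 0 < τ) :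
    HasDerivAt (fun r => heatProfile p r τ) (-(1 / 4) * heatProfile (p + 1) r τ) r := by
  unfold heatProfile
  have h : HasDerivAt (fun r : ℝ => -r / (4 * τ)) (-1 / (4 * τ)) r :=
    ((hasDerivAt_id r).neg).div_const _
  refine (h.exp.const_mul (τ ^ (-p))).congr_deriv ?_
  rw [neg_add, ← sub_eq_add_neg, Real.rpow_sub_one hτ.ne']
  field_simp

lemma integrableOn_add_rpow {t a : ℝ} (ht : 0 < t) (ha : a < -1) :
    IntegrableOn (fun s : ℝ => (t + s) ^ a) (Set.Ioi 0) := by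
  simp_rw [add_comm t]
  exact integrableOn_add_rpow_Ioi_of_lt ha (by linarith)

lemma hasDerivAt_integral_heatProfile_sub {p t r : ℝ} {w : ℝ → ℝ} (hp : 0 < p) (ht : 0 < t)
    (hw : Measurable w)
    (hint : IntegrableOn (fun s => heatProfile p r (t + s) - w s) (Set.Ioi 0)) :
    HasDerivAt (fun r => ∫ s in Set.Ioi (0:ℝ), (heatProfile p r (t + s) - w s))
      (-(1 / 4) * profileTimeIntegral (p + 1) t r) r := by
  rw [profileTimeIntegral, ← integral_const_mul]
  refine (hasDerivAt_integral_of_dominated_loc_of_deriv_le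
    (bound := fun s => (t + s) ^ (-(p + 1)) * Real.exp ((|r| + 1) / (4 * t)))
    (F := fun r s => heatProfile p r (t + s) - w s)
    (F' := fun r s => -(1 / 4) * heatProfile (p + 1) r (t + s))
    (Metric.ball_mem_nhds r one_pos)
    (.of_forall fun r' => ((measurable_heatProfile_add p r' t).sub hw).aestronglyMeasurable) hint
    ((measurable_heatProfile_add (p + 1) r t).const_mul _).aestronglyMeasurable ?_
    ((integrableOn_add_rpow ht (by linarith)).mul_const _) ?_).2
  · refine ae_restrict_of_forall_mem measurableSet_Ioi fun s hs r' hr' => ?_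
    have hts : t < t + s := lt_add_of_pos_right t hs
    have hpos : 0 < t + s := ht.trans hts
    have hr1 : |r'| ≤ |r| + 1 := by
      rw [Metric.mem_ball, Real.dist_eq] at hr'
      have := abs_sub_abs_le_abs_sub r' r
      linarith
    have hexp : -r' / (4 * (t + s)) ≤ (|r| + 1) / (4 * t) := by
      gcongr
      exact (neg_le_abs r').trans hr1
    rw [norm_mul, Real.norm_of_nonneg (heatProfile_pos hpos).le]
    refine (mul_le_of_le_one_left (heatProfile_pos hpos).le (by norm_num)).trans ?_
    unfold heatProfile
    gcongr
  · exact ae_restrict_of_forall_mem measurableSet_Ioi fun s hs r' _ =>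
      (hasDerivAt_heatProfile p r' (add_pos ht hs)).sub_const _

lemma integrableOn_heatProfile_add {q t r : ℝ} (hq : 1 < q) (ht : 0 < t) (hr : 0 ≤ r) :
    IntegrableOn (fun s => heatProfile q r (t + s)) (Set.Ioi 0) := by
  refine Integrable.mono' (integrableOn_add_rpow ht (by linarith : -q < -1))
    (measurable_heatProfile_add q r t).aestronglyMeasurable ?_
  refine ae_restrict_of_forall_mem measurableSet_Ioi fun s hs => ?_
  have hts : 0 < t + s := add_pos ht hs
  rw [Real.norm_of_nonneg (heatProfile_pos hts).le]
  exact heatProfile_le hts hr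

lemma hasDerivAt_profileIntegral {p t r : ℝ} (hp : 0 < p) (ht : 0 < t) (hr : 0 ≤ r) :
    HasDerivAt (profileIntegral p t) (-(1 / 4) * profileTimeIntegral (p + 1) t r) r :=
  hasDerivAt_integral_heatProfile_sub hp ht (measurable_profileTail p)
    (integrableOn_heatProfile_sub_profileTail hp hr ht.le (Or.inl ht))

lemma hasDerivAt_profileTimeIntegral {q t r : ℝ} (hq : 1 < q) (ht : 0 < t) (hr : 0 ≤ r) :
    HasDerivAt (profileTimeIntegral q t) (-(1 / 4) * profileTimeIntegral (q + 1) t r) r := by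
  have h := hasDerivAt_integral_heatProfile_sub (p := q) (r := r) (w := fun _ => 0)
    (by linarith) ht measurable_const (by simpa using integrableOn_heatProfile_add hq ht hr)
  simp only [sub_zero] at h
  exact h

lemma profileTimeIntegral_nonneg {q t r : ℝ} (ht : 0 < t) : 0 ≤ profileTimeIntegral q t r :=
  setIntegral_nonneg measurableSet_Ioi fun _ hs => (heatProfile_pos (add_pos ht hs)).le

lemma integral_add_rpow_Ioi {t a : ℝ} (ht : 0 < t) :
    ∫ s in Set.Ioi (0:ℝ), (t + s) ^ a = t ^ (a + 1) * ∫ s in Set.Ioi (0:ℝ), (1 + s) ^ a := by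
  have h := integral_comp_mul_left_Ioi (fun s => (t + s) ^ a) 0 ht
  rw [mul_zero, smul_eq_mul] at h
  have e : ∀ s ∈ Set.Ioi (0:ℝ), (t + t * s) ^ a = t ^ a * (1 + s) ^ a := fun s hs => by
    have hs0 : 0 < s := hs
    rw [← Real.mul_rpow ht.le (by positivity), mul_add, mul_one]
  rw [setIntegral_congr_fun measurableSet_Ioi e, integral_const_mul] at h
  rw [Real.rpow_add_one ht.ne']
  field_simp at h
  linear_combination -h

lemma exists_profileTimeIntegral_le {q : ℝ} (hq : 5 / 4 ≤ q) :
    ∃ C ≥ 0, ∀ t r : ℝ, 0 < t → 0 ≤ r →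
      profileTimeIntegral q t r ≤ C * t ^ (-(1 / 4) : ℝ) * (t + r) ^ (5 / 4 - q) := by
  obtain ⟨C, hC, h⟩ := exists_heatProfile_le q (q - 5 / 4)
  refine ⟨C * ∫ s in Set.Ioi (0:ℝ), (1 + s) ^ (-(5 / 4) : ℝ),
    mul_nonneg hC.le (setIntegral_nonneg measurableSet_Ioi fun s hs => ?_), fun t r ht hr => ?_⟩
  · have hs0 : (0:ℝ) < s := hs
    positivity
  have h1 : ∀ s ∈ Set.Ioi (0:ℝ), heatProfile q r (t + s) ≤
      C * (t + r) ^ (5 / 4 - q) * (t + s) ^ (-(5 / 4) : ℝ) := by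
    intro s hs
    have hs0 : (0:ℝ) < s := hs
    refine (h r (t + s) hr (by positivity)).trans ?_
    have e1 : q - 5 / 4 - q = -(5 / 4) := by ring
    have e2 : -(q - 5 / 4) = 5 / 4 - q := by ring
    rw [e1, e2, mul_right_comm]
    gcongr ?_ * _
    refine mul_le_mul_of_nonneg_left ?_ hC.le
    exact Real.rpow_le_rpow_of_nonpos (by positivity) (by linarith) (by linarith)
  have h2 := setIntegral_mono_on (integrableOn_heatProfile_add (by linarith) ht hr)
    ((integrableOn_add_rpow ht (by norm_num : (-(5 / 4) : ℝ) < -1)).const_mul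
    (C * (t + r) ^ (5 / 4 - q))) measurableSet_Ioi h1
  rw [integral_const_mul, integral_add_rpow_Ioi ht] at h2
  refine h2.trans_eq ?_
  have e : (-(5 / 4) + 1 : ℝ) = -(1 / 4) := by norm_num
  rw [e]
  ring

lemma hasFDerivAt_comp_norm_sq {n : ℕ} {H : ℝ → ℝ} {H' : ℝ} {x : Euc n}
    (h : HasDerivAt H H' (‖x‖ ^ 2)) :
    HasFDerivAt (fun y : Euc n => H (‖y‖ ^ 2)) (H' • (2 • innerSL ℝ x)) x :=
  h.comp_hasFDerivAt x (hasStrictFDerivAt_norm_sq x).hasFDerivAt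

lemma hasFDerivAt_coord {n : ℕ} (j : Fin n) (x : Euc n) :
    HasFDerivAt (fun y : Euc n => y j) (EuclideanSpace.proj j : Euc n →L[ℝ] ℝ) x :=
  (EuclideanSpace.proj j : Euc n →L[ℝ] ℝ).hasFDerivAt

lemma pd_radial {n : ℕ} {H : ℝ → ℝ} {H' : ℝ} {x : Euc n} (i : Fin n)
    (h : HasDerivAt H H' (‖x‖ ^ 2)) : pd n i (fun y => H (‖y‖ ^ 2)) x = 2 * x i * H' := by
  rw [pd, (hasFDerivAt_comp_norm_sq h).fderiv]
  simp [EuclideanSpace.inner_single_right]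
  ring

lemma pd_pd_genPhi {n : ℕ} (hn : 2 ≤ n) :
    ∃ A : ℝ, ∀ t : ℝ, 0 < t → ∀ i j : Fin n, pd n i (pd n j fun y => genPhi n y t) =
      fun x : Euc n => A * ((if i = j then 1 else 0) * profileTimeIntegral ((n : ℝ) / 2 + 1) t (‖x‖ ^ 2)
        - 1 / 2 * (x i * x j * profileTimeIntegral ((n : ℝ) / 2 + 2) t (‖x‖ ^ 2))) := by
  obtain ⟨A, B, h⟩ := exists_genPhi_eq hn
  have hp : (0:ℝ) < (n : ℝ) / 2 := by positivity
  refine ⟨-A / 2, fun t ht i j => ?_⟩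
  have h1 : pd n j (fun y => genPhi n y t) =
      fun x : Euc n => -A / 2 * (x j * profileTimeIntegral ((n : ℝ) / 2 + 1) t (‖x‖ ^ 2)) := by
    funext x
    have e : (fun y => genPhi n y t) = fun y : Euc n =>
        (fun r => A * profileIntegral ((n : ℝ) / 2) t r + B) (‖y‖ ^ 2) := funext fun y => h t ht y
    rw [e, pd_radial j (((hasDerivAt_profileIntegral hp ht (sq_nonneg ‖x‖)).const_mul A).add_const B)]
    ring
  funext x
  have hJ := hasFDerivAt_comp_norm_sq (hasDerivAt_profileTimeIntegral
    (q := (n : ℝ) / 2 + 1) (by linarith) ht (sq_nonneg ‖x‖))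
  rw [h1, pd, (((hasFDerivAt_coord j x).fun_mul hJ).const_mul (-A / 2)).fderiv]
  have e : (n : ℝ) / 2 + 1 + 1 = (n : ℝ) / 2 + 2 := by ring
  simp [EuclideanSpace.inner_single_right, e, eq_comm (a := i)]
  split_ifs <;> ring

lemma exists_pd_pd_pd_genPhi {n : ℕ} (hn : 2 ≤ n) :
    ∃ A : ℝ, ∀ t : ℝ, 0 < t → ∀ i j k : Fin n, ∀ x : Euc n,
      DifferentiableAt ℝ (pd n i (pd n j fun y => genPhi n y t)) x ∧
      pd n k (pd n i (pd n j fun y => genPhi n y t)) x =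
        A * (((if i = j then 1 else 0) * x k + (if k = i then 1 else 0) * x j
          + (if k = j then 1 else 0) * x i) * profileTimeIntegral ((n : ℝ) / 2 + 2) t (‖x‖ ^ 2)
        - 1 / 2 * (x i * x j * x k * profileTimeIntegral ((n : ℝ) / 2 + 3) t (‖x‖ ^ 2))) := by
  obtain ⟨A, h⟩ := pd_pd_genPhi hn
  have hp : (0:ℝ) < (n : ℝ) / 2 := by positivity
  refine ⟨-A / 2, fun t ht i j k x => ?_⟩
  have hJ1 := hasFDerivAt_comp_norm_sq (hasDerivAt_profileTimeIntegral
    (q := (n : ℝ) / 2 + 1) (by linarith) ht (sq_nonneg ‖x‖))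
  have hJ2 := hasFDerivAt_comp_norm_sq (hasDerivAt_profileTimeIntegral
    (q := (n : ℝ) / 2 + 2) (by linarith) ht (sq_nonneg ‖x‖))
  rw [h t ht i j]
  generalize (if i = j then (1:ℝ) else 0) = d
  have hD := ((hJ1.const_mul d).fun_sub
    ((((hasFDerivAt_coord i x).fun_mul (hasFDerivAt_coord j x)).fun_mul hJ2).const_mul (1 / 2))).const_mul A
  refine ⟨hD.differentiableAt, ?_⟩
  rw [pd, hD.fderiv]
  have e : (n : ℝ) / 2 + 1 + 1 = (n : ℝ) / 2 + 2 := by ring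
  have e' : (n : ℝ) / 2 + 2 + 1 = (n : ℝ) / 2 + 3 := by ring
  simp [EuclideanSpace.inner_single_right, e, e', eq_comm (a := k)]
  split_ifs <;> ring

lemma exists_abs_pd_pd_pd_genPhi_le {n : ℕ} (hn : 2 ≤ n) :
    ∃ C ≥ 0, ∀ t : ℝ, 0 < t → ∀ i j k : Fin n, ∀ x : Euc n,
      |pd n k (pd n i (pd n j fun y => genPhi n y t)) x| ≤
        C * t ^ (-(1 / 4) : ℝ) * (t + ‖x‖ ^ 2) ^ (-((n : ℝ) / 2 + 1 / 4)) := by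
  obtain ⟨A, hA⟩ := exists_pd_pd_pd_genPhi hn
  obtain ⟨C₂, hC₂, h₂⟩ := exists_profileTimeIntegral_le (q := (n : ℝ) / 2 + 2)
    (by linarith [(n.cast_nonneg : (0:ℝ) ≤ n)])
  obtain ⟨C₃, hC₃, h₃⟩ := exists_profileTimeIntegral_le (q := (n : ℝ) / 2 + 3)
    (by linarith [(n.cast_nonneg : (0:ℝ) ≤ n)])
  refine ⟨|A| * (3 * C₂ + C₃), by positivity, fun t ht i j k x => ?_⟩
  rw [(hA t ht i j k x).2]
  set R := t + ‖x‖ ^ 2 with hR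
  have hRpos : 0 < R := by positivity
  have hx : ‖x‖ ≤ R ^ (1 / 2 : ℝ) := by
    rw [← Real.sqrt_eq_rpow]
    exact Real.le_sqrt_of_sq_le (by rw [hR]; linarith)
  have hx3 : ‖x‖ ^ 3 ≤ R ^ (3 / 2 : ℝ) := by
    calc ‖x‖ ^ 3 ≤ (R ^ (1 / 2 : ℝ)) ^ 3 := by gcongr
      _ = R ^ (3 / 2 : ℝ) := by
        rw [← Real.rpow_natCast, ← Real.rpow_mul hRpos.le]; norm_num
  have hc : ∀ l : Fin n, |x l| ≤ ‖x‖ := fun l => PiLp.norm_apply_le x l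
  have hd : ∀ (a b l : Fin n), |(if a = b then (1:ℝ) else 0) * x l| ≤ ‖x‖ := by
    intro a b l
    split_ifs
    · rw [one_mul]; exact hc l
    · rw [zero_mul, abs_zero]; exact norm_nonneg x
  have hJ₂ := profileTimeIntegral_nonneg (q := (n : ℝ) / 2 + 2) (r := ‖x‖ ^ 2) ht
  have hJ₃ := profileTimeIntegral_nonneg (q := (n : ℝ) / 2 + 3) (r := ‖x‖ ^ 2) ht
  have b₂ := h₂ t (‖x‖ ^ 2) ht (sq_nonneg _)
  have b₃ := h₃ t (‖x‖ ^ 2) ht (sq_nonneg _)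
  rw [← hR] at b₂ b₃
  set J₂ := profileTimeIntegral ((n : ℝ) / 2 + 2) t (‖x‖ ^ 2)
  set J₃ := profileTimeIntegral ((n : ℝ) / 2 + 3) t (‖x‖ ^ 2)
  have m₂ : ‖x‖ * J₂ ≤ C₂ * (t ^ (-(1 / 4) : ℝ) * R ^ (-((n : ℝ) / 2 + 1 / 4))) := by
    refine (mul_le_mul hx b₂ hJ₂ (by positivity)).trans_eq ?_
    have e : -((n : ℝ) / 2 + 1 / 4) = 1 / 2 + (5 / 4 - ((n : ℝ) / 2 + 2)) := by ring
    rw [e, Real.rpow_add hRpos]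
    ring
  have m₃ : ‖x‖ ^ 3 * J₃ ≤ C₃ * (t ^ (-(1 / 4) : ℝ) * R ^ (-((n : ℝ) / 2 + 1 / 4))) := by
    refine (mul_le_mul hx3 b₃ hJ₃ (by positivity)).trans_eq ?_
    have e : -((n : ℝ) / 2 + 1 / 4) = 3 / 2 + (5 / 4 - ((n : ℝ) / 2 + 3)) := by ring
    rw [e, Real.rpow_add hRpos]
    ring
  have s₂ : |((if i = j then (1:ℝ) else 0) * x k + (if k = i then 1 else 0) * x j
      + (if k = j then 1 else 0) * x i) * J₂| ≤ 3 * (‖x‖ * J₂) := by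
    rw [abs_mul, abs_of_nonneg hJ₂, ← mul_assoc]
    refine mul_le_mul_of_nonneg_right ((abs_add_three _ _ _).trans ?_) hJ₂
    linarith [hd i j k, hd k i j, hd k j i]
  have s₃ : |1 / 2 * (x i * x j * x k * J₃)| ≤ ‖x‖ ^ 3 * J₃ := by
    rw [abs_mul, abs_mul, abs_mul, abs_mul, abs_of_nonneg hJ₃]
    have : |x i| * |x j| * |x k| ≤ ‖x‖ * ‖x‖ * ‖x‖ := by
      gcongr <;> exact hc _
    have h' := mul_le_mul_of_nonneg_right this hJ₃
    have h0 : 0 ≤ |x i| * |x j| * |x k| * J₃ := by positivity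
    rw [abs_of_nonneg (by norm_num : (0:ℝ) ≤ 1 / 2)]
    linarith
  rw [abs_mul]
  refine (mul_le_mul_of_nonneg_left (c := (3 * C₂ + C₃) *
    (t ^ (-(1 / 4) : ℝ) * R ^ (-((n : ℝ) / 2 + 1 / 4)))) ?_ (abs_nonneg A)).trans_eq (by ring)
  refine (abs_sub _ _).trans ?_
  linarith

/-- Pointwise bound for the derivative of the Oseen kernel. -/
lemma exists_abs_Kten_le {n : ℕ} (hn : 2 ≤ n) :
    ∃ C ≥ 0, ∀ t : ℝ, 0 < t → ∀ i j k : Fin n, ∀ x : Euc n,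
      |Kten n i j k x t| ≤
        C * t ^ (-(1 / 4) : ℝ) * (t + ‖x‖ ^ 2) ^ (-((n : ℝ) / 2 + 1 / 4)) := by
  obtain ⟨A, hA⟩ := exists_pd_pd_pd_genPhi hn
  obtain ⟨C, hC, h⟩ := exists_abs_pd_pd_pd_genPhi_le hn
  refine ⟨((n : ℝ) + 1) * C, by positivity, fun t ht i j k x => ?_⟩
  set b := C * t ^ (-(1 / 4) : ℝ) * (t + ‖x‖ ^ 2) ^ (-((n : ℝ) / 2 + 1 / 4)) with hb
  have hb0 : 0 ≤ b := by positivity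
  have hd : ∀ i j : Fin n, DifferentiableAt ℝ (pd n i (pd n j fun y => genPhi n y t)) x :=
    fun i j => (hA t ht i j k x).1
  have hlap : HasFDerivAt (lap n fun y => genPhi n y t)
      (∑ l : Fin n, fderiv ℝ (pd n l (pd n l fun y => genPhi n y t)) x) x :=
    HasFDerivAt.fun_sum fun l _ => (hd l l).hasFDerivAt
  have hlap' : |fderiv ℝ (lap n fun y => genPhi n y t) x (EuclideanSpace.single k 1)| ≤ n * b := by
    rw [hlap.fderiv, sum_apply]
    refine (Finset.abs_sum_le_sum_abs _ _).trans ?_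
    refine (Finset.sum_le_card_nsmul _ _ b fun l _ => h t ht l l k x).trans_eq ?_
    simp
  have hij := h t ht i j k x
  rw [← hb] at hij
  have hgoal : |Kten n i j k x t| ≤ n * b + b := by
    by_cases hij' : i = j
    · have e : (fun y => Kmat n i j y t) = fun y => -(lap n (fun y => genPhi n y t) y) +
          pd n i (pd n j fun y => genPhi n y t) y := by
        funext y; simp only [Kmat, if_pos hij']
      rw [Kten, e, pd, (hlap.fun_neg.fun_add (hd i j).hasFDerivAt).fderiv, ← hlap.fderiv]
      refine (abs_add_le _ _).trans (add_le_add ?_ hij)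
      exact (abs_neg _).trans_le hlap'
    · have e : (fun y => Kmat n i j y t) = pd n i (pd n j fun y => genPhi n y t) := by
        funext y; simp only [Kmat, if_neg hij', zero_add]
      rw [Kten, e]
      have : 0 ≤ (n : ℝ) * b := by positivity
      linarith
  refine hgoal.trans_eq ?_
  rw [hb]; ring

lemma integrable_add_norm_sq_rpow (n : ℕ) {t : ℝ} (ht : 0 < t) (x : Euc n) :
    Integrable (fun y : Euc n => (t + ‖x - y‖ ^ 2) ^ (-((n : ℝ) / 2 + 1 / 4))) ∧
    ∫ y : Euc n, (t + ‖x - y‖ ^ 2) ^ (-((n : ℝ) / 2 + 1 / 4)) =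
      t ^ (-(1 / 4) : ℝ) * ∫ y : Euc n, (1 + ‖y‖ ^ 2) ^ (-((n : ℝ) / 2 + 1 / 4)) := by
  have hint : Integrable (fun y : Euc n => (1 + ‖y‖ ^ 2) ^ (-((n : ℝ) / 2 + 1 / 4))) := by
    have := integrable_rpow_neg_one_add_norm_sq (E := Euc n) (μ := volume)
      (r := (n : ℝ) + 1 / 2) (by rw [finrank_euclideanSpace_fin]; linarith)
    have e : -((n : ℝ) / 2 + 1 / 4) = -((n : ℝ) + 1 / 2) / 2 := by ring
    rw [e]; exact this
  have hs : 0 < √t := Real.sqrt_pos.2 ht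
  have e : (fun y : Euc n => (t + ‖y‖ ^ 2) ^ (-((n : ℝ) / 2 + 1 / 4))) = fun y =>
      t ^ (-((n : ℝ) / 2 + 1 / 4)) * (1 + ‖(√t)⁻¹ • y‖ ^ 2) ^ (-((n : ℝ) / 2 + 1 / 4)) := by
    funext y
    rw [← Real.mul_rpow ht.le (by positivity), norm_smul, mul_pow, norm_inv, inv_pow,
      Real.norm_of_nonneg hs.le, Real.sq_sqrt ht.le]
    congr 1
    field_simp
  have hint' : Integrable (fun y : Euc n => (t + ‖y‖ ^ 2) ^ (-((n : ℝ) / 2 + 1 / 4))) := by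
    rw [e]
    exact ((integrable_comp_smul_iff volume _ (inv_ne_zero hs.ne')).2 hint).const_mul _
  refine ⟨hint'.comp_sub_left x, ?_⟩
  rw [integral_sub_left_eq_self (fun y : Euc n => (t + ‖y‖ ^ 2) ^ (-((n : ℝ) / 2 + 1 / 4))) volume x,
    e, integral_const_mul, Measure.integral_comp_inv_smul_of_nonneg volume
    (fun y : Euc n => (1 + ‖y‖ ^ 2) ^ (-((n : ℝ) / 2 + 1 / 4))) hs.le, finrank_euclideanSpace_fin,
    smul_eq_mul, ← mul_assoc]
  congr 1
  rw [Real.sqrt_eq_rpow, ← Real.rpow_natCast, ← Real.rpow_mul ht.le, ← Real.rpow_add ht]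
  congr 1
  ring

lemma integrableOn_sub_rpow_neg_half {t : ℝ} (ht : 0 < t) :
    IntegrableOn (fun s : ℝ => (t - s) ^ (-(1 / 2) : ℝ)) (Set.Ioo 0 t) ∧
    ∫ s in Set.Ioo 0 t, (t - s) ^ (-(1 / 2) : ℝ) = 2 * √t := by
  have h := (intervalIntegral.intervalIntegrable_rpow' (a := 0) (b := t)
    (by norm_num : (-1:ℝ) < -(1 / 2))).comp_sub_left t
  rw [sub_zero, sub_self] at h
  constructor
  · exact ((intervalIntegrable_iff_integrableOn_Ioc_of_le ht.le).1 h.symm).mono_set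
      Set.Ioo_subset_Ioc_self
  · rw [← integral_Ioc_eq_integral_Ioo, ← intervalIntegral.integral_of_le ht.le,
      intervalIntegral.integral_comp_sub_left (fun s => s ^ (-(1 / 2) : ℝ)) t, sub_self, sub_zero,
      integral_rpow (Or.inl (by norm_num)), Real.sqrt_eq_rpow, Real.zero_rpow (by norm_num)]
    norm_num
    ring

lemma norm_le_card_mul_of_abs_le {n : ℕ} {z : Euc n} {M : ℝ} (h : ∀ i, |z i| ≤ M) :
    ‖z‖ ≤ n * M := by
  have e : z = ∑ i, EuclideanSpace.single i (z i) := by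
    ext j
    simp [Finset.sum_apply]
  calc ‖z‖ = ‖∑ i, EuclideanSpace.single i (z i)‖ := by rw [← e]
    _ ≤ ∑ i, ‖EuclideanSpace.single i (z i)‖ := norm_sum_le _ _
    _ ≤ ∑ _i : Fin n, M := Finset.sum_le_sum fun i _ => by
        rw [PiLp.norm_single]; exact h i
    _ = n * M := by simp

/-- Estimate (4.6): ‖B(u,v)‖_{L^∞(ℝⁿ×(0,T))} ≤ C(n) √T ‖u‖_{L^∞} ‖v‖_{L^∞}. -/
theorem bilinear_form_estimate (n : ℕ) (hn : 2 ≤ n) :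
    ∃ C > (0:ℝ), ∀ (T : ℝ), 0 < T → ∀ (u v : Euc n → ℝ → Euc n) (U V : ℝ),
      Measurable (fun q : Euc n × ℝ => u q.1 q.2) →
      Measurable (fun q : Euc n × ℝ => v q.1 q.2) →
      (∀ x : Euc n, ∀ t ∈ Set.Ioo (0:ℝ) T, ‖u x t‖ ≤ U) →
      (∀ x : Euc n, ∀ t ∈ Set.Ioo (0:ℝ) T, ‖v x t‖ ≤ V) →
      ∀ x : Euc n, ∀ t ∈ Set.Ioo (0:ℝ) T,
        ‖nsBilin n u v x t‖ ≤ C * Real.sqrt T * U * V := by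
  obtain ⟨K, hK, hKten⟩ := exists_abs_Kten_le hn
  set I := ∫ y : Euc n, (1 + ‖y‖ ^ 2) ^ (-((n : ℝ) / 2 + 1 / 4)) with hI
  have hI0 : 0 ≤ I := integral_nonneg fun y => by positivity
  refine ⟨2 * n ^ 3 * K * I + 1, by positivity, ?_⟩
  intro T hT u v U V _ _ hu hv x t ht
  have hU : 0 ≤ U := (norm_nonneg _).trans (hu x t ht)
  have hV : 0 ≤ V := (norm_nonneg _).trans (hv x t ht)
  have ht0 : 0 < t := ht.1
  set D := (n : ℝ) ^ 2 * K * U * V with hD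
  have hD0 : 0 ≤ D := by positivity
  have hpt : ∀ s ∈ Set.Ioo 0 t, ∀ i : Fin n, ∀ y : Euc n,
      ‖∑ j : Fin n, ∑ k : Fin n, Kten n i j k (x - y) (t - s) * u y s k * v y s j‖ ≤
        D * (t - s) ^ (-(1 / 4) : ℝ) *
          (t - s + ‖x - y‖ ^ 2) ^ (-((n : ℝ) / 2 + 1 / 4)) := by
    intro s hs i y
    have hts : 0 < t - s := sub_pos.2 hs.2
    have hsT : s ∈ Set.Ioo 0 T := ⟨hs.1, hs.2.trans ht.2⟩
    set b := K * (t - s) ^ (-(1 / 4) : ℝ) *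
      (t - s + ‖x - y‖ ^ 2) ^ (-((n : ℝ) / 2 + 1 / 4)) with hb
    have hb0 : 0 ≤ b := by positivity
    have hterm : ∀ j k : Fin n,
        ‖Kten n i j k (x - y) (t - s) * u y s k * v y s j‖ ≤ b * U * V := by
      intro j k
      rw [norm_mul, norm_mul]
      have h1 : ‖Kten n i j k (x - y) (t - s)‖ ≤ b := hKten (t - s) hts i j k (x - y)
      have h2 : ‖u y s k‖ ≤ U := (PiLp.norm_apply_le _ k).trans (hu y s hsT)
      have h3 : ‖v y s j‖ ≤ V := (PiLp.norm_apply_le _ j).trans (hv y s hsT)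
      gcongr
    calc _ ≤ ∑ _j : Fin n, ∑ _k : Fin n, b * U * V :=
          norm_sum_le_of_le _ fun j _ => norm_sum_le_of_le _ fun k _ => hterm j k
      _ = D * (t - s) ^ (-(1 / 4) : ℝ) *
          (t - s + ‖x - y‖ ^ 2) ^ (-((n : ℝ) / 2 + 1 / 4)) := by
        simp only [Finset.sum_const, Finset.card_univ, Fintype.card_fin, nsmul_eq_mul]
        rw [hb, hD]; ring
  have hspace : ∀ s ∈ Set.Ioo 0 t, ∀ i : Fin n,
      ‖∫ y : Euc n, ∑ j : Fin n, ∑ k : Fin n,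
        Kten n i j k (x - y) (t - s) * u y s k * v y s j‖ ≤
          D * I * (t - s) ^ (-(1 / 2) : ℝ) := by
    intro s hs i
    have hts : 0 < t - s := sub_pos.2 hs.2
    obtain ⟨hint, heq⟩ := integrable_add_norm_sq_rpow n hts x
    refine (norm_integral_le_of_norm_le (hint.const_mul (D * (t - s) ^ (-(1 / 4) : ℝ)))
      (.of_forall (hpt s hs i))).trans_eq ?_
    have e : (-(1 / 2) : ℝ) = -(1 / 4) + -(1 / 4) := by norm_num
    rw [integral_const_mul, heq, ← hI, e, Real.rpow_add hts]
    ring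
  have hcoord : ∀ i : Fin n, |nsBilin n u v x t i| ≤ D * I * (2 * √t) := by
    intro i
    obtain ⟨hint, heq⟩ := integrableOn_sub_rpow_neg_half ht0
    rw [← heq, ← integral_const_mul]
    change |-∫ s in Set.Ioo 0 t, ∫ y : Euc n, ∑ j : Fin n, ∑ k : Fin n,
      Kten n i j k (x - y) (t - s) * u y s k * v y s j| ≤ _
    rw [abs_neg]
    exact norm_integral_le_of_norm_le (hint.const_mul (D * I))
      (ae_restrict_of_forall_mem measurableSet_Ioo fun s hs => hspace s hs i)
  have hsq : √t ≤ √T := Real.sqrt_le_sqrt ht.2.le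
  calc ‖nsBilin n u v x t‖ ≤ n * (D * I * (2 * √t)) := norm_le_card_mul_of_abs_le hcoord
    _ ≤ n * (D * I * (2 * √T)) := by gcongr
    _ = 2 * n ^ 3 * K * I * √T * U * V := by rw [hD]; ring
    _ ≤ (2 * n ^ 3 * K * I + 1) * √T * U * V := by
      gcongr
      linarith

end
end

section
/- There exist constants ε₀ = ε₀(n) > 0 and C₀ = C₀(n) such that for every divergence-free (in the sense of distributions) u₀ ∈ L^∞(ℝⁿ;ℝⁿ) with N = ‖u₀‖_{L^∞(ℝⁿ)} > 0, setting T = ε₀ N^{−2}, there exists a mild solution u ∈ L^∞(ℝⁿ×(0,T); ℝⁿ) of the Navier–Stokes equations with initial datum u₀ satisfying ‖u‖_{L^∞(ℝⁿ×(0,T))} ≤ C₀ N, and u is the unique mild solution with initial datum u₀ in the ball {v ∈ L^∞(ℝⁿ×(0,T); ℝⁿ) : ‖v‖_{L^∞} ≤ C₀ N}. -/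
open MeasureTheory Real Filter Topology

noncomputable section

section Partials

variable {n : ℕ}

lemma pd_congr {i : Fin n} {f g : Euc n → ℝ} {x : Euc n} (h : f =ᶠ[𝓝 x] g) :
    pd n i f x = pd n i g x := by
  unfold pd; rw [h.fderiv_eq]

lemma pd_comp_smul (i : Fin n) (f : Euc n → ℝ) (c : ℝ) (x : Euc n) :
    pd n i (fun y => f (c • y)) x = c * pd n i f (c • x) := by
  unfold pd
  rw [fderiv_comp_smul]; simp

lemma pd_const_mul (i : Fin n) (f : Euc n → ℝ) (a : ℝ) (x : Euc n) :
    pd n i (fun y => a * f y) x = a * pd n i f x := by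
  unfold pd
  have h : (fun y => a * f y) = a • f := by ext; simp
  rw [h, fderiv_const_smul_field]; simp

lemma pd_add_const (i : Fin n) (f : Euc n → ℝ) (b : ℝ) (x : Euc n) :
    pd n i (fun y => f y + b) x = pd n i f x := by
  unfold pd
  rw [fderiv_add_const]

lemma pd_add {i : Fin n} {f g : Euc n → ℝ} (hf : Differentiable ℝ f) (hg : Differentiable ℝ g) :
    pd n i (fun y => f y + g y) = fun x => pd n i f x + pd n i g x := by
  ext x
  unfold pd
  rw [fderiv_fun_add (hf x) (hg x)]; simp

lemma ContDiffAt.pd {i : Fin n} {f : Euc n → ℝ} {x : Euc n}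
    (hf : ContDiffAt ℝ (⊤ : ℕ∞) f x) : ContDiffAt ℝ (⊤ : ℕ∞) (pd n i f) x := by
  have h1 : ContDiffAt ℝ (⊤ : ℕ∞) (fderiv ℝ f) x := hf.fderiv_right (by simp)
  exact h1.clm_apply contDiffAt_const

lemma ContDiff.pd {i : Fin n} {f : Euc n → ℝ}
    (hf : ContDiff ℝ (⊤ : ℕ∞) f) : ContDiff ℝ (⊤ : ℕ∞) (pd n i f) :=
  contDiff_iff_contDiffAt.2 fun x => (contDiff_iff_contDiffAt.1 hf x).pd

lemma measurable_pd (i : Fin n) (f : Euc n → ℝ) : Measurable (pd n i f) :=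
  measurable_fderiv_apply_const ℝ f _

lemma norm_le_sum_apply_single (L : Euc n →L[ℝ] ℝ) :
    ‖L‖ ≤ ∑ i, |L (EuclideanSpace.single i 1)| := by
  refine L.opNorm_le_bound (Finset.sum_nonneg fun i _ => abs_nonneg _) fun v => ?_
  have hv : v = ∑ i, v i • EuclideanSpace.single i (1 : ℝ) := by
    ext j; simp [Finset.sum_apply, Pi.single_apply]
  have h1 : L v = ∑ i, v i * L (EuclideanSpace.single i 1) := by
    conv_lhs => rw [hv]
    simp
  rw [h1, Finset.sum_mul]
  refine (norm_sum_le _ _).trans (Finset.sum_le_sum fun i _ => ?_)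
  rw [norm_mul, mul_comm, Real.norm_eq_abs (L _)]
  exact mul_le_mul_of_nonneg_left (PiLp.norm_apply_le v i) (abs_nonneg _)

end Partials

section Growth

variable {n : ℕ}

/-- At most polynomial growth. -/
def PolyGrowth (g : Euc n → ℝ) : Prop := ∃ C : ℝ, ∃ k : ℕ, ∀ x, |g x| ≤ C * (1 + ‖x‖) ^ k

/-- All polynomial moments are finite. -/
def RapidDecay (w : Euc n → ℝ) : Prop :=
  ∀ k : ℕ, Integrable (fun y => (1 + ‖y‖) ^ k * w y)

lemma RapidDecay.integrable {w : Euc n → ℝ} (hw : RapidDecay w) : Integrable w := by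
  simpa using hw 0

lemma one_add_norm_sub_le (x y : Euc n) : 1 + ‖x - y‖ ≤ (1 + ‖x‖) * (1 + ‖y‖) := by
  have := norm_sub_le x y
  nlinarith [norm_nonneg x, norm_nonneg y]

lemma abs_mul_le_of_growth {w g : Euc n → ℝ} {C : ℝ} {k : ℕ}
    (hg : ∀ x, |g x| ≤ C * (1 + ‖x‖) ^ k) (x y : Euc n) {R : ℝ} (hx : 1 + ‖x‖ ≤ R) :
    |w y * g (x - y)| ≤ (C * R ^ k) * ‖(1 + ‖y‖) ^ k * w y‖ := by
  have hC : 0 ≤ C := by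
    have := (abs_nonneg _).trans (hg 0); simpa using this
  have h1 : (1 + ‖x - y‖) ^ k ≤ (R * (1 + ‖y‖)) ^ k := by
    refine pow_le_pow_left₀ (by positivity) ?_ k
    exact (one_add_norm_sub_le x y).trans (mul_le_mul_of_nonneg_right hx (by positivity))
  have h2 := (hg (x - y)).trans (mul_le_mul_of_nonneg_left h1 hC)
  rw [abs_mul, norm_mul, Real.norm_of_nonneg (by positivity : (0:ℝ) ≤ (1 + ‖y‖) ^ k),
    Real.norm_eq_abs]
  calc |w y| * |g (x - y)| ≤ |w y| * (C * (R * (1 + ‖y‖)) ^ k) := by gcongr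
    _ = _ := by rw [mul_pow]; ring

lemma integrable_mul_comp_sub {w g : Euc n → ℝ} (hw : RapidDecay w) (hg : PolyGrowth g)
    (hgc : Continuous g) (x : Euc n) : Integrable (fun y => w y * g (x - y)) := by
  obtain ⟨C, k, hC⟩ := hg
  refine Integrable.mono' ((hw k).norm.const_mul (C * (1 + ‖x‖) ^ k)) ?_ ?_
  · exact hw.integrable.aestronglyMeasurable.mul
      (hgc.comp (continuous_const.sub continuous_id)).aestronglyMeasurable
  · exact Eventually.of_forall fun y => abs_mul_le_of_growth hC x y le_rfl

/-- Differentiation of a convolution on the smooth factor. -/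
lemma hasFDerivAt_conv {w g : Euc n → ℝ} (hw : RapidDecay w) (hg : PolyGrowth g)
    (hgs : ContDiff ℝ (⊤ : ℕ∞) g) (hg' : ∀ i, PolyGrowth (pd n i g)) (x : Euc n) :
    HasFDerivAt (fun x => ∫ y, w y * g (x - y)) (∫ y, w y • fderiv ℝ g (x - y)) x := by
  choose C k hC using hg'
  have hfc : Continuous (fderiv ℝ g) := hgs.continuous_fderiv (by simp)
  refine hasFDerivAt_integral_of_dominated_of_fderiv_le
    (F' := fun x y => w y • fderiv ℝ g (x - y)) (s := Metric.ball x 1)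
    (bound := fun y => ∑ i, (C i * (2 + ‖x‖) ^ k i) * ‖(1 + ‖y‖) ^ k i * w y‖)
    (Metric.ball_mem_nhds x one_pos) ?_ (integrable_mul_comp_sub hw hg hgs.continuous x) ?_ ?_ ?_ ?_
  · exact Eventually.of_forall fun z =>
      (integrable_mul_comp_sub hw hg hgs.continuous z).aestronglyMeasurable
  · exact hw.integrable.aestronglyMeasurable.smul
      (hfc.comp (continuous_const.sub continuous_id)).aestronglyMeasurable
  · refine Eventually.of_forall fun y z hz => ?_
    have hz' : 1 + ‖z‖ ≤ 2 + ‖x‖ := by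
      have h1 : ‖z - x‖ < 1 := by simpa [dist_eq_norm] using hz
      have h2 := norm_sub_norm_le z x
      linarith
    rw [norm_smul]
    calc ‖w y‖ * ‖fderiv ℝ g (z - y)‖ ≤ ‖w y‖ * ∑ i, |pd n i g (z - y)| :=
          mul_le_mul_of_nonneg_left (norm_le_sum_apply_single _) (norm_nonneg _)
      _ = ∑ i, |w y * pd n i g (z - y)| := by
          rw [Finset.mul_sum]; simp [abs_mul]
      _ ≤ _ := Finset.sum_le_sum fun i _ => abs_mul_le_of_growth (hC i) z y hz'
  · exact integrable_finsetSum _ fun i _ => (hw (k i)).norm.const_mul _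
  · refine Eventually.of_forall fun y z _ => ?_
    have h1 : HasFDerivAt g (fderiv ℝ g (z - y)) (z - y) :=
      (hgs.differentiable (by simp) _).hasFDerivAt
    have h2 := h1.comp z ((hasFDerivAt_id z).sub_const y)
    rw [ContinuousLinearMap.comp_id] at h2
    exact h2.const_mul (w y)

lemma integrable_smul_fderiv {w g : Euc n → ℝ} (hw : RapidDecay w)
    (hgs : ContDiff ℝ (⊤ : ℕ∞) g) (hg' : ∀ i, PolyGrowth (pd n i g)) (x : Euc n) :
    Integrable (fun y => w y • fderiv ℝ g (x - y)) := by
  have hfc : Continuous (fderiv ℝ g) := hgs.continuous_fderiv (by simp)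
  refine Integrable.mono' (g := fun y => ∑ i, |w y * pd n i g (x - y)|) ?_ ?_ ?_
  · exact integrable_finsetSum _ fun i _ =>
      (integrable_mul_comp_sub hw (hg' i) hgs.pd.continuous x).abs
  · exact hw.integrable.aestronglyMeasurable.smul
      (hfc.comp (continuous_const.sub continuous_id)).aestronglyMeasurable
  · refine Eventually.of_forall fun y => ?_
    rw [norm_smul]
    calc ‖w y‖ * ‖fderiv ℝ g (x - y)‖ ≤ ‖w y‖ * ∑ i, |pd n i g (x - y)| :=
          mul_le_mul_of_nonneg_left (norm_le_sum_apply_single _) (norm_nonneg _)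
      _ = ∑ i, |w y * pd n i g (x - y)| := by
          rw [Finset.mul_sum]; simp [abs_mul]

lemma pd_conv {w g : Euc n → ℝ} (hw : RapidDecay w) (hg : PolyGrowth g)
    (hgs : ContDiff ℝ (⊤ : ℕ∞) g) (hg' : ∀ i, PolyGrowth (pd n i g)) (i : Fin n) :
    pd n i (fun x => ∫ y, w y * g (x - y)) = fun x => ∫ y, w y * pd n i g (x - y) := by
  ext x
  unfold pd
  rw [(hasFDerivAt_conv hw hg hgs hg' x).fderiv,
    ContinuousLinearMap.integral_apply (integrable_smul_fderiv hw hgs hg' x)]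
  simp

lemma differentiable_conv {w g : Euc n → ℝ} (hw : RapidDecay w) (hg : PolyGrowth g)
    (hgs : ContDiff ℝ (⊤ : ℕ∞) g) (hg' : ∀ i, PolyGrowth (pd n i g)) :
    Differentiable ℝ (fun x => ∫ y, w y * g (x - y)) :=
  fun x => (hasFDerivAt_conv hw hg hgs hg' x).differentiableAt

lemma integrable_conv {w g : Euc n → ℝ} (hw : Integrable w) (hg : Integrable g) :
    Integrable (fun x => ∫ y, w y * g (x - y)) := by
  exact hw.integrable_convolution (ContinuousLinearMap.mul ℝ ℝ) hg

end Growth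

section Gauss

variable {n : ℕ}

lemma heatKer_one (x : Euc n) :
    heatKer n x 1 = (4 * π) ^ (-(n : ℝ) / 2) * Real.exp (-‖x‖ ^ 2 / 4) := by
  simp [heatKer]

lemma heatKer_one_nonneg (x : Euc n) : 0 ≤ heatKer n x 1 := by
  rw [heatKer_one]; positivity

lemma exists_pow_mul_heatKer_le (n M : ℕ) :
    ∃ C, ∀ x : Euc n, (1 + ‖x‖) ^ M * heatKer n x 1 ≤ C := by
  refine ⟨(4 * π) ^ (-(n : ℝ) / 2) * (M.factorial * Real.exp 2), fun x => ?_⟩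
  have h1 := Real.pow_div_factorial_le_exp (1 + ‖x‖) (by positivity) M
  rw [div_le_iff₀ (by positivity)] at h1
  have h2 : Real.exp (1 + ‖x‖) * Real.exp (-‖x‖ ^ 2 / 4) ≤ Real.exp 2 := by
    rw [← Real.exp_add]
    exact Real.exp_le_exp.2 (by nlinarith [sq_nonneg (‖x‖ - 2)])
  rw [heatKer_one, mul_left_comm]
  refine mul_le_mul_of_nonneg_left ?_ (by positivity)
  calc (1 + ‖x‖) ^ M * Real.exp (-‖x‖ ^ 2 / 4)
      ≤ Real.exp (1 + ‖x‖) * M.factorial * Real.exp (-‖x‖ ^ 2 / 4) := by gcongr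
    _ = M.factorial * (Real.exp (1 + ‖x‖) * Real.exp (-‖x‖ ^ 2 / 4)) := by ring
    _ ≤ _ := by gcongr

lemma contDiff_heatKer_one : ContDiff ℝ (⊤ : ℕ∞) (fun x : Euc n => heatKer n x 1) := by
  simp only [heatKer_one]
  exact contDiff_const.mul (((contDiff_norm_sq ℝ).neg.div_const 4).exp)

lemma pd_heatKer_one (i : Fin n) (x : Euc n) :
    pd n i (fun x => heatKer n x 1) x = -(x i) / 2 * heatKer n x 1 := by
  have h1 : HasFDerivAt (fun x : Euc n => ‖x‖ ^ 2) (2 • innerSL ℝ x) x :=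
    (hasStrictFDerivAt_norm_sq x).hasFDerivAt
  have h2 := (((h1.neg.mul_const (1 / 4 : ℝ)).exp).const_mul ((4 * π) ^ (-(n : ℝ) / 2)))
  have h3 : (fun x : Euc n => heatKer n x 1) = fun x =>
      (4 * π) ^ (-(n : ℝ) / 2) * Real.exp (-‖x‖ ^ 2 * (1 / 4)) := by
    ext y; rw [heatKer_one]; congr 2; ring
  have h4 : heatKer n x 1 = (4 * π) ^ (-(n : ℝ) / 2) * Real.exp (-‖x‖ ^ 2 * (1 / 4)) :=
    congrFun h3 x
  unfold pd
  rw [h4, h3]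
  refine (congrArg (fun L : Euc n →L[ℝ] ℝ => L (EuclideanSpace.single i 1)) h2.fderiv).trans ?_
  simp [EuclideanSpace.inner_single_right]
  ring

lemma hasTemperateGrowth_fderiv {p : Euc n → ℝ} (hp : p.HasTemperateGrowth) :
    (fderiv ℝ p).HasTemperateGrowth := by
  refine ⟨hp.1.fderiv_right (by simp), fun m => ?_⟩
  obtain ⟨k, C, h⟩ := hp.2 (m + 1)
  exact ⟨k, C, fun x => by rw [norm_iteratedFDeriv_fderiv]; exact h x⟩

/-- Products of a function of temperate growth and the heat kernel at time one. -/
def IsGaussPoly (f : Euc n → ℝ) : Prop :=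
  ∃ p : Euc n → ℝ, p.HasTemperateGrowth ∧ f = fun x => p x * heatKer n x 1

lemma isGaussPoly_heatKer : IsGaussPoly (fun x : Euc n => heatKer n x 1) :=
  ⟨fun _ => 1, by fun_prop, by simp⟩

lemma IsGaussPoly.contDiff {f : Euc n → ℝ} (hf : IsGaussPoly f) : ContDiff ℝ (⊤ : ℕ∞) f := by
  obtain ⟨p, hp, rfl⟩ := hf
  exact hp.1.mul contDiff_heatKer_one

lemma IsGaussPoly.pd {f : Euc n → ℝ} (hf : IsGaussPoly f) (i : Fin n) :
    IsGaussPoly (pd n i f) := by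
  obtain ⟨p, hp, rfl⟩ := hf
  refine ⟨fun x => fderiv ℝ p x (EuclideanSpace.single i 1) + p x * (-(1 / 2) *
    inner ℝ x (EuclideanSpace.single i 1)), ?_, ?_⟩
  · have h1 : (fun x => fderiv ℝ p x (EuclideanSpace.single i 1)).HasTemperateGrowth := by
      exact (ContinuousLinearMap.hasTemperateGrowth (ContinuousLinearMap.apply ℝ ℝ
        (EuclideanSpace.single i (1 : ℝ)))).comp (hasTemperateGrowth_fderiv hp)
    fun_prop
  · ext x
    have hd := (hp.1.differentiable (by simp) x)
    have hd' := (contDiff_heatKer_one (n := n)).differentiable (by simp) x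
    have h1 := pd_heatKer_one i x
    unfold _root_.pd at h1 ⊢
    rw [fderiv_fun_mul hd hd']
    simp [h1, EuclideanSpace.inner_single_right]
    ring

lemma IsGaussPoly.exists_abs_le {f : Euc n → ℝ} (hf : IsGaussPoly f) :
    ∃ C : ℝ, ∃ k : ℕ, 0 ≤ C ∧ ∀ x, |f x| ≤ C * (1 + ‖x‖) ^ k * heatKer n x 1 := by
  obtain ⟨p, hp, rfl⟩ := hf
  obtain ⟨k, C, hC⟩ := hp.2 0
  have hC' : ∀ x, |p x| ≤ C * (1 + ‖x‖) ^ k := by simpa using hC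
  refine ⟨C, k, by simpa using (abs_nonneg _).trans (hC' 0), fun x => ?_⟩
  rw [abs_mul, abs_of_nonneg (heatKer_one_nonneg x)]
  exact mul_le_mul_of_nonneg_right (hC' x) (heatKer_one_nonneg x)

lemma IsGaussPoly.polyGrowth {f : Euc n → ℝ} (hf : IsGaussPoly f) : PolyGrowth f := by
  obtain ⟨C, k, hC0, hC⟩ := hf.exists_abs_le
  obtain ⟨D, hD⟩ := exists_pow_mul_heatKer_le n k
  refine ⟨C * D, 0, fun x => (hC x).trans ?_⟩
  rw [mul_assoc, pow_zero, mul_one]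
  exact mul_le_mul_of_nonneg_left (hD x) hC0

lemma integrable_of_abs_pow_mul_le {f : Euc n → ℝ} (hf : AEStronglyMeasurable f) {C : ℝ}
    (h : ∀ x, (1 + ‖x‖) ^ (n + 1) * |f x| ≤ C) : Integrable f := by
  have h1 : Integrable (fun x : Euc n => (1 + ‖x‖) ^ (-((n : ℝ) + 1))) :=
    integrable_one_add_norm (by simp)
  refine (h1.const_mul C).mono' hf (Eventually.of_forall fun x => ?_)
  have h2 : (0 : ℝ) < 1 + ‖x‖ := by positivity
  rw [Real.rpow_neg h2.le, ← div_eq_mul_inv, le_div_iff₀ (by positivity), mul_comm,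
    Real.norm_eq_abs]
  have h3 := h x
  rwa [← Real.rpow_natCast, Nat.cast_add, Nat.cast_one] at h3

lemma IsGaussPoly.rapidDecay {f : Euc n → ℝ} (hf : IsGaussPoly f) : RapidDecay f := by
  intro j
  have hc := hf.contDiff.continuous
  obtain ⟨C, k, hC0, hC⟩ := hf.exists_abs_le
  obtain ⟨D, hD⟩ := exists_pow_mul_heatKer_le n (n + 1 + j + k)
  refine integrable_of_abs_pow_mul_le (C := C * D) (by fun_prop) fun x => ?_
  rw [abs_mul, abs_of_nonneg (by positivity)]
  calc (1 + ‖x‖) ^ (n + 1) * ((1 + ‖x‖) ^ j * |f x|)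
      ≤ (1 + ‖x‖) ^ (n + 1) * ((1 + ‖x‖) ^ j * (C * (1 + ‖x‖) ^ k * heatKer n x 1)) := by
        gcongr; exact hC x
    _ = C * ((1 + ‖x‖) ^ (n + 1 + j + k) * heatKer n x 1) := by
        rw [pow_add, pow_add]; ring
    _ ≤ C * D := mul_le_mul_of_nonneg_left (hD x) hC0

end Gauss

section Homogeneous

variable {n : ℕ}

/-- Positive homogeneity of degree `-d` away from the origin. -/
def HomogNeg (d : ℕ) (f : Euc n → ℝ) : Prop :=
  ∀ c : ℝ, 0 < c → ∀ x : Euc n, x ≠ 0 → c ^ d * f (c • x) = f x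

lemma HomogNeg.pd {d : ℕ} {f : Euc n → ℝ} (hf : HomogNeg d f) (i : Fin n) :
    HomogNeg (d + 1) (pd n i f) := by
  intro c hc x hx
  have h1 : (fun y => c ^ d * f (c • y)) =ᶠ[𝓝 x] f := by
    filter_upwards [isOpen_ne.mem_nhds hx] with y hy using hf c hc y hy
  rw [← pd_congr h1, pd_const_mul, pd_comp_smul, pow_succ, mul_assoc]

lemma HomogNeg.exists_bound {d : ℕ} {f : Euc n → ℝ} (hf : HomogNeg d f)
    (hc : ∀ x ≠ 0, ContinuousAt f x) : ∃ C, ∀ x ≠ 0, ‖x‖ ^ d * |f x| ≤ C := by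
  obtain ⟨C, hC⟩ := (isCompact_sphere (0 : Euc n) 1).exists_bound_of_continuousOn (f := f)
    fun x hx => (hc x (by rintro rfl; simp at hx)).continuousWithinAt
  refine ⟨C, fun x hx => ?_⟩
  have hx' : 0 < ‖x‖ := norm_pos_iff.2 hx
  have h1 := hf ‖x‖ hx' (‖x‖⁻¹ • x) (by simp [hx])
  rw [smul_smul, mul_inv_cancel₀ hx'.ne', one_smul] at h1
  have h2 := hC (‖x‖⁻¹ • x) (by simp [norm_smul, hx'.ne'])
  rw [← h1, Real.norm_eq_abs, abs_mul, abs_of_nonneg (by positivity)] at h2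
  exact h2

lemma exists_weighted_bound {d : ℕ} {f g : Euc n → ℝ} (hf : HomogNeg d f)
    (hc : ∀ x ≠ 0, ContinuousAt f x) (hg : Continuous g)
    (hfg : Set.EqOn g f {x | 2 < ‖x‖}) : ∃ C, ∀ x, (1 + ‖x‖) ^ d * |g x| ≤ C := by
  obtain ⟨C₁, h₁⟩ := hf.exists_bound hc
  obtain ⟨C₂, h₂⟩ := (isCompact_closedBall (0 : Euc n) 2).exists_bound_of_continuousOn
    (f := fun x => (1 + ‖x‖) ^ d * |g x|) (by fun_prop)
  refine ⟨max (2 ^ d * C₁) C₂, fun x => ?_⟩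
  rcases le_or_gt ‖x‖ 2 with hx | hx
  · exact ((le_abs_self _).trans (h₂ x (by simpa using hx))).trans (le_max_right _ _)
  · refine le_trans ?_ (le_max_left _ _)
    have hx0 : x ≠ 0 := by rintro rfl; simp at hx; linarith
    rw [hfg hx]
    calc (1 + ‖x‖) ^ d * |f x| ≤ (2 * ‖x‖) ^ d * |f x| := by gcongr; linarith
      _ = 2 ^ d * (‖x‖ ^ d * |f x|) := by rw [mul_pow]; ring
      _ ≤ _ := by gcongr; exact h₁ x hx0

lemma polyGrowth_of_weighted_bound {d : ℕ} {g : Euc n → ℝ}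
    (h : ∃ C, ∀ x, (1 + ‖x‖) ^ d * |g x| ≤ C) : PolyGrowth g := by
  obtain ⟨C, hC⟩ := h
  refine ⟨C, 0, fun x => ?_⟩
  rw [pow_zero, mul_one]
  refine le_trans ?_ (hC x)
  exact le_mul_of_one_le_left (abs_nonneg _) (one_le_pow₀ (by simp))

lemma eqOn_pd {f g : Euc n → ℝ} {s : Set (Euc n)} (hs : IsOpen s) (h : Set.EqOn f g s)
    (i : Fin n) : Set.EqOn (pd n i f) (pd n i g) s := fun _ hx =>
  pd_congr (Filter.eventuallyEq_of_mem (hs.mem_nhds hx) h)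

end Homogeneous

section FundamentalSolution

variable {n : ℕ}

lemma lapFund_smul (hn : 2 ≤ n) {c : ℝ} (hc : 0 < c) :
    ∃ b, ∀ x : Euc n, x ≠ 0 → c ^ (n - 2) * lapFund n (c • x) = lapFund n x + b := by
  unfold lapFund
  split_ifs with h
  · subst h
    refine ⟨(2 * π)⁻¹ * Real.log c, fun x hx => ?_⟩
    rw [norm_smul, Real.norm_of_nonneg hc.le, Real.log_mul hc.ne' (norm_ne_zero_iff.2 hx)]
    ring
  · refine ⟨0, fun x _ => ?_⟩
    rw [norm_smul, Real.norm_of_nonneg hc.le, Real.mul_rpow hc.le (norm_nonneg _)]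
    have h1 : c ^ (n - 2) * c ^ (2 - (n : ℝ)) = 1 := by
      rw [← Real.rpow_natCast, ← Real.rpow_add hc, Nat.cast_sub hn]
      simp
    linear_combination (-((((n : ℝ) - 2) * (2 * π ^ ((n : ℝ) / 2) / Real.Gamma ((n : ℝ) / 2)))⁻¹) *
      ‖x‖ ^ (2 - (n : ℝ))) * h1

lemma homogNeg_pd_lapFund (hn : 2 ≤ n) (i : Fin n) : HomogNeg (n - 1) (pd n i (lapFund n)) := by
  intro c hc x hx
  obtain ⟨b, hb⟩ := lapFund_smul hn hc
  have h1 : (fun y => c ^ (n - 2) * lapFund n (c • y)) =ᶠ[𝓝 x] fun y => lapFund n y + b := by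
    filter_upwards [isOpen_ne.mem_nhds hx] with y hy using hb y hy
  have h2 := pd_congr (i := i) h1
  rw [pd_add_const, pd_const_mul, pd_comp_smul, ← mul_assoc, ← pow_succ] at h2
  rwa [show n - 1 = n - 2 + 1 by omega]

lemma contDiffAt_lapFund {x : Euc n} (hx : x ≠ 0) : ContDiffAt ℝ (⊤ : ℕ∞) (lapFund n) x := by
  have h1 : ContDiffAt ℝ (⊤ : ℕ∞) (fun y : Euc n => ‖y‖) x := contDiffAt_norm ℝ hx
  have h2 : ‖x‖ ≠ 0 := norm_ne_zero_iff.2 hx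
  unfold lapFund
  split_ifs
  · exact contDiffAt_const.mul (h1.log h2)
  · exact contDiffAt_const.mul (h1.rpow_const_of_ne h2)

lemma measurable_lapFund : Measurable (lapFund n) := by
  unfold lapFund
  split_ifs <;> fun_prop

lemma abs_log_le {r : ℝ} (hr : 0 < r) : |Real.log r| ≤ r + r⁻¹ := by
  have h1 := Real.log_le_sub_one_of_pos hr
  have h2 := Real.log_le_sub_one_of_pos (inv_pos.2 hr)
  rw [Real.log_inv] at h2
  have := inv_pos.2 hr
  exact abs_le.2 ⟨by linarith, by linarith⟩

lemma integrableOn_lapFund (hn : 2 ≤ n) : IntegrableOn (lapFund n) (Metric.ball 0 2) := by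
  by_cases h : n = 2
  · have hd : (1 : ℝ) < Module.finrank ℝ (Euc n) := by simp; exact_mod_cast hn
    refine integrableOn_ball_of_norm_le_rpow (C := (2 * π)⁻¹ * 5) (by simp; omega) hd ?_
      measurable_lapFund.aestronglyMeasurable
    refine (ae_restrict_iff' measurableSet_ball).2 (Eventually.of_forall fun x hx => ?_)
    simp only [lapFund, h, if_true, norm_mul, Real.norm_eq_abs, Real.rpow_neg_one]
    rw [abs_of_nonneg (by positivity : 0 ≤ (2 * π)⁻¹), mul_assoc]
    refine mul_le_mul_of_nonneg_left ?_ (by positivity)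
    rcases (norm_nonneg x).eq_or_lt with h0 | h0
    · simp [← h0]
    · have hx2 : ‖x‖ < 2 := by simpa using hx
      have h3 : ‖x‖ ≤ 4 * ‖x‖⁻¹ := by
        rw [← div_eq_mul_inv, le_div_iff₀ h0]; nlinarith
      linarith [abs_log_le h0]
  · have hd : (n : ℝ) - 2 < Module.finrank ℝ (Euc n) := by simp
    refine integrableOn_ball_of_norm_le_rpow
      (C := |-((((n : ℝ) - 2) * (2 * π ^ ((n : ℝ) / 2) / Real.Gamma ((n : ℝ) / 2)))⁻¹)|)
      (by simp; omega) hd ?_ measurable_lapFund.aestronglyMeasurable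
    refine Eventually.of_forall fun x => ?_
    simp only [lapFund, h, if_false, norm_mul]
    rw [neg_sub, Real.norm_of_nonneg (Real.rpow_nonneg (norm_nonneg x) _), Real.norm_eq_abs]

lemma exists_lapFund_le (hn : 2 ≤ n) :
    ∃ C, 0 ≤ C ∧ ∀ x : Euc n, 1 ≤ ‖x‖ → |lapFund n x| ≤ C * (1 + ‖x‖) := by
  by_cases h : n = 2
  · refine ⟨(2 * π)⁻¹, by positivity, fun x hx => ?_⟩
    simp only [lapFund, h, if_true, abs_mul]
    rw [abs_of_nonneg (by positivity : 0 ≤ (2 * π)⁻¹)]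
    refine mul_le_mul_of_nonneg_left ?_ (by positivity)
    have := abs_log_le (by linarith : 0 < ‖x‖)
    have := inv_le_one_of_one_le₀ hx
    linarith
  · refine ⟨|-((((n : ℝ) - 2) * (2 * π ^ ((n : ℝ) / 2) / Real.Gamma ((n : ℝ) / 2)))⁻¹)|,
      abs_nonneg _, fun x hx => ?_⟩
    simp only [lapFund, h, if_false, abs_mul]
    refine mul_le_mul_of_nonneg_left ?_ (abs_nonneg _)
    rw [abs_of_nonneg (by positivity)]
    have hn' : (2 : ℝ) ≤ n := by exact_mod_cast hn
    have := Real.rpow_le_one_of_one_le_of_nonpos hx (by linarith : (2 : ℝ) - n ≤ 0)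
    linarith

/-- A smooth cutoff, equal to one on the unit ball and vanishing outside the ball of radius 2. -/
def cutoff (n : ℕ) : ContDiffBump (0 : Euc n) := ⟨1, 2, one_pos, one_lt_two⟩

/-- The compactly supported singular part of the fundamental solution. -/
def fundNear (n : ℕ) (x : Euc n) : ℝ := cutoff n x * lapFund n x

/-- The smooth part of the fundamental solution. -/
def fundFar (n : ℕ) (x : Euc n) : ℝ := (1 - cutoff n x) * lapFund n x

lemma cutoff_eq_zero {x : Euc n} (hx : 2 ≤ ‖x‖) : cutoff n x = 0 :=
  (cutoff n).zero_of_le_dist (by simpa [cutoff] using hx)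

lemma cutoff_eq_one {x : Euc n} (hx : ‖x‖ ≤ 1) : cutoff n x = 1 :=
  (cutoff n).one_of_mem_closedBall (by simpa [cutoff] using hx)

lemma rapidDecay_fundNear (hn : 2 ≤ n) : RapidDecay (fundNear n) := by
  intro k
  have h1 := ((integrableOn_lapFund hn).integrable_indicator measurableSet_ball).norm.const_mul
    ((3 : ℝ) ^ k)
  have hm := measurable_lapFund (n := n)
  have hc : Continuous (cutoff n) := (cutoff n).continuous
  refine h1.mono' ?_ (Eventually.of_forall fun x => ?_)
  · unfold fundNear
    exact Measurable.aestronglyMeasurable (by fun_prop)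
  · rcases lt_or_ge ‖x‖ 2 with hx | hx
    · rw [Set.indicator_of_mem (by simpa using hx), fundNear, norm_mul, norm_mul,
        Real.norm_of_nonneg (by positivity), Real.norm_of_nonneg (cutoff n).nonneg]
      have h2 : (1 + ‖x‖) ^ k ≤ 3 ^ k := pow_le_pow_left₀ (by positivity) (by linarith) k
      have h3 : cutoff n x * ‖lapFund n x‖ ≤ ‖lapFund n x‖ :=
        mul_le_of_le_one_left (norm_nonneg _) (cutoff n).le_one
      have h4 : 0 ≤ cutoff n x := (cutoff n).nonneg
      exact mul_le_mul h2 h3 (by positivity) (by positivity)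
    · rw [fundNear, cutoff_eq_zero hx]
      simp only [zero_mul, mul_zero, norm_zero]
      positivity

lemma contDiff_fundFar : ContDiff ℝ (⊤ : ℕ∞) (fundFar n) := by
  refine contDiff_iff_contDiffAt.2 fun x => ?_
  by_cases hx : x = 0
  · subst hx
    have h1 : fundFar n =ᶠ[𝓝 0] fun _ => 0 := by
      filter_upwards [(cutoff n).eventuallyEq_one] with y hy
      simp [fundFar, hy]
    exact contDiffAt_const.congr_of_eventuallyEq h1
  · exact (contDiffAt_const.sub (cutoff n).contDiffAt).mul (contDiffAt_lapFund hx)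

lemma polyGrowth_fundFar (hn : 2 ≤ n) : PolyGrowth (fundFar n) := by
  obtain ⟨C, hC0, hC⟩ := exists_lapFund_le hn
  refine ⟨C, 1, fun x => ?_⟩
  rw [pow_one]
  rcases le_or_gt ‖x‖ 1 with hx | hx
  · rw [fundFar, cutoff_eq_one hx]
    simp only [sub_self, zero_mul, abs_zero]
    positivity
  · rw [fundFar, abs_mul]
    have h1 : 0 ≤ cutoff n x := (cutoff n).nonneg
    have h2 : cutoff n x ≤ 1 := (cutoff n).le_one
    have h3 : |1 - cutoff n x| ≤ 1 := abs_le.2 ⟨by linarith, by linarith⟩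
    exact (mul_le_of_le_one_left (abs_nonneg _) h3).trans (hC x hx.le)

lemma eqOn_fundFar : Set.EqOn (fundFar n) (lapFund n) {x | 2 < ‖x‖} := fun x hx => by
  have hx' : 2 ≤ ‖x‖ := le_of_lt hx
  rw [fundFar, cutoff_eq_zero hx']; ring

lemma isOpen_two_lt_norm : IsOpen {x : Euc n | 2 < ‖x‖} :=
  isOpen_lt continuous_const continuous_norm

lemma polyGrowth_pd_fundFar (hn : 2 ≤ n) (i : Fin n) : PolyGrowth (pd n i (fundFar n)) :=
  polyGrowth_of_weighted_bound <| exists_weighted_bound (homogNeg_pd_lapFund hn i)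
    (fun _ hx => (contDiffAt_lapFund hx).pd.continuousAt) contDiff_fundFar.pd.continuous
    (eqOn_pd isOpen_two_lt_norm eqOn_fundFar i)

lemma polyGrowth_pd_pd_fundFar (hn : 2 ≤ n) (i j : Fin n) :
    PolyGrowth (pd n j (pd n i (fundFar n))) :=
  polyGrowth_of_weighted_bound <| exists_weighted_bound ((homogNeg_pd_lapFund hn i).pd j)
    (fun _ hx => (contDiffAt_lapFund hx).pd.pd.continuousAt) contDiff_fundFar.pd.pd.continuous
    (eqOn_pd isOpen_two_lt_norm (eqOn_pd isOpen_two_lt_norm eqOn_fundFar i) j)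

lemma exists_bound_pd_pd_pd_fundFar (hn : 2 ≤ n) (i j k : Fin n) :
    ∃ C, ∀ x, (1 + ‖x‖) ^ (n + 1) * |pd n k (pd n j (pd n i (fundFar n))) x| ≤ C := by
  have h := exists_weighted_bound (((homogNeg_pd_lapFund hn i).pd j).pd k)
    (fun _ hx => (contDiffAt_lapFund hx).pd.pd.pd.continuousAt)
    contDiff_fundFar.pd.pd.pd.continuous
    (eqOn_pd isOpen_two_lt_norm
      (eqOn_pd isOpen_two_lt_norm (eqOn_pd isOpen_two_lt_norm eqOn_fundFar i) j) k)
  rwa [show n - 1 + 1 + 1 = n + 1 by omega] at h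

end FundamentalSolution

section OseenKernel

variable {n : ℕ}

/-- The sum of the convolutions of `g` with the singular part of the fundamental solution and of
`h` with the heat kernel at time one. -/
def splitConv (n : ℕ) (g h : Euc n → ℝ) (x : Euc n) : ℝ :=
  (∫ y, fundNear n y * g (x - y)) + ∫ y, heatKer n y 1 * h (x - y)

lemma differentiable_splitConv (hn : 2 ≤ n) {g h : Euc n → ℝ} (hg : IsGaussPoly g)
    (hh : ContDiff ℝ (⊤ : ℕ∞) h) (h0 : PolyGrowth h) (h1 : ∀ i, PolyGrowth (pd n i h)) :
    Differentiable ℝ (splitConv n g h) :=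
  (differentiable_conv (rapidDecay_fundNear hn) hg.polyGrowth hg.contDiff
    fun i => (hg.pd i).polyGrowth).add
  (differentiable_conv isGaussPoly_heatKer.rapidDecay h0 hh h1)

lemma pd_splitConv (hn : 2 ≤ n) {g h : Euc n → ℝ} (hg : IsGaussPoly g)
    (hh : ContDiff ℝ (⊤ : ℕ∞) h) (h0 : PolyGrowth h) (h1 : ∀ i, PolyGrowth (pd n i h))
    (i : Fin n) : pd n i (splitConv n g h) = splitConv n (pd n i g) (pd n i h) := by
  have hA := rapidDecay_fundNear hn
  have hG := isGaussPoly_heatKer (n := n).rapidDecay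
  have hg' := fun i => (hg.pd i).polyGrowth
  have h2 := pd_add (i := i) (differentiable_conv hA hg.polyGrowth hg.contDiff hg')
    (differentiable_conv hG h0 hh h1)
  rw [pd_conv hA hg.polyGrowth hg.contDiff hg', pd_conv hG h0 hh h1] at h2
  exact h2

lemma genPhi_one_eq (hn : 2 ≤ n) :
    (fun x => genPhi n x 1) = splitConv n (fun x => heatKer n x 1) (fundFar n) := by
  ext x
  have hG := isGaussPoly_heatKer (n := n)
  have h1 := integrable_mul_comp_sub (rapidDecay_fundNear hn) hG.polyGrowth
    hG.contDiff.continuous x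
  have h2 := (integrable_mul_comp_sub hG.rapidDecay (polyGrowth_fundFar hn)
    contDiff_fundFar.continuous x).comp_sub_left x
  have h3 : ∫ y, heatKer n y 1 * fundFar n (x - y) =
      ∫ y, heatKer n (x - y) 1 * fundFar n (x - (x - y)) :=
    (integral_sub_left_eq_self (fun y => heatKer n y 1 * fundFar n (x - y)) volume x).symm
  rw [splitConv, h3, ← integral_add h1 h2, genPhi]
  congr 1
  ext y
  rw [sub_sub_cancel, fundNear, fundFar]
  ring

lemma integrable_lapFund_mul_heatKer (hn : 2 ≤ n) (x : Euc n) :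
    Integrable (fun y => lapFund n y * heatKer n (x - y) 1) := by
  have hG := isGaussPoly_heatKer (n := n)
  have h1 := integrable_mul_comp_sub (rapidDecay_fundNear hn) hG.polyGrowth
    hG.contDiff.continuous x
  have h2 := (integrable_mul_comp_sub hG.rapidDecay (polyGrowth_fundFar hn)
    contDiff_fundFar.continuous x).comp_sub_left x
  refine (h1.add h2).congr (Eventually.of_forall fun y => ?_)
  simp only [Pi.add_apply]
  rw [sub_sub_cancel, fundNear, fundFar]
  ring

lemma pd_pd_genPhi_one (hn : 2 ≤ n) (i j : Fin n) :
    pd n j (pd n i (fun x => genPhi n x 1)) =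
      splitConv n (pd n j (pd n i (fun x => heatKer n x 1))) (pd n j (pd n i (fundFar n))) := by
  have hG := isGaussPoly_heatKer (n := n)
  rw [genPhi_one_eq hn, pd_splitConv hn hG contDiff_fundFar (polyGrowth_fundFar hn)
    (polyGrowth_pd_fundFar hn), pd_splitConv hn (hG.pd i) contDiff_fundFar.pd
    (polyGrowth_pd_fundFar hn i) (polyGrowth_pd_pd_fundFar hn i)]

lemma polyGrowth_pd_pd_pd_fundFar (hn : 2 ≤ n) (i j k : Fin n) :
    PolyGrowth (pd n k (pd n j (pd n i (fundFar n)))) :=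
  polyGrowth_of_weighted_bound (exists_bound_pd_pd_pd_fundFar hn i j k)

lemma differentiable_pd_pd_genPhi_one (hn : 2 ≤ n) (i j : Fin n) :
    Differentiable ℝ (pd n j (pd n i (fun x => genPhi n x 1))) := by
  rw [pd_pd_genPhi_one hn]
  exact differentiable_splitConv hn ((isGaussPoly_heatKer.pd i).pd j) contDiff_fundFar.pd.pd
    (polyGrowth_pd_pd_fundFar hn i j) (polyGrowth_pd_pd_pd_fundFar hn i j)

lemma integrable_pd_pd_pd_genPhi_one (hn : 2 ≤ n) (i j k : Fin n) :
    Integrable (pd n k (pd n j (pd n i (fun x => genPhi n x 1)))) := by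
  have hG := ((isGaussPoly_heatKer (n := n)).pd i).pd j
  rw [pd_pd_genPhi_one hn, pd_splitConv hn hG contDiff_fundFar.pd.pd
    (polyGrowth_pd_pd_fundFar hn i j) (polyGrowth_pd_pd_pd_fundFar hn i j)]
  obtain ⟨C, hC⟩ := exists_bound_pd_pd_pd_fundFar hn i j k
  exact (integrable_conv (rapidDecay_fundNear hn).integrable (hG.pd k).rapidDecay.integrable).add
    (integrable_conv isGaussPoly_heatKer.rapidDecay.integrable
      (integrable_of_abs_pow_mul_le (measurable_pd _ _).aestronglyMeasurable hC))

lemma integrable_Kten_one (hn : 2 ≤ n) (i j k : Fin n) :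
    Integrable (fun x => Kten n i j k x 1) := by
  have hd := differentiable_pd_pd_genPhi_one hn
  have hK : (fun y => Kmat n i j y 1) = fun y =>
      (if i = j then (-1 : ℝ) else 0) * (∑ l, pd n l (pd n l (fun y => genPhi n y 1)) y) +
      pd n i (pd n j (fun y => genPhi n y 1)) y := by
    ext y
    unfold Kmat lap
    split_ifs <;> simp
  have hs : Differentiable ℝ fun y => ∑ l, pd n l (pd n l (fun y => genPhi n y 1)) y :=
    Differentiable.fun_sum fun l _ => hd l l
  have hs' : pd n k (fun y => ∑ l, pd n l (pd n l (fun y => genPhi n y 1)) y) =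
      fun x => ∑ l, pd n k (pd n l (pd n l (fun y => genPhi n y 1))) x := by
    ext x
    unfold pd at hd ⊢
    rw [fderiv_fun_sum fun l _ => hd l l x]
    simp
  have h : (fun x => Kten n i j k x 1) = fun x =>
      (if i = j then (-1 : ℝ) else 0) *
        (∑ l, pd n k (pd n l (pd n l (fun y => genPhi n y 1))) x) +
      pd n k (pd n i (pd n j (fun y => genPhi n y 1))) x := by
    ext x
    rw [Kten, hK, pd_add (hs.const_mul _) (hd j i)]
    beta_reduce
    rw [pd_const_mul, hs']
  rw [h]
  exact ((integrable_finsetSum _ fun l _ => integrable_pd_pd_pd_genPhi_one hn l l k).const_mul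
    _).add (integrable_pd_pd_pd_genPhi_one hn j i k)

end OseenKernel

section Scaling

variable {n : ℕ}

lemma heatKer_scale (c : ℝ) (hc : 0 < c) (x : Euc n) :
    heatKer n (c • x) (c ^ 2) = (c ^ n)⁻¹ * heatKer n x 1 := by
  unfold heatKer
  have h1 : (4 * π * c ^ 2) ^ (-(n : ℝ) / 2) = (c ^ n)⁻¹ * (4 * π * 1) ^ (-(n : ℝ) / 2) := by
    rw [mul_one, Real.mul_rpow (by positivity) (by positivity), mul_comm]
    congr 1
    rw [← Real.rpow_natCast c 2, ← Real.rpow_mul hc.le, ← Real.rpow_natCast, ← Real.rpow_neg hc.le]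
    congr 1
    push_cast
    ring
  rw [h1, mul_assoc]
  congr 3
  rw [norm_smul, Real.norm_of_nonneg hc.le]
  field_simp

lemma genPhi_scale (hn : 2 ≤ n) (c : ℝ) (hc : 0 < c) :
    ∃ b, ∀ x : Euc n, c ^ (n - 2) * genPhi n (c • x) (c ^ 2) = genPhi n x 1 + b := by
  obtain ⟨b, hb⟩ := lapFund_smul hn hc
  refine ⟨b * ∫ y : Euc n, heatKer n y 1, fun x => ?_⟩
  have hcn : c ^ n ≠ 0 := by positivity
  have hint := isGaussPoly_heatKer (n := n).rapidDecay.integrable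
  have h1 : genPhi n (c • x) (c ^ 2) =
      ∫ y : Euc n, lapFund n (c • y) * heatKer n (x - y) 1 := by
    have h2 := Measure.integral_comp_smul (volume : Measure (Euc n))
      (fun y => lapFund n y * heatKer n (c • x - y) (c ^ 2)) c
    simp only [finrank_euclideanSpace, Fintype.card_fin, ← smul_sub, heatKer_scale c hc] at h2
    rw [abs_of_nonneg (by positivity), smul_eq_mul] at h2
    have h3 : (fun y : Euc n => lapFund n (c • y) * ((c ^ n)⁻¹ * heatKer n (x - y) 1)) =
        fun y => (c ^ n)⁻¹ * (lapFund n (c • y) * heatKer n (x - y) 1) := by ext; ring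
    rw [h3, integral_const_mul] at h2
    exact (mul_left_cancel₀ (inv_ne_zero hcn) h2).symm
  rw [h1, ← integral_const_mul, genPhi]
  have h0 : ∫ y : Euc n, heatKer n (x - y) 1 = ∫ y : Euc n, heatKer n y 1 :=
    integral_sub_left_eq_self (fun y => heatKer n y 1) volume x
  rw [← h0, ← integral_const_mul, ← integral_add (integrable_lapFund_mul_heatKer hn x)
    ((hint.comp_sub_left x).const_mul b)]
  have : Nonempty (Fin n) := ⟨⟨0, by omega⟩⟩
  refine integral_congr_ae ?_
  have hne : ∀ᵐ y : Euc n, y ≠ 0 := by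
    simp [ae_iff, measure_singleton]
  filter_upwards [hne] with y hy
  linear_combination (heatKer n (x - y) 1) * hb y hy

lemma Kten_scale (hn : 2 ≤ n) (i j k : Fin n) (c : ℝ) (hc : 0 < c) (x : Euc n) :
    c ^ (n + 1) * Kten n i j k (c • x) (c ^ 2) = Kten n i j k x 1 := by
  obtain ⟨b, hb⟩ := genPhi_scale hn c hc
  have h1 : ∀ l (y : Euc n), c ^ (n - 1) * pd n l (fun y => genPhi n y (c ^ 2)) (c • y) =
      pd n l (fun y => genPhi n y 1) y := by
    intro l y
    rw [← pd_add_const l (fun y => genPhi n y 1) b, ← funext hb, pd_const_mul,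
      pd_comp_smul l (fun y => genPhi n y (c ^ 2)), ← mul_assoc, ← pow_succ]
    congr 2; omega
  have h2 : ∀ l m (y : Euc n), c ^ n * pd n m (pd n l (fun y => genPhi n y (c ^ 2))) (c • y) =
      pd n m (pd n l (fun y => genPhi n y 1)) y := by
    intro l m y
    rw [← funext (h1 l), pd_const_mul, pd_comp_smul, ← mul_assoc, ← pow_succ]
    congr 2; omega
  have h3 : ∀ y : Euc n, c ^ n * Kmat n i j (c • y) (c ^ 2) = Kmat n i j y 1 := by
    intro y
    unfold Kmat lap
    rw [mul_add, h2]
    simp only [← h2]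
    split_ifs
    · rw [← Finset.mul_sum]; ring
    · ring
  have h4 := pd_congr (i := k) (x := x) (Eventually.of_forall h3)
  rw [pd_const_mul, pd_comp_smul k (fun y => Kmat n i j y (c ^ 2)), ← mul_assoc, ← pow_succ] at h4
  exact h4

lemma heatKer_eq {t : ℝ} (ht : 0 < t) (x : Euc n) :
    heatKer n x t = (√t ^ n)⁻¹ * heatKer n ((√t)⁻¹ • x) 1 := by
  have hs : 0 < √t := Real.sqrt_pos.2 ht
  rw [← heatKer_scale (√t) hs, smul_smul, mul_inv_cancel₀ hs.ne', one_smul, Real.sq_sqrt ht.le]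

lemma Kten_eq (hn : 2 ≤ n) (i j k : Fin n) {t : ℝ} (ht : 0 < t) (x : Euc n) :
    Kten n i j k x t = (√t ^ (n + 1))⁻¹ * Kten n i j k ((√t)⁻¹ • x) 1 := by
  have hs : 0 < √t := Real.sqrt_pos.2 ht
  have hs' : √t ^ (n + 1) ≠ 0 := by positivity
  rw [← Kten_scale hn i j k (√t) hs, smul_smul, mul_inv_cancel₀ hs.ne', one_smul,
    Real.sq_sqrt ht.le, inv_mul_cancel_left₀ hs']

lemma integral_abs_comp_inv_sqrt_smul (f : Euc n → ℝ) (t : ℝ) (x : Euc n) :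
    ∫ y, |f ((√t)⁻¹ • (x - y))| = √t ^ n * ∫ y, |f y| := by
  have h1 := integral_sub_left_eq_self (fun y => |f ((√t)⁻¹ • y)|) volume x
  rw [h1, Measure.integral_comp_inv_smul volume (fun y => |f y|)]
  simp [abs_of_nonneg (Real.sqrt_nonneg t)]

lemma integrable_comp_inv_sqrt_smul {f : Euc n → ℝ} (hf : Integrable f) {t : ℝ} (ht : 0 < t)
    (x : Euc n) : Integrable (fun y => f ((√t)⁻¹ • (x - y))) :=
  (hf.comp_smul (inv_ne_zero (Real.sqrt_pos.2 ht).ne')).comp_sub_left x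

end Scaling

section FixedPoint

lemma existsUnique_fixedPoint_of_contracting {α E : Type*} [NormedAddCommGroup E]
    [CompleteSpace E] {S : Set (α → E)} {P : (α → E) → α → E} {R : ℝ} {u₀ : α → E} (h₀ : u₀ ∈ S)
    (hP : Set.MapsTo P S S)
    (hlim : ∀ f : ℕ → α → E, (∀ m, f m ∈ S) → ∀ u, Tendsto f atTop (𝓝 u) → u ∈ S)
    (hR : ∀ u ∈ S, ∀ a, ‖u a‖ ≤ R)
    (hc : ∀ u ∈ S, ∀ v ∈ S, ∀ δ, (∀ a, ‖u a - v a‖ ≤ δ) → ∀ a, ‖P u a - P v a‖ ≤ δ / 2) :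
    ∃ u ∈ S, P u = u ∧ ∀ v ∈ S, P v = v → v = u := by
  have hmem : ∀ m, P^[m] u₀ ∈ S := fun m => hP.iterate m h₀
  have hd : ∀ u ∈ S, ∀ v ∈ S, ∀ a, ‖u a - v a‖ ≤ 2 * R := fun u hu v hv a => by
    have h1 := norm_sub_le (u a) (v a)
    have h2 := hR u hu a
    have h3 := hR v hv a
    linarith
  have hstep : ∀ m a, dist (P^[m] u₀ a) (P^[m + 1] u₀ a) ≤ 4 * R / 2 / 2 ^ m := by
    intro m
    induction m with
    | zero =>
      intro a
      rw [dist_eq_norm]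
      have := hd _ (hmem 0) _ (hmem 1) a
      simp only [pow_zero, div_one]
      linarith
    | succ m ih =>
      intro a
      rw [dist_eq_norm, Function.iterate_succ_apply', Function.iterate_succ_apply' P (m + 1)]
      refine (hc _ (hmem m) _ (hmem (m + 1)) _ (fun b => ?_) a).trans
        (le_of_eq (?_ : 4 * R / 2 / 2 ^ m / 2 = _))
      · rw [← dist_eq_norm]; exact ih b
      · rw [pow_succ]; field_simp
  choose u hu using fun a => cauchySeq_tendsto_of_complete
    (cauchySeq_of_le_geometric_two (hstep · a))
  have huS : u ∈ S := hlim _ hmem u (tendsto_pi_nhds.2 hu)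
  have hclose : ∀ m a, ‖P^[m] u₀ a - u a‖ ≤ 4 * R / 2 ^ m := fun m a => by
    rw [← dist_eq_norm]
    exact dist_le_of_le_geometric_two_of_tendsto (hstep · a) (hu a) m
  have hzero : ∀ C : ℝ, Tendsto (fun m : ℕ => C / 2 ^ m) atTop (𝓝 0) := fun C =>
    tendsto_const_nhds.div_atTop (tendsto_pow_atTop_atTop_of_one_lt one_lt_two)
  refine ⟨u, huS, ?_, fun v hv hPv => ?_⟩
  · ext1 a
    refine tendsto_nhds_unique ?_ ((tendsto_add_atTop_iff_nat 1).2 (hu a))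
    rw [tendsto_iff_norm_sub_tendsto_zero]
    refine squeeze_zero (fun _ => norm_nonneg _) (fun m => ?_) (hzero (4 * R / 2))
    rw [Function.iterate_succ_apply']
    exact (hc _ (hmem m) _ huS _ (hclose m) a).trans (le_of_eq (by ring))
  · have h1 : ∀ m a, ‖v a - P^[m] u₀ a‖ ≤ 2 * R / 2 ^ m := by
      intro m
      induction m with
      | zero => simpa using hd v hv u₀ h₀
      | succ m ih =>
        intro a
        rw [Function.iterate_succ_apply', ← hPv]
        exact (hc _ hv _ (hmem m) _ ih a).trans (le_of_eq (by rw [pow_succ]; field_simp))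
    ext1 a
    refine tendsto_nhds_unique ?_ (hu a)
    rw [tendsto_iff_norm_sub_tendsto_zero]
    refine squeeze_zero (fun _ => norm_nonneg _) (fun m => ?_) (hzero (2 * R))
    rw [norm_sub_rev]
    exact h1 m a

end FixedPoint

section Duhamel

variable {n : ℕ}

/-- The parabolically self-similar kernel of degree `-(n + 1)` with profile `κ`. -/
def selfSim (κ : Euc n → ℝ) (x : Euc n) (t : ℝ) : ℝ := (√t ^ (n + 1))⁻¹ * κ ((√t)⁻¹ • x)

/-- The Duhamel integral of a source `F` against the self-similar kernel with profile `κ`. -/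
def duhamel (κ : Euc n → ℝ) (F : Euc n → ℝ → ℝ) (x : Euc n) (t : ℝ) : ℝ :=
  ∫ s in Set.Ioo 0 t, ∫ y, selfSim κ (x - y) (t - s) * F y s

lemma integrable_selfSim {κ : Euc n → ℝ} (hκ : Integrable κ) (x : Euc n) {t : ℝ} (ht : 0 < t) :
    Integrable (fun y => selfSim κ (x - y) t) :=
  (integrable_comp_inv_sqrt_smul hκ ht x).const_mul _

lemma integral_abs_selfSim (κ : Euc n → ℝ) (x : Euc n) {t : ℝ} (ht : 0 < t) :
    ∫ y, |selfSim κ (x - y) t| = (√t)⁻¹ * ∫ y, |κ y| := by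
  have hs : 0 < √t := Real.sqrt_pos.2 ht
  simp only [selfSim, abs_mul]
  rw [integral_const_mul, integral_abs_comp_inv_sqrt_smul κ t x, abs_of_nonneg (by positivity),
    pow_succ]
  field_simp

lemma integrable_selfSim_mul {κ : Euc n → ℝ} (hκ : Integrable κ) {f : Euc n → ℝ}
    (hf : Measurable f) {Q : ℝ} (hQ : ∀ y, |f y| ≤ Q) (x : Euc n) {t : ℝ} (ht : 0 < t) :
    Integrable (fun y => selfSim κ (x - y) t * f y) :=
  (integrable_selfSim hκ x ht).mul_bdd hf.aestronglyMeasurable (Eventually.of_forall hQ)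

lemma abs_integral_selfSim_mul_le {κ : Euc n → ℝ} (hκ : Integrable κ) {f : Euc n → ℝ} {Q : ℝ}
    (hQ : ∀ y, |f y| ≤ Q) (x : Euc n) {t : ℝ} (ht : 0 < t) :
    |∫ y, selfSim κ (x - y) t * f y| ≤ Q * (∫ y, |κ y|) * (√t)⁻¹ := by
  have h1 : ‖∫ y, selfSim κ (x - y) t * f y‖ ≤ ∫ y, |selfSim κ (x - y) t| * Q := by
    refine norm_integral_le_of_norm_le ((integrable_selfSim hκ x ht).abs.mul_const Q)
      (Eventually.of_forall fun y => ?_)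
    rw [norm_mul]
    exact mul_le_mul_of_nonneg_left (hQ y) (abs_nonneg _)
  rw [integral_mul_const, integral_abs_selfSim κ x ht] at h1
  exact h1.trans (le_of_eq (by ring))

lemma integrableOn_inv_sqrt_sub (t : ℝ) :
    IntegrableOn (fun s => (√(t - s))⁻¹) (Set.Ioo 0 t) ∧
      (0 ≤ t → ∫ s in Set.Ioo 0 t, (√(t - s))⁻¹ = 2 * √t) := by
  rcases lt_or_ge t 0 with ht | ht
  · simp [Set.Ioo_eq_empty (not_lt.2 ht.le), not_le.2 ht]
  have h0 : ∀ s : ℝ, s ∈ Set.Ioo 0 t → (t - s) ^ (-(1 / 2) : ℝ) = (√(t - s))⁻¹ := fun s hs => by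
    rw [Real.rpow_neg (by linarith [hs.2]), Real.sqrt_eq_rpow]
  have h1 : IntervalIntegrable (fun s : ℝ => (t - s) ^ (-(1 / 2) : ℝ)) volume 0 t := by
    have := (intervalIntegral.intervalIntegrable_rpow' (a := 0) (b := t)
      (by norm_num : (-1 : ℝ) < -(1 / 2))).comp_sub_left t
    simpa using this.symm
  have h2 : ∫ s in (0 : ℝ)..t, (t - s) ^ (-(1 / 2) : ℝ) = 2 * √t := by
    rw [intervalIntegral.integral_comp_sub_left (fun s : ℝ => s ^ (-(1 / 2) : ℝ)),
      sub_self, sub_zero, integral_rpow (Or.inl (by norm_num)), Real.sqrt_eq_rpow]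
    norm_num
    ring
  rw [intervalIntegrable_iff_integrableOn_Ioo_of_le ht] at h1
  refine ⟨h1.congr_fun h0 measurableSet_Ioo, fun _ => ?_⟩
  rw [← h2, intervalIntegral.integral_of_le ht, integral_Ioc_eq_integral_Ioo]
  exact setIntegral_congr_fun measurableSet_Ioo fun s hs => (h0 s hs).symm

lemma measurable_integral_selfSim_mul {κ : Euc n → ℝ} (hκ : Measurable κ) {F : Euc n → ℝ → ℝ}
    (hF : Measurable fun q : Euc n × ℝ => F q.1 q.2) :
    Measurable fun r : (Euc n × ℝ) × ℝ => ∫ y, selfSim κ (r.1.1 - y) (r.1.2 - r.2) * F y r.2 := by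
  have h1 : Measurable fun p : ((Euc n × ℝ) × ℝ) × Euc n =>
      selfSim κ (p.1.1.1 - p.2) (p.1.1.2 - p.1.2) * F p.2 p.1.2 := by
    unfold selfSim
    have h2 : Measurable fun p : ((Euc n × ℝ) × ℝ) × Euc n => F p.2 p.1.2 :=
      hF.comp (measurable_snd.prodMk (measurable_snd.comp measurable_fst))
    fun_prop
  exact (h1.stronglyMeasurable.integral_prod_right').measurable

lemma measurable_duhamel {κ : Euc n → ℝ} (hκ : Measurable κ) {F : Euc n → ℝ → ℝ}
    (hF : Measurable fun q : Euc n × ℝ => F q.1 q.2) :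
    Measurable fun q : Euc n × ℝ => duhamel κ F q.1 q.2 := by
  have h1 := measurable_integral_selfSim_mul hκ hF
  have hs : MeasurableSet {r : (Euc n × ℝ) × ℝ | r.2 ∈ Set.Ioo 0 r.1.2} :=
    (measurableSet_lt measurable_const measurable_snd).inter
      (measurableSet_lt measurable_snd (measurable_snd.comp measurable_fst))
  have h2 := ((h1.indicator hs).stronglyMeasurable.integral_prod_right' (ν := volume)).measurable
  convert h2 using 2 with q
  rw [duhamel, ← integral_indicator measurableSet_Ioo]
  rfl

lemma integrableOn_duhamel {κ : Euc n → ℝ} (hκ : Measurable κ) (hκi : Integrable κ)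
    {F : Euc n → ℝ → ℝ} (hF : Measurable fun q : Euc n × ℝ => F q.1 q.2) {Q t : ℝ}
    (hQ : ∀ y, ∀ s ∈ Set.Ioo 0 t, |F y s| ≤ Q) (x : Euc n) :
    IntegrableOn (fun s => ∫ y, selfSim κ (x - y) (t - s) * F y s) (Set.Ioo 0 t) := by
  have hm : Measurable fun s => ∫ y, selfSim κ (x - y) (t - s) * F y s :=
    (measurable_integral_selfSim_mul hκ hF).comp
      (measurable_const.prodMk measurable_id : Measurable fun s : ℝ => ((x, t), s))
  refine ((integrableOn_inv_sqrt_sub t).1.const_mul (Q * ∫ y, |κ y|)).mono'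
    hm.aestronglyMeasurable ((ae_restrict_iff' measurableSet_Ioo).2 (Eventually.of_forall
      fun s hs => ?_))
  exact abs_integral_selfSim_mul_le hκi (fun y => hQ y s hs) x (sub_pos.2 hs.2)

lemma abs_duhamel_le {κ : Euc n → ℝ} (hκi : Integrable κ) {F : Euc n → ℝ → ℝ} {Q t : ℝ}
    (ht : 0 ≤ t) (hQ : ∀ y, ∀ s ∈ Set.Ioo 0 t, |F y s| ≤ Q) (x : Euc n) :
    |duhamel κ F x t| ≤ 2 * √t * (Q * ∫ y, |κ y|) := by
  obtain ⟨h1, h2⟩ := integrableOn_inv_sqrt_sub t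
  have h3 : ‖duhamel κ F x t‖ ≤ ∫ s in Set.Ioo 0 t, (Q * ∫ y, |κ y|) * (√(t - s))⁻¹ :=
    norm_integral_le_of_norm_le (h1.const_mul _) ((ae_restrict_iff' measurableSet_Ioo).2
      (Eventually.of_forall fun s hs =>
        abs_integral_selfSim_mul_le hκi (fun y => hQ y s hs) x (sub_pos.2 hs.2)))
  rw [integral_const_mul, h2 ht] at h3
  exact h3.trans (le_of_eq (by ring))

lemma measurable_slice {β : Type*} [MeasurableSpace β] {F : Euc n → ℝ → β}
    (hF : Measurable fun q : Euc n × ℝ => F q.1 q.2) (s : ℝ) : Measurable fun y => F y s :=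
  hF.comp (measurable_id.prodMk measurable_const)

lemma duhamel_sub {κ : Euc n → ℝ} (hκ : Measurable κ) (hκi : Integrable κ)
    {F H : Euc n → ℝ → ℝ} (hF : Measurable fun q : Euc n × ℝ => F q.1 q.2)
    (hH : Measurable fun q : Euc n × ℝ => H q.1 q.2) {Q t : ℝ}
    (hFQ : ∀ y, ∀ s ∈ Set.Ioo 0 t, |F y s| ≤ Q) (hHQ : ∀ y, ∀ s ∈ Set.Ioo 0 t, |H y s| ≤ Q)
    (x : Euc n) :
    duhamel κ F x t - duhamel κ H x t = duhamel κ (fun y s => F y s - H y s) x t := by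
  rw [duhamel, duhamel, ← integral_sub (integrableOn_duhamel hκ hκi hF hFQ x)
    (integrableOn_duhamel hκ hκi hH hHQ x)]
  refine setIntegral_congr_fun measurableSet_Ioo fun s hs => ?_
  have hts := sub_pos.2 hs.2
  beta_reduce
  rw [← integral_sub
    (integrable_selfSim_mul hκi (measurable_slice hF s)
      (fun y => hFQ y s hs) x hts)
    (integrable_selfSim_mul hκi (measurable_slice hH s)
      (fun y => hHQ y s hs) x hts)]
  simp only [mul_sub]

lemma abs_integral_heatKer_mul_le {f : Euc n → ℝ} {N : ℝ} (hf : ∀ y, |f y| ≤ N) {t : ℝ}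
    (ht : 0 < t) (x : Euc n) :
    |∫ y, heatKer n (x - y) t * f y| ≤ N * ∫ y : Euc n, heatKer n y 1 := by
  have hs : 0 < √t := Real.sqrt_pos.2 ht
  have hG := (isGaussPoly_heatKer (n := n)).rapidDecay.integrable
  have h1 : ‖∫ y, heatKer n (x - y) t * f y‖ ≤
      ∫ y, (√t ^ n)⁻¹ * |heatKer n ((√t)⁻¹ • (x - y)) 1| * N := by
    refine norm_integral_le_of_norm_le
      (((integrable_comp_inv_sqrt_smul hG ht x).abs.const_mul _).mul_const N)
      (Eventually.of_forall fun y => ?_)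
    rw [norm_mul, heatKer_eq ht, norm_mul, Real.norm_of_nonneg (by positivity)]
    exact mul_le_mul_of_nonneg_left (hf y) (by positivity)
  rw [integral_mul_const, integral_const_mul,
    integral_abs_comp_inv_sqrt_smul (fun y => heatKer n y 1) t x,
    inv_mul_cancel_left₀ (by positivity)] at h1
  simp only [abs_of_nonneg (heatKer_one_nonneg _)] at h1
  exact h1.trans (le_of_eq (mul_comm _ _))

lemma measurable_integral_heatKer_mul {f : Euc n → ℝ} (hf : Measurable f) :
    Measurable fun q : Euc n × ℝ => ∫ y, heatKer n (q.1 - y) q.2 * f y := by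
  have h1 : Measurable fun p : (Euc n × ℝ) × Euc n => heatKer n (p.1.1 - p.2) p.1.2 * f p.2 := by
    unfold heatKer
    fun_prop
  exact (h1.stronglyMeasurable.integral_prod_right').measurable

end Duhamel

section Picard

variable {n : ℕ}

/-- The profile of the Oseen kernel `K_{ijk}`. -/
def oseenProfile (n : ℕ) (i j k : Fin n) (x : Euc n) : ℝ := Kten n i j k x 1

lemma measurable_oseenProfile (i j k : Fin n) : Measurable (oseenProfile n i j k) :=
  measurable_pd k _

lemma integrable_oseenProfile (hn : 2 ≤ n) (i j k : Fin n) : Integrable (oseenProfile n i j k) :=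
  integrable_Kten_one hn i j k

lemma Kten_eq_selfSim (hn : 2 ≤ n) (i j k : Fin n) {t : ℝ} (ht : 0 < t) (x : Euc n) :
    Kten n i j k x t = selfSim (oseenProfile n i j k) x t :=
  Kten_eq hn i j k ht x

/-- The right-hand side of the mild formulation. -/
def mildRhs (n : ℕ) (u₀ : Euc n → Euc n) (u : Euc n → ℝ → Euc n) (x : Euc n) (t : ℝ) : Euc n :=
  WithLp.toLp 2 fun i => (∫ y : Euc n, heatKer n (x - y) t * u₀ y i) -
    ∑ j : Fin n, ∑ k : Fin n, duhamel (oseenProfile n i j k) (fun y s => u y s k * u y s j) x t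

lemma measurable_coord_mul {u : Euc n → ℝ → Euc n}
    (hu : Measurable fun q : Euc n × ℝ => u q.1 q.2) (j k : Fin n) :
    Measurable fun q : Euc n × ℝ => u q.1 q.2 k * u q.1 q.2 j := by
  fun_prop

lemma abs_coord_mul_le {v : Euc n} {R : ℝ} (hv : ‖v‖ ≤ R) (j k : Fin n) :
    |v k * v j| ≤ R ^ 2 := by
  have hj := (PiLp.norm_apply_le v j).trans hv
  have hk := (PiLp.norm_apply_le v k).trans hv
  rw [abs_mul, sq]
  exact mul_le_mul hk hj (abs_nonneg _) ((abs_nonneg _).trans hk)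

lemma abs_coord_mul_sub_le {v w : Euc n} {R δ : ℝ} (hv : ‖v‖ ≤ R) (hw : ‖w‖ ≤ R)
    (h : ‖v - w‖ ≤ δ) (j k : Fin n) : |v k * v j - w k * w j| ≤ 2 * R * δ := by
  have h1 : |v k| ≤ R := (PiLp.norm_apply_le v k).trans hv
  have h2 : |w j| ≤ R := (PiLp.norm_apply_le w j).trans hw
  have h3 : |v j - w j| ≤ δ := (PiLp.norm_apply_le (v - w) j).trans h
  have h4 : |v k - w k| ≤ δ := (PiLp.norm_apply_le (v - w) k).trans h
  have hR : 0 ≤ R := (norm_nonneg _).trans hv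
  have hδ : 0 ≤ δ := (norm_nonneg _).trans h
  calc |v k * v j - w k * w j| = |v k * (v j - w j) + (v k - w k) * w j| := by ring_nf
    _ ≤ |v k| * |v j - w j| + |v k - w k| * |w j| := by
        rw [← abs_mul, ← abs_mul]; exact abs_add_le _ _
    _ ≤ R * δ + δ * R := by gcongr
    _ = _ := by ring

lemma norm_le_sum_abs (v : Euc n) : ‖v‖ ≤ ∑ i, |v i| := by
  have hv : v = ∑ i, v i • EuclideanSpace.single i (1 : ℝ) := by
    ext j; simp [Finset.sum_apply, Pi.single_apply]
  conv_lhs => rw [hv]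
  refine (norm_sum_le _ _).trans (le_of_eq ?_)
  simp [norm_smul]

lemma norm_le_card_mul {v : Euc n} {a : ℝ} (h : ∀ i, |v i| ≤ a) : ‖v‖ ≤ n * a := by
  refine (norm_le_sum_abs v).trans ((Finset.sum_le_sum fun i _ => h i).trans ?_)
  simp

lemma abs_sum_sum_le {f : Fin n → Fin n → ℝ} {a : ℝ} (h : ∀ j k, |f j k| ≤ a) :
    |∑ j, ∑ k, f j k| ≤ n ^ 2 * a := by
  have h1 : ∀ j, |∑ k, f j k| ≤ n * a := fun j =>
    (Finset.abs_sum_le_sum_abs _ _).trans ((Finset.sum_le_sum fun k _ => h j k).trans (by simp))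
  refine (Finset.abs_sum_le_sum_abs _ _).trans ((Finset.sum_le_sum fun j _ => h1 j).trans ?_)
  simp only [Finset.sum_const, Finset.card_univ, Fintype.card_fin, nsmul_eq_mul]
  exact le_of_eq (by ring)

lemma measurable_mildRhs {u₀ : Euc n → Euc n} {u : Euc n → ℝ → Euc n} (hu₀ : Measurable u₀)
    (hu : Measurable fun q : Euc n × ℝ => u q.1 q.2) :
    Measurable fun q : Euc n × ℝ => mildRhs n u₀ u q.1 q.2 := by
  refine (WithLp.measurable_toLp 2 _).comp (measurable_pi_lambda _ fun i => ?_)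
  refine Measurable.sub (measurable_integral_heatKer_mul (by fun_prop)) ?_
  exact Finset.measurable_fun_sum _ fun j _ => Finset.measurable_fun_sum _ fun k _ =>
    measurable_duhamel (measurable_oseenProfile i j k) (measurable_coord_mul hu j k)

lemma mildRhs_apply (hn : 2 ≤ n) {u₀ : Euc n → Euc n} {u : Euc n → ℝ → Euc n}
    (hu : Measurable fun q : Euc n × ℝ => u q.1 q.2) {R t : ℝ}
    (hR : ∀ y, ∀ s ∈ Set.Ioo 0 t, ‖u y s‖ ≤ R) (x : Euc n) (i : Fin n) :
    mildRhs n u₀ u x t i = (∫ y : Euc n, heatKer n (x - y) (t - 0) * u₀ y i)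
      - ∫ s in Set.Ioo 0 t, ∫ y : Euc n,
          ∑ j : Fin n, ∑ k : Fin n, Kten n i j k (x - y) (t - s) * u y s k * u y s j := by
  have hQ : ∀ j k : Fin n, ∀ y, ∀ s ∈ Set.Ioo 0 t, |u y s k * u y s j| ≤ R ^ 2 :=
    fun j k y s hs => abs_coord_mul_le (hR y s hs) j k
  have hm := measurable_oseenProfile (n := n) i
  have hi : ∀ j k, Integrable (oseenProfile n i j k) := integrable_oseenProfile hn i
  have h1 : ∀ j k, IntegrableOn (fun s => ∫ y, selfSim (oseenProfile n i j k) (x - y) (t - s) *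
      (u y s k * u y s j)) (Set.Ioo 0 t) := fun j k =>
    integrableOn_duhamel (hm j k) (hi j k) (measurable_coord_mul hu j k) (hQ j k) x
  have h2 : ∀ s ∈ Set.Ioo 0 t, ∀ j k, Integrable fun y =>
      selfSim (oseenProfile n i j k) (x - y) (t - s) * (u y s k * u y s j) := fun s hs j k =>
    integrable_selfSim_mul (hi j k)
      (measurable_slice (F := fun y s => u y s k * u y s j) (measurable_coord_mul hu j k) s)
      (fun y => hQ j k y s hs) x (sub_pos.2 hs.2)
  simp only [mildRhs, sub_zero]
  refine congrArg₂ _ rfl ?_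
  unfold duhamel
  simp_rw [← integral_finsetSum _ fun k _ => h1 _ k]
  rw [← integral_finsetSum _ fun j _ => integrable_finsetSum _ fun k _ => h1 j k]
  refine setIntegral_congr_fun measurableSet_Ioo fun s hs => ?_
  beta_reduce
  simp_rw [← integral_finsetSum _ fun k _ => h2 s hs _ k]
  rw [← integral_finsetSum _ fun j _ => integrable_finsetSum _ fun k _ => h2 s hs j k]
  simp only [Kten_eq_selfSim hn i _ _ (sub_pos.2 hs.2), mul_assoc]

lemma isMildNS_iff (hn : 2 ≤ n) {u₀ : Euc n → Euc n} {u : Euc n → ℝ → Euc n} {T R : ℝ}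
    (hu : Measurable fun q : Euc n × ℝ => u q.1 q.2)
    (hR : ∀ x, ∀ t ∈ Set.Ioo 0 T, ‖u x t‖ ≤ R) :
    IsMildNS n 0 T u₀ u ↔ ∀ x, ∀ t ∈ Set.Ioo 0 T, u x t = mildRhs n u₀ u x t := by
  have h : ∀ x, ∀ t ∈ Set.Ioo 0 T, ∀ i, mildRhs n u₀ u x t i = _ := fun x t ht i =>
    mildRhs_apply hn (u₀ := u₀) hu (fun y s hs => hR y s ⟨hs.1, hs.2.trans ht.2⟩) x i
  constructor
  · intro hm x t ht
    ext i
    rw [hm x t ht i, h x t ht i]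
  · intro hm x t ht i
    rw [← h x t ht i, ← hm x t ht]

lemma norm_mildRhs_le (hn : 2 ≤ n) {u₀ : Euc n → Euc n} {u : Euc n → ℝ → Euc n} {M N R t : ℝ}
    (hM : ∀ i j k, ∫ y, |oseenProfile n i j k y| ≤ M) (hN : ∀ x, ‖u₀ x‖ ≤ N) (ht : 0 < t)
    (hR : ∀ y, ∀ s ∈ Set.Ioo 0 t, ‖u y s‖ ≤ R) (x : Euc n) :
    ‖mildRhs n u₀ u x t‖ ≤
      n * (N * (∫ y : Euc n, heatKer n y 1) + n ^ 2 * (2 * √t * (R ^ 2 * M))) := by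
  refine norm_le_card_mul fun i => (abs_sub _ _).trans (add_le_add ?_ (abs_sum_sum_le fun j k => ?_))
  · exact abs_integral_heatKer_mul_le (fun y => (PiLp.norm_apply_le (u₀ y) i).trans (hN y)) ht x
  · refine (abs_duhamel_le (integrable_oseenProfile hn i j k) ht.le
      (fun y s hs => abs_coord_mul_le (hR y s hs) j k) x).trans ?_
    have := hM i j k
    gcongr

lemma norm_mildRhs_sub_le (hn : 2 ≤ n) {u₀ : Euc n → Euc n} {u v : Euc n → ℝ → Euc n}
    {M R δ t : ℝ} (hM : ∀ i j k, ∫ y, |oseenProfile n i j k y| ≤ M) (ht : 0 < t)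
    (hu : Measurable fun q : Euc n × ℝ => u q.1 q.2)
    (hv : Measurable fun q : Euc n × ℝ => v q.1 q.2)
    (huR : ∀ y, ∀ s ∈ Set.Ioo 0 t, ‖u y s‖ ≤ R) (hvR : ∀ y, ∀ s ∈ Set.Ioo 0 t, ‖v y s‖ ≤ R)
    (hδ : ∀ y, ∀ s ∈ Set.Ioo 0 t, ‖u y s - v y s‖ ≤ δ) (x : Euc n) :
    ‖mildRhs n u₀ u x t - mildRhs n u₀ v x t‖ ≤ n * (n ^ 2 * (2 * √t * (2 * R * δ * M))) := by
  have hs : t / 2 ∈ Set.Ioo 0 t := ⟨by linarith, by linarith⟩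
  have hR0 : 0 ≤ R := (norm_nonneg _).trans (huR 0 _ hs)
  have hδ0 : 0 ≤ δ := (norm_nonneg _).trans (hδ 0 _ hs)
  refine norm_le_card_mul fun i => ?_
  simp only [mildRhs, PiLp.sub_apply, sub_sub_sub_cancel_left, ← Finset.sum_sub_distrib]
  refine abs_sum_sum_le fun j k => ?_
  rw [duhamel_sub (measurable_oseenProfile i j k) (integrable_oseenProfile hn i j k)
    (measurable_coord_mul hv j k) (measurable_coord_mul hu j k)
    (fun y s hs => abs_coord_mul_le (hvR y s hs) j k)
    (fun y s hs => abs_coord_mul_le (huR y s hs) j k)]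
  refine (abs_duhamel_le (integrable_oseenProfile hn i j k) ht.le (Q := 2 * R * δ)
    (fun y s hs => ?_) x).trans ?_
  · exact abs_coord_mul_sub_le (hvR y s hs) (huR y s hs)
      (by rw [norm_sub_rev]; exact hδ y s hs) j k
  · have := hM i j k
    gcongr

lemma duhamel_congr {κ : Euc n → ℝ} {F H : Euc n → ℝ → ℝ} {t : ℝ}
    (h : ∀ y, ∀ s ∈ Set.Ioo 0 t, F y s = H y s) (x : Euc n) :
    duhamel κ F x t = duhamel κ H x t :=
  setIntegral_congr_fun measurableSet_Ioo fun s hs => by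
    beta_reduce
    simp only [h _ s hs]

lemma mildRhs_congr {u₀ : Euc n → Euc n} {u v : Euc n → ℝ → Euc n} {t : ℝ}
    (h : ∀ y, ∀ s ∈ Set.Ioo 0 t, u y s = v y s) (x : Euc n) :
    mildRhs n u₀ u x t = mildRhs n u₀ v x t := by
  ext i
  simp only [mildRhs]
  congr 1
  exact Finset.sum_congr rfl fun j _ => Finset.sum_congr rfl fun k _ =>
    duhamel_congr (fun y s hs => by rw [h y s hs]) x

/-- Unique solvability of the mild formulation in a ball on which the Picard map is a
contraction. -/
lemma existsUnique_mild (hn : 2 ≤ n) {u₀ : Euc n → Euc n} {M N R T : ℝ}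
    (hM : ∀ i j k, ∫ y, |oseenProfile n i j k y| ≤ M) (hM0 : 0 ≤ M) (hu₀ : Measurable u₀)
    (hN : ∀ x, ‖u₀ x‖ ≤ N) (hR0 : 0 ≤ R)
    (hball : n * (N * (∫ y : Euc n, heatKer n y 1) + n ^ 2 * (2 * √T * (R ^ 2 * M))) ≤ R)
    (hcontr : n * (n ^ 2 * (2 * √T * (2 * R * M))) ≤ 1 / 2) :
    ∃ u : Euc n → ℝ → Euc n,
      Measurable (fun q : Euc n × ℝ => u q.1 q.2) ∧
      (∀ x, ∀ t ∈ Set.Ioo 0 T, ‖u x t‖ ≤ R) ∧ IsMildNS n 0 T u₀ u ∧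
      ∀ v : Euc n → ℝ → Euc n, Measurable (fun q : Euc n × ℝ => v q.1 q.2) →
        (∀ x, ∀ t ∈ Set.Ioo 0 T, ‖v x t‖ ≤ R) → IsMildNS n 0 T u₀ v →
        ∀ x, ∀ t ∈ Set.Ioo 0 T, v x t = u x t := by
  let S : Set (Euc n × ℝ → Euc n) := {f | Measurable f ∧ ∀ q, ‖f q‖ ≤ R}
  let D : Set (Euc n × ℝ) := {q | q.2 ∈ Set.Ioo 0 T}
  let P : (Euc n × ℝ → Euc n) → Euc n × ℝ → Euc n := fun f =>
    D.indicator fun q => mildRhs n u₀ (fun x t => f (x, t)) q.1 q.2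
  have hD : MeasurableSet D := measurable_snd measurableSet_Ioo
  have hsqrt : ∀ q ∈ D, √q.2 ≤ √T := fun q hq => Real.sqrt_le_sqrt hq.2.le
  have hPin : ∀ f, ∀ q ∈ D, P f q = mildRhs n u₀ (fun x t => f (x, t)) q.1 q.2 :=
    fun f q hq => Set.indicator_of_mem hq _
  have hPout : ∀ f, ∀ q ∉ D, P f q = 0 := fun f q hq => Set.indicator_of_notMem hq _
  obtain ⟨u, ⟨hum, huR⟩, huP, huniq⟩ := existsUnique_fixedPoint_of_contracting (S := S) (P := P)
    (R := R) (u₀ := fun _ => 0) ⟨measurable_const, fun _ => by simpa using hR0⟩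
    (fun f hf => ⟨(measurable_mildRhs hu₀ (u := fun x t => f (x, t)) hf.1).indicator hD,
      fun q => by
        by_cases hq : q ∈ D
        · rw [hPin f q hq]
          refine ((norm_mildRhs_le hn hM hN hq.1 (fun y s _ => hf.2 (y, s)) q.1).trans ?_).trans
            hball
          have := hsqrt q hq
          gcongr
        · rw [hPout f q hq]; simpa using hR0⟩)
    (fun f hf u hu => ⟨measurable_of_tendsto_metrizable (fun m => (hf m).1) hu, fun q =>
      le_of_tendsto (tendsto_pi_nhds.1 hu q).norm (Eventually.of_forall fun m => (hf m).2 q)⟩)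
    (fun f hf => hf.2)
    (fun f hf g hg δ hδ q => by
      have hδ0 : 0 ≤ δ := (norm_nonneg _).trans (hδ q)
      by_cases hq : q ∈ D
      · rw [hPin f q hq, hPin g q hq]
        refine (norm_mildRhs_sub_le hn hM hq.1 (u := fun x t => f (x, t))
          (v := fun x t => g (x, t)) hf.1 hg.1 (fun y s _ => hf.2 (y, s))
          (fun y s _ => hg.2 (y, s)) (fun y s _ => hδ (y, s)) q.1).trans ?_
        have := hsqrt q hq
        calc n * (n ^ 2 * (2 * √q.2 * (2 * R * δ * M)))
            ≤ n * (n ^ 2 * (2 * √T * (2 * R * δ * M))) := by gcongr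
          _ = n * (n ^ 2 * (2 * √T * (2 * R * M))) * δ := by ring
          _ ≤ 1 / 2 * δ := by gcongr
          _ = δ / 2 := by ring
      · rw [hPout f q hq, hPout g q hq, sub_zero, norm_zero]
        positivity)
  have huR' : ∀ x, ∀ t ∈ Set.Ioo 0 T, ‖u (x, t)‖ ≤ R := fun x t _ => huR (x, t)
  refine ⟨fun x t => u (x, t), hum, huR', (isMildNS_iff hn hum huR').2 fun x t ht => ?_,
    fun v hv hvR hmild x t ht => ?_⟩
  · have h1 := congrFun huP (x, t)
    rw [← h1]
    exact hPin u (x, t) ht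
  · let w : Euc n × ℝ → Euc n := D.indicator fun q => v q.1 q.2
    have hw : ∀ y, ∀ s ∈ Set.Ioo 0 T, w (y, s) = v y s := fun y s hs =>
      Set.indicator_of_mem (show (y, s) ∈ D from hs) _
    have hwout : ∀ q ∉ D, w q = 0 := fun q hq => Set.indicator_of_notMem hq _
    have hwS : w ∈ S := ⟨hv.indicator hD, fun q => by
      by_cases hq : q ∈ D
      · exact (hw q.1 q.2 hq).symm ▸ hvR q.1 q.2 hq
      · rw [hwout q hq]; simpa using hR0⟩
    have hwP : P w = w := by
      ext1 q
      by_cases hq : q ∈ D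
      · rw [hPin w q hq, mildRhs_congr (fun y s hs => hw y s ⟨hs.1, hs.2.trans hq.2⟩),
          ← (isMildNS_iff hn hv hvR).1 hmild q.1 q.2 hq]
        exact (hw q.1 q.2 hq).symm
      · exact (hPout w q hq).trans (hwout q hq).symm
    rw [← hw x t ht, huniq w hwS hwP]

end Picard

/-- Local-in-time existence and uniqueness of mild solutions of the Navier–Stokes
equations with bounded divergence-free initial data: there are ε₀(n), C₀(n) > 0 such that
for N = ‖u₀‖_∞ > 0 and T = ε₀ N⁻², there is a mild solution with ‖u‖_∞ ≤ C₀ N, unique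
in the ball of radius C₀ N of L^∞(ℝⁿ×(0,T)). -/
theorem ns_local_existence_uniqueness (n : ℕ) (hn : 2 ≤ n) :
    ∃ ε₀ > (0:ℝ), ∃ C₀ > (0:ℝ), ∀ (u₀ : Euc n → Euc n) (N : ℝ),
      Measurable u₀ → 0 < N →
      (∀ x : Euc n, ‖u₀ x‖ ≤ N) →
      -- u₀ is divergence-free in the sense of distributions
      (∀ ψ : Euc n → ℝ, ContDiff ℝ (⊤ : ℕ∞) ψ → HasCompactSupport ψ →
        (∫ x : Euc n, ∑ i : Fin n, u₀ x i * pd n i ψ x) = 0) →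
      ∃ u : Euc n → ℝ → Euc n,
        Measurable (fun q : Euc n × ℝ => u q.1 q.2) ∧
        (∀ x : Euc n, ∀ t ∈ Set.Ioo 0 (ε₀ * N⁻¹ ^ 2), ‖u x t‖ ≤ C₀ * N) ∧
        IsMildNS n 0 (ε₀ * N⁻¹ ^ 2) u₀ u ∧
        (∀ v : Euc n → ℝ → Euc n,
          Measurable (fun q : Euc n × ℝ => v q.1 q.2) →
          (∀ x : Euc n, ∀ t ∈ Set.Ioo 0 (ε₀ * N⁻¹ ^ 2), ‖v x t‖ ≤ C₀ * N) →
          IsMildNS n 0 (ε₀ * N⁻¹ ^ 2) u₀ v →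
          ∀ x : Euc n, ∀ t ∈ Set.Ioo 0 (ε₀ * N⁻¹ ^ 2), v x t = u x t) := by
  have hI : 0 ≤ ∫ y : Euc n, heatKer n y 1 := integral_nonneg heatKer_one_nonneg
  have hκ : ∀ i j k, 0 ≤ ∫ y, |oseenProfile n i j k y| := fun i j k =>
    integral_nonneg fun _ => abs_nonneg _
  obtain ⟨M, hM0, hM⟩ : ∃ M, 0 < M ∧ ∀ i j k, ∫ y, |oseenProfile n i j k y| ≤ M := by
    refine ⟨1 + ∑ p : Fin n × Fin n × Fin n, ∫ y, |oseenProfile n p.1 p.2.1 p.2.2 y|, ?_, ?_⟩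
    · have := Finset.sum_nonneg fun (p : Fin n × Fin n × Fin n) (_ : p ∈ Finset.univ) =>
        hκ p.1 p.2.1 p.2.2
      linarith
    · intro i j k
      have := Finset.single_le_sum (f := fun p : Fin n × Fin n × Fin n =>
        ∫ y, |oseenProfile n p.1 p.2.1 p.2.2 y|) (fun p _ => hκ p.1 p.2.1 p.2.2)
        (Finset.mem_univ (i, j, k))
      dsimp only at this
      linarith
  have hn0 : (0 : ℝ) < n := by exact_mod_cast (by omega : 0 < n)
  obtain ⟨C, hC⟩ : ∃ C, C = 2 * (n * ∫ y : Euc n, heatKer n y 1) + 1 := ⟨_, rfl⟩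
  have hC0 : 0 < C := by rw [hC]; positivity
  obtain ⟨e, he⟩ : ∃ e, e = (8 * (n * n ^ 2 * M) * C)⁻¹ := ⟨_, rfl⟩
  have he0 : 0 < e := by rw [he]; positivity
  have heC : 8 * (n * n ^ 2 * M) * C * e = 1 := by rw [he]; field_simp
  refine ⟨e ^ 2, by positivity, C, hC0, fun u₀ N hu₀ hN hbd _ => ?_⟩
  have hsqrt : √(e ^ 2 * N⁻¹ ^ 2) = e * N⁻¹ := by
    rw [← mul_pow, Real.sqrt_sq (by positivity)]
  have hNN : N⁻¹ * N = 1 := inv_mul_cancel₀ hN.ne'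
  refine existsUnique_mild hn hM hM0.le hu₀ hbd (by positivity) ?_ ?_
  · rw [hsqrt]
    have h1 : (n : ℝ) * (n ^ 2 * (2 * (e * N⁻¹) * ((C * N) ^ 2 * M))) = C * N / 4 := by
      linear_combination (C * N / 4) * heC + 2 * n * n ^ 2 * e * C ^ 2 * N * M * hNN
    have h2 : (n : ℝ) * (N * ∫ y : Euc n, heatKer n y 1) ≤ C * N / 2 := by
      rw [hC]; linarith
    rw [mul_add, h1]
    have := mul_pos hC0 hN
    linarith
  · rw [hsqrt]
    have h1 : (n : ℝ) * (n ^ 2 * (2 * (e * N⁻¹) * (2 * (C * N) * M))) = 1 / 2 := by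
      linear_combination (1 / 2) * heC + 4 * n * n ^ 2 * e * C * M * hNN
    exact h1.le


end
end
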